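/- Let Σ be a complete (⋃_{σ∈Σ} σ = ℝ^n) non-singular fan in ℝ^n satisfying condition (2.9.2), and let Σ_1 be a fan in ℝ^n with Σ(1) ⊆ Σ_1 ⊊ Σ, where Σ(1) is the set of one-dimensional cones of Σ (so Σ_1 has the same primitive generators n_1,…,n_r, and condition (2.9.1) holds for Σ_1). Then for every r-tuple D = (d_1,…,d_r) of positive integers: (i) the map j_D : Pol*_D(S¹,X_{Σ_1}) → ΩU(K_{Σ_1}) (the lift of i_D when ∑_k d_k n_k = 0, and the composite j_{D_0} ∘ s_{D,D_0} otherwise) is a homotopy equivalence through dimension d(D,Σ_1) = 2(r_min(Σ_1)−1)·d_min − 2; and (ii) the map i_D = (Ωq_{Σ_1}) ∘ j_D : Pol*_D(S¹,X_{Σ_1}) → ΩX_{Σ_1} induces an isomorphism (i_D)_* : π_k(Pol*_D(S¹,X_{Σ_1})) → π_k(ΩX_{Σ_1}) ≅ π_{k+1}(X_{Σ_1}) for every 2 ≤ k ≤ d(D,Σ_1). -/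

import Mathlib

open scoped BigOperators
attribute [local instance] Classical.propDecidable

noncomputable section

namespace Toric


/-! ### Cones and fans -/

/-- The real vector associated to an integer vector. -/
def zr {n : ℕ} (v : Fin n → ℤ) : Fin n → ℝ := fun i => (v i : ℝ)

/-- A convex rational polyhedral cone in `ℝ^n`. -/
def IsRatCone {n : ℕ} (σ : Set (Fin n → ℝ)) : Prop :=
  ∃ s : Finset (Fin n → ℤ),
    σ = {x | ∃ lam : (Fin n → ℤ) → ℝ, (∀ v, 0 ≤ lam v) ∧ x = ∑ v ∈ s, lam v • zr v}

/-- A cone is strongly convex if `σ ∩ (-σ) = {0}`. -/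
def StronglyConvex {n : ℕ} (σ : Set (Fin n → ℝ)) : Prop := σ ∩ (-σ) = {0}

/-- `τ` is a face of `σ`, cut out by a linear form nonnegative on `σ`. -/
def IsFaceOf {n : ℕ} (τ σ : Set (Fin n → ℝ)) : Prop :=
  ∃ L : (Fin n → ℝ) →ₗ[ℝ] ℝ, (∀ x ∈ σ, 0 ≤ L x) ∧ τ = σ ∩ {x | L x = 0}

/-- A fan in `ℝ^n`: a finite collection of strongly convex rational polyhedral cones,
closed under taking faces, such that the intersection of two cones is a face of each;
we also require that it strictly contains `{0}`. -/
structure Fan (n : ℕ) where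
  cones : Set (Set (Fin n → ℝ))
  finite : cones.Finite
  ratCone : ∀ σ ∈ cones, IsRatCone σ
  stronglyConvex : ∀ σ ∈ cones, StronglyConvex σ
  face_mem : ∀ σ ∈ cones, ∀ τ, IsFaceOf τ σ → τ ∈ cones
  inter_face : ∀ σ ∈ cones, ∀ τ ∈ cones, IsFaceOf (σ ∩ τ) σ
  zero_mem : ({0} : Set (Fin n → ℝ)) ∈ cones
  nontrivial : cones ≠ {({0} : Set (Fin n → ℝ))}

/-- A fan is complete if its cones cover `ℝ^n`. -/
def Fan.Complete {n : ℕ} (F : Fan n) : Prop := ⋃₀ F.cones = Set.univ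

/-- A fan is non-singular if each of its cones is spanned by part of a `ℤ`-basis of `ℤ^n`. -/
def Fan.NonSingular {n : ℕ} (F : Fan n) : Prop :=
  ∀ σ ∈ F.cones, ∃ (b : Module.Basis (Fin n) ℤ (Fin n → ℤ)) (s : Finset (Fin n)),
    σ = {x | ∃ lam : Fin n → ℝ, (∀ i, 0 ≤ lam i) ∧ x = ∑ i ∈ s, lam i • zr (b i)}

/-- The ray (one-dimensional cone) generated by a vector. -/
def ray {n : ℕ} (v : Fin n → ℝ) : Set (Fin n → ℝ) := {x | ∃ t : ℝ, 0 ≤ t ∧ x = t • v}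

/-- The cone spanned by the vectors `n_i`, `i ∈ s`. -/
def coneIdx {n r : ℕ} (N : Fin r → Fin n → ℤ) (s : Finset (Fin r)) : Set (Fin n → ℝ) :=
  {x | ∃ lam : Fin r → ℝ, (∀ i, 0 ≤ lam i) ∧ x = ∑ i ∈ s, lam i • zr (N i)}

/-- A point of `ℝ^n` lying in the lattice `ℤ^n`. -/
def IsLatticePoint {n : ℕ} (x : Fin n → ℝ) : Prop := ∀ i, ∃ m : ℤ, x i = (m : ℝ)

/-- `N 1, …, N r` is the (complete, repetition-free) list of primitive generators of the
one-dimensional cones of the fan `F`. -/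
structure IsPrimGens {n r : ℕ} (F : Fan n) (N : Fin r → Fin n → ℤ) : Prop where
  ray_mem : ∀ k, ray (zr (N k)) ∈ F.cones
  ne_zero : ∀ k, N k ≠ 0
  primitive : ∀ k, ray (zr (N k)) ∩ {x | IsLatticePoint x}
      = {x | ∃ c : ℕ, x = (c : ℝ) • zr (N k)}
  inj : Function.Injective N
  complete : ∀ σ ∈ F.cones, Module.finrank ℝ (Submodule.span ℝ σ) = 1 →
      ∃ k, σ = ray (zr (N k))

/-- Condition (2.9.1): a positive integral relation among the primitive generators. -/
def Cond1 {n r : ℕ} (N : Fin r → Fin n → ℤ) : Prop :=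
  ∃ d : Fin r → ℕ, (∀ k, 0 < d k) ∧ ∑ k, (d k : ℤ) • N k = 0

/-- Condition (2.9.2): the primitive generators span `ℤ^n` over `ℤ`. -/
def Cond2 {n r : ℕ} (N : Fin r → Fin n → ℤ) : Prop :=
  Submodule.span ℤ (Set.range N) = ⊤

/-- The underlying simplicial complex `K_Σ` of a fan. -/
def KC {n r : ℕ} (F : Fan n) (N : Fin r → Fin n → ℤ) : Set (Finset (Fin r)) :=
  {s | coneIdx N s ∈ F.cones}

/-- A primitive set: it spans no cone of the fan, but every proper subset does. -/
def PrimitiveSet {r : ℕ} (K : Set (Finset (Fin r))) (s : Finset (Fin r)) : Prop :=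
  s ∉ K ∧ ∀ t ⊂ s, t ∈ K

/-- `r_min`: the minimal cardinality of a primitive set. -/
def rmin {r : ℕ} (K : Set (Finset (Fin r))) : ℕ :=
  sInf {m | ∃ s : Finset (Fin r), PrimitiveSet K s ∧ s.card = m}

/-- `d_min = min {d_1, …, d_r}`. -/
def dmin {r : ℕ} (D : Fin r → ℕ) : ℕ := sInf (Set.range D)

/-- The stability dimension `d(D,Σ) = 2(r_min − 1) d_min − 2`. -/
def dBound {r : ℕ} (K : Set (Finset (Fin r))) (D : Fin r → ℕ) : ℤ :=
  2 * ((rmin K : ℤ) - 1) * (dmin D : ℤ) - 2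

/-- The connectivity bound `C_D(Σ) = 2(r_min − 1) d_min − 1`. -/
def CBound {r : ℕ} (K : Set (Finset (Fin r))) (D : Fin r → ℕ) : ℤ :=
  2 * ((rmin K : ℤ) - 1) * (dmin D : ℤ) - 1

/-! ### Coordinate subspaces, `U(K)`, `G_Σ` and the toric quotient -/

/-- The coordinate subspace `L_σ ⊆ ℂ^r`. -/
def LSub {r : ℕ} (σ : Finset (Fin r)) : Set (Fin r → ℂ) := {x | ∀ i ∈ σ, x i = 0}

/-- The complement `U(K)` of the coordinate subspace arrangement of type `K`. -/
def UK {r : ℕ} (K : Set (Finset (Fin r))) : Set (Fin r → ℂ) :=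
  (⋃ σ ∈ {s : Finset (Fin r) | s ∉ K}, LSub σ)ᶜ

lemma mem_UK {r : ℕ} {K : Set (Finset (Fin r))} {x : Fin r → ℂ} :
    x ∈ UK K ↔ ∀ σ : Finset (Fin r), σ ∉ K → ∃ i ∈ σ, x i ≠ 0 := by
  constructor
  · intro h σ hσ
    by_contra hc
    push_neg at hc
    exact h (Set.mem_biUnion hσ (fun i hi => hc i hi))
  · intro h hx
    rcases Set.mem_iUnion₂.1 hx with ⟨σ, hσ, hxσ⟩
    rcases h σ hσ with ⟨i, hi, hne⟩
    exact hne (hxσ i hi)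

/-- The group `G_Σ` (as a subset of `ℂ^r`). -/
def GSet {n r : ℕ} (N : Fin r → Fin n → ℤ) : Set (Fin r → ℂ) :=
  {μ | (∀ k, μ k ≠ 0) ∧ ∀ m : Fin n → ℤ, ∏ k, μ k ^ (∑ j, N k j * m j) = 1}

/-- The orbit relation of the `G_Σ`-action on `U(K_Σ)`. -/
def toricRel {n r : ℕ} (N : Fin r → Fin n → ℤ) (K : Set (Finset (Fin r)))
    (x y : ↥(UK K)) : Prop :=
  ∃ μ ∈ GSet N, (fun i => μ i * (x : Fin r → ℂ) i) = (y : Fin r → ℂ)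

/-- The toric variety `X_Σ = U(K_Σ)/G_Σ`, as a topological quotient. -/
def XS {n r : ℕ} (N : Fin r → Fin n → ℤ) (K : Set (Finset (Fin r))) : Type :=
  Quot (toricRel N K)

instance {n r : ℕ} (N : Fin r → Fin n → ℤ) (K : Set (Finset (Fin r))) :
    TopologicalSpace (XS N K) :=
  instTopologicalSpaceQuot

/-- The quotient map `q_Σ : U(K_Σ) → X_Σ`. -/
def qmap {n r : ℕ} (N : Fin r → Fin n → ℤ) (K : Set (Finset (Fin r))) :
    ↥(UK K) → XS N K :=
  Quot.mk (toricRel N K)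

/-- `q_Σ` as a continuous map. -/
def qCont {n r : ℕ} (N : Fin r → Fin n → ℤ) (K : Set (Finset (Fin r))) :
    C(↥(UK K), XS N K) :=
  ⟨qmap N K, continuous_quot_mk⟩

lemma coneIdx_empty {n r : ℕ} (N : Fin r → Fin n → ℤ) :
    coneIdx N (∅ : Finset (Fin r)) = ({0} : Set (Fin n → ℝ)) := by
  ext x
  constructor
  · rintro ⟨lam, -, hx⟩
    simpa using hx
  · intro hx
    exact ⟨0, fun i => le_refl 0, by simpa using hx⟩

lemma empty_mem_KC {n r : ℕ} (F : Fan n) (N : Fin r → Fin n → ℤ) :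
    (∅ : Finset (Fin r)) ∈ KC F N := by
  show coneIdx N ∅ ∈ F.cones
  rw [coneIdx_empty]
  exact F.zero_mem

/-- The point `(1,…,1)`. -/
def onesC {r : ℕ} : Fin r → ℂ := fun _ => 1

lemma ones_mem_UK {r : ℕ} {K : Set (Finset (Fin r))} (h : (∅ : Finset (Fin r)) ∈ K) :
    (onesC : Fin r → ℂ) ∈ UK K := by
  rw [mem_UK]
  intro σ hσ
  rcases Finset.nonempty_iff_ne_empty.2 (fun he : σ = ∅ => hσ (by rw [he]; exact h)) with ⟨i, hi⟩
  exact ⟨i, hi, one_ne_zero⟩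

/-- The base point `(1,…,1)` of `U(K_Σ)`. -/
def onesUK {r : ℕ} {K : Set (Finset (Fin r))} (h : (∅ : Finset (Fin r)) ∈ K) : ↥(UK K) :=
  ⟨onesC, ones_mem_UK h⟩

/-- The base point `[1,…,1]` of `X_Σ`. -/
def baseX {n r : ℕ} (N : Fin r → Fin n → ℤ) (K : Set (Finset (Fin r)))
    (h : (∅ : Finset (Fin r)) ∈ K) : XS N K :=
  qmap N K (onesUK h)



/-! ### Spaces of tuples of monic polynomials -/

/-- The monic polynomial `z^d + a_{d-1} z^{d-1} + ⋯ + a_0` with coefficient data `a`. -/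
def toPoly {d : ℕ} (a : Fin d → ℂ) : Polynomial ℂ :=
  Polynomial.X ^ d + ∑ i : Fin d, Polynomial.C (a i) * Polynomial.X ^ (i : ℕ)

/-- The space `Pol*_D(S¹, X_Σ)` of `r`-tuples of monic polynomials of multidegree `D`
(in coefficient coordinates) such that for every `σ ∉ K` the polynomials `{f_i : i ∈ σ}`
have no common real root. -/
def PolSp {r : ℕ} (K : Set (Finset (Fin r))) (D : Fin r → ℕ) :
    Set (∀ k : Fin r, Fin (D k) → ℂ) :=
  {f | ∀ σ : Finset (Fin r), σ ∉ K → ∀ t : ℝ,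
        ∃ k ∈ σ, (toPoly (f k)).eval (t : ℂ) ≠ 0}

lemma polEval_mem_UK {r : ℕ} {K : Set (Finset (Fin r))} {D : Fin r → ℕ}
    (f : ↥(PolSp K D)) (t : ℝ) :
    (fun k => (toPoly (f.1 k)).eval (t : ℂ)) ∈ UK K :=
  mem_UK.2 fun σ hσ => f.2 σ hσ t

/-! ### Loop spaces and induced maps on homotopy groups -/

/-- The loop space `Ω X = Map*(S¹, X)` with `S¹ = ℝ ∪ {∞}` (the one-point
compactification of `ℝ`), based at `x₀`. -/
def Loop (X : Type*) [TopologicalSpace X] (x₀ : X) : Type _ :=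
  {γ : C(OnePoint ℝ, X) // γ OnePoint.infty = x₀}

instance {X : Type*} [TopologicalSpace X] (x₀ : X) : TopologicalSpace (Loop X x₀) :=
  instTopologicalSpaceSubtype

/-- The constant loop, base point of `Ω X`. -/
def Loop.const {X : Type*} [TopologicalSpace X] (x₀ : X) : Loop X x₀ :=
  ⟨ContinuousMap.const _ x₀, rfl⟩

/-- A based continuous map induces a continuous map of loop spaces. -/
def loopMap {X Y : Type*} [TopologicalSpace X] [TopologicalSpace Y] {x₀ : X} {y₀ : Y}
    (f : C(X, Y)) (hf : f x₀ = y₀) : C(Loop X x₀, Loop Y y₀) where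
  toFun γ := ⟨f.comp γ.1, by simp [γ.2, hf]⟩
  continuous_toFun := by
    apply Continuous.subtype_mk
    exact (ContinuousMap.continuous_postcomp f).comp continuous_subtype_val

/-- The map induced by a continuous map on homotopy groups (`π_q`). -/
def piMap (q : ℕ) {X Y : Type*} [TopologicalSpace X] [TopologicalSpace Y]
    (f : C(X, Y)) (x : X) :
    HomotopyGroup (Fin q) X x → HomotopyGroup (Fin q) Y (f x) :=
  Quotient.map
    (fun p => ⟨f.comp p.1, fun y hy => by
      show f (p.1 y) = f x
      rw [p.2 y hy]⟩)
    (fun p₁ p₂ h => h.elim fun H => ⟨H.compContinuousMap f⟩)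

/-- `f` is a homotopy equivalence through dimension `d`: it induces isomorphisms on
`π_k` for all `k ≤ d` (at every base point). -/
def HomotopyEquivThrough {X Y : Type*} [TopologicalSpace X] [TopologicalSpace Y]
    (f : C(X, Y)) (d : ℤ) : Prop :=
  ∀ (x : X) (k : ℕ), (k : ℤ) ≤ d → Function.Bijective (piMap k f x)

/-- A genuine homotopy equivalence. -/
def IsHtpyEquiv {X Y : Type*} [TopologicalSpace X] [TopologicalSpace Y]
    (f : C(X, Y)) : Prop :=
  ∃ g : C(Y, X), (f.comp g).Homotopic (ContinuousMap.id Y) ∧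
    (g.comp f).Homotopic (ContinuousMap.id X)

/-! ### `i_D`, lifts, and stabilization maps -/

/-- `j : Pol*_D → Ω U(K_Σ)` is a lift of `i_D` through `Ω q_Σ`, i.e. `Ω q_Σ ∘ j = i_D`:
for every tuple `f` and real `t`, the loop `j f` at time `t` lies over the point
`[f_1(t), …, f_r(t)]` of `X_Σ` (and at `∞` over `[1,…,1]`, automatically). -/
def IsLiftOfID {n r : ℕ} (N : Fin r → Fin n → ℤ) (K : Set (Finset (Fin r)))
    (hE : (∅ : Finset (Fin r)) ∈ K) (D : Fin r → ℕ)
    (j : ↥(PolSp K D) → Loop ↥(UK K) (onesUK hE)) : Prop :=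
  ∀ (f : ↥(PolSp K D)) (t : ℝ),
    qmap N K ((j f).1 (t : OnePoint ℝ)) =
      qmap N K ⟨fun k => (toPoly (f.1 k)).eval (t : ℂ), polEval_mem_UK f t⟩

/-- `i : Pol*_D → Ω X_Σ` is the map `i_D` given by evaluation. -/
def IsID {n r : ℕ} (N : Fin r → Fin n → ℤ) (K : Set (Finset (Fin r)))
    (hE : (∅ : Finset (Fin r)) ∈ K) (D : Fin r → ℕ)
    (i : ↥(PolSp K D) → Loop (XS N K) (baseX N K hE)) : Prop :=
  ∀ (f : ↥(PolSp K D)) (t : ℝ),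
    (i f).1 (t : OnePoint ℝ) =
      qmap N K ⟨fun k => (toPoly (f.1 k)).eval (t : ℂ), polEval_mem_UK f t⟩

/-- `φ` is an admissible parameter for the stabilization maps: a homeomorphism of `ℂ`
onto the half plane `{Re < bound}` carrying `ℝ` onto `(-∞, bound)`. -/
def AdmissiblePhi (bound : ℝ) (φ : ℂ → ℂ) : Prop :=
  Continuous φ ∧ Function.Injective φ ∧ IsOpenMap φ ∧
    Set.range φ = {w : ℂ | w.re < bound} ∧
    φ '' {z : ℂ | z.im = 0} = {z : ℂ | z.im = 0 ∧ z.re < bound}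

/-- The defining property of the stabilization map
`s_{D,D'}(f)_k = φ(f_k) · (z - x_k)^{d'_k - d_k}`, where `φ(f)` denotes the monic
polynomial whose roots are the images under `φ` of the roots of `f`. -/
def StabSpec {r : ℕ} (K : Set (Finset (Fin r))) (φ : ℂ → ℂ) (xpt : Fin r → ℂ)
    (D D' : Fin r → ℕ) (s : ↥(PolSp K D) → ↥(PolSp K D')) : Prop :=
  ∀ (f : ↥(PolSp K D)) (k : Fin r),
    toPoly ((s f).1 k) =
      (((toPoly (f.1 k)).roots.map φ).map
        fun α => Polynomial.X - Polynomial.C α).prod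
        * (Polynomial.X - Polynomial.C (xpt k)) ^ (D' k - D k)

/-- The general defining property of the map `j_D : Pol*_D → Ω U(K_Σ)`:
when `∑ d_k n_k = 0` it is a lift of `i_D` through `Ω q_Σ`, and otherwise it is the
composite `j_{D₀} ∘ s_{D,D₀}` for a suitable `D₀ = m₀ D*` as in condition (2.9.1). -/
def IsJD {n r : ℕ} (N : Fin r → Fin n → ℤ) (K : Set (Finset (Fin r)))
    (hE : (∅ : Finset (Fin r)) ∈ K) (D : Fin r → ℕ)
    (j : C(↥(PolSp K D), Loop ↥(UK K) (onesUK hE))) : Prop :=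
  ((∑ k, (D k : ℤ) • N k = 0) ∧ IsLiftOfID N K hE D j) ∨
  ((∑ k, (D k : ℤ) • N k ≠ 0) ∧
    ∃ (dstar : Fin r → ℕ) (m₀ : ℕ),
      (∀ k, 0 < dstar k) ∧ (∑ k, (dstar k : ℤ) • N k = 0) ∧
      (∀ k, D k < m₀ * dstar k) ∧
      ∃ (φ : ℂ → ℂ) (xpt : Fin r → ℂ),
        AdmissiblePhi ((∑ k, D k : ℕ) : ℝ) φ ∧
        (∀ k, ((∑ k, D k : ℕ) : ℝ) < (xpt k).re) ∧ Function.Injective xpt ∧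
        ∃ (j₀ : C(↥(PolSp K fun k => m₀ * dstar k), Loop ↥(UK K) (onesUK hE)))
          (s₀ : C(↥(PolSp K D), ↥(PolSp K fun k => m₀ * dstar k))),
          IsLiftOfID N K hE _ j₀ ∧ StabSpec K φ xpt D _ s₀ ∧ j = j₀.comp s₀)

/-! ### Stabilized (colimit) spaces -/

/-- The multidegree `D + t·e`. -/
def Dt {r : ℕ} (D : Fin r → ℕ) (t : ℕ) : Fin r → ℕ := fun k => D k + t

/-- Carrier of the stabilized space: the disjoint union of the `Pol*_{D+te}`. -/
def ColCar {r : ℕ} (K : Set (Finset (Fin r))) (D : Fin r → ℕ) : Type :=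
  Σ t : ℕ, ↥(PolSp K (Dt D t))

instance {r : ℕ} (K : Set (Finset (Fin r))) (D : Fin r → ℕ) :
    TopologicalSpace (ColCar K D) := by
  unfold ColCar; infer_instance

/-- The identifications generating the colimit along the stabilization maps. -/
def ColRel {r : ℕ} (K : Set (Finset (Fin r))) (D : Fin r → ℕ)
    (s : ∀ t : ℕ, ↥(PolSp K (Dt D t)) → ↥(PolSp K (Dt D (t + 1)))) :
    ColCar K D → ColCar K D → Prop :=
  fun a b => b = ⟨a.1 + 1, s a.1 a.2⟩

/-- The stabilized space `Pol^Σ_{D+∞} = colim_t Pol*_{D+te}(S¹, X_Σ)`. -/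
def PolColim {r : ℕ} (K : Set (Finset (Fin r))) (D : Fin r → ℕ)
    (s : ∀ t : ℕ, ↥(PolSp K (Dt D t)) → ↥(PolSp K (Dt D (t + 1)))) : Type :=
  Quot (ColRel K D s)

instance {r : ℕ} (K : Set (Finset (Fin r))) (D : Fin r → ℕ)
    (s : ∀ t : ℕ, ↥(PolSp K (Dt D t)) → ↥(PolSp K (Dt D (t + 1)))) :
    TopologicalSpace (PolColim K D s) :=
  instTopologicalSpaceQuot

/-- Admissibility of a family of stabilization maps `s_{D+te}`. -/
def AdmissibleStabFamily {r : ℕ} (K : Set (Finset (Fin r))) (D : Fin r → ℕ)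
    (s : ∀ t : ℕ, ↥(PolSp K (Dt D t)) → ↥(PolSp K (Dt D (t + 1)))) : Prop :=
  ∀ t : ℕ, ∃ (φ : ℂ → ℂ) (xpt : Fin r → ℂ),
    AdmissiblePhi ((∑ k, Dt D t k : ℕ) : ℝ) φ ∧
    (∀ k, ((∑ k, Dt D t k : ℕ) : ℝ) < (xpt k).re) ∧ Function.Injective xpt ∧
    StabSpec K φ xpt (Dt D t) (Dt D (t + 1)) (s t)


/-! ### Part A: homotopy group basics -/
section PartA
open unitInterval Topology

def rad {k : ℕ} (v : Fin k → I) : ℝ := ‖fun i => 2 * (v i : ℝ) - 1‖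

def resc {k : ℕ} (c : ℝ) (v : Fin k → I) : Fin k → I :=
  fun i => Set.projIcc 0 1 zero_le_one ((1 + c * (2 * (v i : ℝ) - 1)) / 2)

lemma continuous_rad {k : ℕ} : Continuous (rad : (Fin k → I) → ℝ) := by
  unfold rad; fun_prop

lemma rad_le_one {k : ℕ} (v : Fin k → I) : rad v ≤ 1 := by
  unfold rad
  refine (pi_norm_le_iff_of_nonneg zero_le_one).2 fun i => ?_
  rw [Real.norm_eq_abs, abs_le]
  have h0 := (v i).2.1
  have h1 := (v i).2.2
  constructor <;> linarith

lemma rad_nonneg {k : ℕ} (v : Fin k → I) : 0 ≤ rad v := norm_nonneg _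

lemma rad_boundary {k : ℕ} {v : Fin k → I} (hv : v ∈ Cube.boundary (Fin k)) : rad v = 1 := by
  apply le_antisymm (rad_le_one v)
  obtain ⟨i, hi⟩ := hv
  have h := norm_le_pi_norm (fun i => 2 * (v i : ℝ) - 1) i
  refine le_trans ?_ h
  rcases hi with hi | hi <;> simp [hi]; norm_num

lemma resc_one {k : ℕ} (v : Fin k → I) : resc 1 v = v := by
  funext i
  unfold resc
  have : (1 + 1 * (2 * (v i : ℝ) - 1)) / 2 = v i := by ring
  rw [this, Set.projIcc_val]

lemma resc_boundary {k : ℕ} {c : ℝ} (hc : 0 ≤ c) {v : Fin k → I} (h : c * rad v = 1) :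
    resc c v ∈ Cube.boundary (Fin k) := by
  by_contra hcon
  have hlt : ∀ i, |c * (2 * (v i : ℝ) - 1)| < 1 := by
    intro i
    by_contra hi
    push Not at hi
    apply hcon
    refine ⟨i, ?_⟩
    rcases le_abs.1 hi with h1 | h1
    · right
      apply Set.projIcc_of_right_le; linarith
    · left
      apply Set.projIcc_of_le_left; linarith
  have : ‖c • (fun i => 2 * (v i : ℝ) - 1)‖ < 1 := by
    refine (pi_norm_lt_iff zero_lt_one).2 fun i => ?_
    simpa using hlt i
  rw [norm_smul, Real.norm_of_nonneg hc] at this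
  unfold rad at h
  linarith

lemma continuous_resc {k : ℕ} {Z : Type*} [TopologicalSpace Z] {c : Z → ℝ} {v : Z → Fin k → I}
    (hc : Continuous c) (hv : Continuous v) : Continuous fun z => resc (c z) (v z) := by
  unfold resc
  refine continuous_pi fun i => continuous_projIcc.comp ?_
  have : Continuous fun z => ((v z i : I) : ℝ) := by fun_prop
  fun_prop

lemma collar_continuous {k : ℕ} {Y : Type*} [TopologicalSpace Y]
    (P : C(I × (Fin k → I), Y)) (Q : C(I × I, Y)) (c : I → ℝ) (hc : Continuous c)
    (hc0 : ∀ s, 0 ≤ c s)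
    (hPQ : ∀ s, ∀ v ∈ Cube.boundary (Fin k), P (s, v) = Q (s, 0)) :
    Continuous fun z : I × (Fin k → I) =>
      if c z.1 * rad z.2 ≤ 1 then P (z.1, resc (c z.1) z.2)
      else Q (z.1, Set.projIcc 0 1 zero_le_one (c z.1 * rad z.2 - 1)) := by
  have hc' : Continuous fun z : I × (Fin k → I) => c z.1 := hc.comp continuous_fst
  have hr : Continuous fun z : I × (Fin k → I) => rad z.2 := continuous_rad.comp continuous_snd
  refine Continuous.if_le ?_ ?_ (hc'.mul hr) continuous_const ?_
  · exact P.continuous.comp (continuous_fst.prodMk (continuous_resc hc' continuous_snd))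
  · refine Q.continuous.comp (continuous_fst.prodMk (continuous_projIcc.comp ?_))
    exact (hc'.mul hr).sub continuous_const
  · intro z hz
    rw [hPQ _ _ (resc_boundary (hc0 _) hz), hz]
    simp

/-- Free homotopy between cube maps, with prescribed values on the boundary. -/
def BH {k : ℕ} {Y : Type*} [TopologicalSpace Y] (p q : C(Fin k → I, Y)) {y0 y1 : Y}
    (γ : Path y0 y1) : Prop :=
  ∃ H : p.Homotopy q, ∀ s, ∀ v ∈ Cube.boundary (Fin k), H (s, v) = γ s

lemma BH.trans {k : ℕ} {Y : Type*} [TopologicalSpace Y] {p q r : C(Fin k → I, Y)} {y0 y1 y2 : Y}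
    {γ : Path y0 y1} {δ : Path y1 y2} (h1 : BH p q γ) (h2 : BH q r δ) : BH p r (γ.trans δ) := by
  obtain ⟨H1, h1⟩ := h1
  obtain ⟨H2, h2⟩ := h2
  refine ⟨H1.trans H2, fun s v hv => ?_⟩
  rw [ContinuousMap.Homotopy.trans_apply, Path.trans_apply]
  split_ifs with h
  · exact h1 _ v hv
  · exact h2 _ v hv

lemma BH.symm {k : ℕ} {Y : Type*} [TopologicalSpace Y] {p q : C(Fin k → I, Y)} {y0 y1 : Y}
    {γ : Path y0 y1} (h1 : BH p q γ) : BH q p γ.symm := by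
  obtain ⟨H1, h1⟩ := h1
  exact ⟨H1.symm, fun s v hv => h1 _ v hv⟩

lemma BH_of_rel {k : ℕ} {Y : Type*} [TopologicalSpace Y] {p q : C(Fin k → I, Y)} {y0 : Y}
    (h : p.HomotopicRel q (Cube.boundary (Fin k))) (hp : ∀ v ∈ Cube.boundary (Fin k), p v = y0) :
    BH p q (Path.refl y0) := by
  obtain ⟨H⟩ := h
  exact ⟨H.toHomotopy, fun s v hv => (H.eq_fst s hv).trans (hp v hv)⟩

/-- transport along a path -/
lemma BH_transport {k : ℕ} {Y : Type*} [TopologicalSpace Y] (p : C(Fin k → I, Y)) {y0 y1 : Y}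
    (hp : ∀ v ∈ Cube.boundary (Fin k), p v = y0) (γ : Path y0 y1) :
    ∃ q : C(Fin k → I, Y), BH p q γ ∧ ∀ v, q v =
      if 2 * rad v ≤ 1 then p (resc 2 v) else
        γ (Set.projIcc 0 1 zero_le_one (2 * rad v - 1)) := by
  have hcont := collar_continuous (p.comp ⟨Prod.snd, continuous_snd⟩ : C(I × (Fin k → I), Y))
    (γ.toContinuousMap.comp ⟨Prod.snd, continuous_snd⟩ : C(I × I, Y)) (fun s => 1 + (s : ℝ))
    (by fun_prop) (fun s => by have := s.2.1; linarith) (fun s v hv => by simp [hp v hv])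
  set Hf := fun z : I × (Fin k → I) => _ with hHf
  have hcont : Continuous Hf := hcont
  have h2 : (1 : ℝ) + ((1 : I) : ℝ) = 2 := by norm_num
  refine ⟨⟨fun v => Hf (1, v), hcont.comp (by fun_prop)⟩, ⟨⟨⟨Hf, hcont⟩, ?_, fun v => rfl⟩, ?_⟩, ?_⟩
  · intro v
    simp only [hHf, Set.Icc.coe_zero, add_zero, one_mul, rad_le_one, if_true, resc_one]
    rfl
  · intro s v hv
    show Hf (s, v) = γ s
    have hr := rad_boundary hv
    simp only [hHf, hr, mul_one]
    split_ifs with h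
    · have hs : s = 0 := by
        apply Subtype.ext
        have := s.2.1
        show (s : ℝ) = 0
        linarith
      subst hs
      simp [resc_one, hp v hv]
    · simp
  · intro v
    show Hf (1, v) = _
    simp only [hHf, h2]
    rfl

lemma rel_of_BH {k : ℕ} {Y : Type*} [TopologicalSpace Y] {p q : C(Fin k → I, Y)} {y0 : Y}
    {γ : Path y0 y0} (h : BH p q γ) (hγ : γ.Homotopic (Path.refl y0)) :
    p.HomotopicRel q (Cube.boundary (Fin k)) := by
  obtain ⟨H, hH⟩ := h
  obtain ⟨N⟩ := hγ
  have hp : ∀ v ∈ Cube.boundary (Fin k), p v = y0 := fun v hv => by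
    rw [← H.apply_zero, hH 0 v hv]; simp
  have hq : ∀ v ∈ Cube.boundary (Fin k), q v = y0 := fun v hv => by
    rw [← H.apply_one, hH 1 v hv]; simp
  have key : ∀ p' : C(Fin k → I, Y), (∀ v ∈ Cube.boundary (Fin k), p' v = y0) →
      ∀ p'' : C(Fin k → I, Y), BH p' p'' (Path.refl y0) →
      p'.HomotopicRel p'' (Cube.boundary (Fin k)) := by
    rintro p' hp' p'' ⟨H', h'⟩
    exact ⟨⟨H', fun s v hv => (h' s v hv).trans (hp' v hv).symm⟩⟩
  obtain ⟨p', hp1, hp2⟩ := BH_transport p hp (Path.refl y0)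
  obtain ⟨q', hq1, hq2⟩ := BH_transport q hq (Path.refl y0)
  refine (key p hp p' hp1).trans (ContinuousMap.HomotopicRel.trans ?_ (key q hq q' hq1).symm)
  have hcont := collar_continuous H.toContinuousMap
    (N.toContinuousMap.comp ⟨Prod.swap, continuous_swap⟩ : C(I × I, Y)) (fun s => 2)
    continuous_const (fun s => by norm_num) (fun s v hv => by
      show H (s, v) = N (0, s)
      rw [hH s v hv]; simp)
  set Hf := fun z : I × (Fin k → I) => _ with hHf
  have hcont : Continuous Hf := hcont
  refine ⟨⟨⟨⟨Hf, hcont⟩, ?_, ?_⟩, ?_⟩⟩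
  · intro v
    show Hf (0, v) = _
    rw [hp2]
    simp only [hHf]
    split_ifs with h
    · exact H.apply_zero _
    · show N (_, 0) = _
      simp
  · intro v
    show Hf (1, v) = _
    rw [hq2]
    simp only [hHf]
    split_ifs with h
    · exact H.apply_one _
    · show N (_, 1) = _
      simp
  · intro s v hv
    show Hf (s, v) = p' v
    rw [hp2]
    have hr := rad_boundary hv
    simp only [hHf, hr]
    norm_num

lemma BH_of_homotopy {k : ℕ} {X Y : Type*} [TopologicalSpace X] [TopologicalSpace Y]
    {f g : C(X, Y)} (H : f.Homotopy g) {x : X} (p : C(Fin k → I, X))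
    (hp : ∀ v ∈ Cube.boundary (Fin k), p v = x) :
    BH (f.comp p) (g.comp p) (H.evalAt x) := by
  refine ⟨ContinuousMap.Homotopy.comp H (ContinuousMap.Homotopy.refl p), fun s v hv => ?_⟩
  show H (s, p v) = H (s, x)
  rw [hp v hv]

lemma piMap_injective_iff {k : ℕ} {X Y : Type*} [TopologicalSpace X] [TopologicalSpace Y]
    (f : C(X, Y)) (x : X) : Function.Injective (piMap k f x) ↔
    ∀ p q : C(Fin k → I, X), (∀ v ∈ Cube.boundary (Fin k), p v = x) →
      (∀ v ∈ Cube.boundary (Fin k), q v = x) →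
      (f.comp p).HomotopicRel (f.comp q) (Cube.boundary (Fin k)) →
      p.HomotopicRel q (Cube.boundary (Fin k)) := by
  constructor
  · intro h p q hp hq hpq
    have := @h (Quotient.mk _ ⟨p, hp⟩) (Quotient.mk _ ⟨q, hq⟩) (Quotient.sound hpq)
    exact Quotient.exact this
  · intro h a b
    refine Quotient.inductionOn₂ a b fun p q hpq => ?_
    exact Quotient.sound (h p.1 q.1 p.2 q.2 (Quotient.exact hpq))

lemma piMap_surjective_iff {k : ℕ} {X Y : Type*} [TopologicalSpace X] [TopologicalSpace Y]
    (f : C(X, Y)) (x : X) : Function.Surjective (piMap k f x) ↔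
    ∀ c : C(Fin k → I, Y), (∀ v ∈ Cube.boundary (Fin k), c v = f x) →
      ∃ p : C(Fin k → I, X), (∀ v ∈ Cube.boundary (Fin k), p v = x) ∧
      (f.comp p).HomotopicRel c (Cube.boundary (Fin k)) := by
  constructor
  · intro h c hc
    obtain ⟨a, ha⟩ := h (Quotient.mk _ ⟨c, hc⟩)
    induction a using Quotient.inductionOn with
    | h p => exact ⟨p.1, p.2, Quotient.exact ha⟩
  · intro h a
    refine Quotient.inductionOn a fun c => ?_
    obtain ⟨p, hp, hpc⟩ := h c.1 c.2
    exact ⟨Quotient.mk _ ⟨p, hp⟩, Quotient.sound hpc⟩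

lemma homotopic_symm_trans {Y : Type*} [TopologicalSpace Y] {a b : Y} (γ : Path a b) :
    (γ.symm.trans ((Path.refl a).trans γ)).Homotopic (Path.refl b) := by
  have h1 : ((Path.refl a).trans γ).Homotopic γ := ⟨Path.Homotopy.reflTrans γ⟩
  have h2 := Path.Homotopic.hcomp (Path.Homotopic.refl γ.symm) h1
  exact h2.trans ⟨(Path.Homotopy.reflSymmTrans γ).symm⟩

lemma homotopic_trans_symm {Y : Type*} [TopologicalSpace Y] {a b : Y} (γ : Path a b) :
    (γ.trans ((Path.refl b).trans γ.symm)).Homotopic (Path.refl a) := by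
  have h1 : ((Path.refl b).trans γ.symm).Homotopic γ.symm := ⟨Path.Homotopy.reflTrans γ.symm⟩
  have h2 := Path.Homotopic.hcomp (Path.Homotopic.refl γ) h1
  exact h2.trans ⟨(Path.Homotopy.reflTransSymm γ).symm⟩

/-- Bijectivity on homotopy groups is invariant under free homotopies. -/
theorem piMap_bijective_of_homotopic {k : ℕ} {X Y : Type*} [TopologicalSpace X]
    [TopologicalSpace Y] {f g : C(X, Y)} (hfg : f.Homotopic g) (x : X)
    (hg : Function.Bijective (piMap k g x)) : Function.Bijective (piMap k f x) := by
  obtain ⟨H⟩ := hfg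
  obtain ⟨hi, hs⟩ := hg
  rw [piMap_injective_iff] at hi
  rw [piMap_surjective_iff] at hs
  constructor
  · rw [piMap_injective_iff]
    intro p q hp hq hpq
    refine hi p q hp hq ?_
    have h1 := BH_of_homotopy H p hp
    have h2 := BH_of_homotopy H q hq
    have h3 := BH_of_rel (y0 := f x) hpq (fun v hv => by simp [hp v hv])
    exact rel_of_BH (h1.symm.trans (h3.trans h2)) (homotopic_symm_trans _)
  · rw [piMap_surjective_iff]
    intro c hc
    obtain ⟨c', h1, -⟩ := BH_transport c hc (H.evalAt x)
    have hc' : ∀ v ∈ Cube.boundary (Fin k), c' v = g x := by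
      obtain ⟨G, hG⟩ := h1
      intro v hv
      rw [← G.apply_one, hG 1 v hv]; simp
    obtain ⟨p, hp, hpc⟩ := hs c' hc'
    refine ⟨p, hp, ?_⟩
    have h2 := BH_of_homotopy H p hp
    have h3 := BH_of_rel (y0 := g x) hpc (fun v hv => by simp [hp v hv])
    exact rel_of_BH (h2.trans (h3.trans h1.symm)) (homotopic_trans_symm _)

lemma piMap_comp {k : ℕ} {X Y Z : Type*} [TopologicalSpace X] [TopologicalSpace Y]
    [TopologicalSpace Z] (g : C(Y, Z)) (f : C(X, Y)) (x : X) :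
    piMap k (g.comp f) x = piMap k g (f x) ∘ piMap k f x := by
  funext a
  refine Quotient.inductionOn a fun p => rfl

lemma piMap_bijective_comp {k : ℕ} {X Y Z : Type*} [TopologicalSpace X] [TopologicalSpace Y]
    [TopologicalSpace Z] {g : C(Y, Z)} {f : C(X, Y)} {x : X}
    (hg : Function.Bijective (piMap k g (f x))) (hf : Function.Bijective (piMap k f x)) :
    Function.Bijective (piMap k (g.comp f) x) := by
  rw [piMap_comp]; exact hg.comp hf

lemma piMap_bijective_of_homeo {k : ℕ} {X Y : Type*} [TopologicalSpace X] [TopologicalSpace Y]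
    (f : C(X, Y)) (g : C(Y, X)) (hgf : ∀ x, g (f x) = x) (hfg : ∀ y, f (g y) = y) (x : X) :
    Function.Bijective (piMap k f x) := by
  constructor
  · rw [piMap_injective_iff]
    intro p q hp hq hpq
    have := hpq.comp_continuousMap g
    convert this using 1
    · ext v; simp [hgf]
    · ext v; simp [hgf]
  · rw [piMap_surjective_iff]
    intro c hc
    refine ⟨g.comp c, fun v hv => by simp [hc v hv, hgf], ?_⟩
    convert ContinuousMap.HomotopicRel.refl c using 1
    ext v; simp [hfg]

end PartA

/-! ### Part B: monic polynomials and their roots -/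
section PartB
open Polynomial

lemma toPoly_deg_lt {d : ℕ} (a : Fin d → ℂ) :
    (∑ i : Fin d, C (a i) * X ^ (i : ℕ) : ℂ[X]).degree < d := by
  refine lt_of_le_of_lt (degree_sum_le _ _) ?_
  rw [Finset.sup_lt_iff (by exact WithBot.bot_lt_coe d)]
  intro i _
  refine lt_of_le_of_lt (degree_C_mul_X_pow_le _ _) ?_
  exact_mod_cast i.2

lemma toPoly_monic {d : ℕ} (a : Fin d → ℂ) : (toPoly a).Monic :=
  monic_X_pow_add (toPoly_deg_lt a)

lemma toPoly_natDegree {d : ℕ} (a : Fin d → ℂ) : (toPoly a).natDegree = d := by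
  apply natDegree_eq_of_degree_eq_some
  unfold toPoly
  rw [degree_add_eq_left_of_degree_lt, degree_X_pow]
  rw [degree_X_pow]; exact toPoly_deg_lt a

lemma toPoly_coeff {d : ℕ} (a : Fin d → ℂ) (i : Fin d) : (toPoly a).coeff i = a i := by
  unfold toPoly
  rw [coeff_add, coeff_X_pow, if_neg (by have := i.2; omega), zero_add, finsetSum_coeff]
  simp only [coeff_C_mul, coeff_X_pow]
  rw [Finset.sum_eq_single i]
  · simp
  · intro b _ hb
    rw [if_neg, mul_zero]
    intro h; exact hb (Fin.ext h.symm)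
  · simp

lemma toPoly_of_monic {d : ℕ} {p : ℂ[X]} (hp : p.Monic) (hd : p.natDegree = d) :
    toPoly (fun i : Fin d => p.coeff i) = p := by
  ext i
  rcases lt_trichotomy i d with h | h | h
  · exact toPoly_coeff (fun i : Fin d => p.coeff i) ⟨i, h⟩
  · subst h
    have h1 := (toPoly_monic (fun k : Fin i => p.coeff k)).coeff_natDegree
    have h2 := hp.coeff_natDegree
    rw [toPoly_natDegree] at h1
    rw [h1, ← hd, h2]
  · rw [coeff_eq_zero_of_natDegree_lt (by rw [toPoly_natDegree]; exact h),
      coeff_eq_zero_of_natDegree_lt (by omega)]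

lemma toPoly_injective {d : ℕ} : Function.Injective (toPoly : (Fin d → ℂ) → ℂ[X]) := by
  intro a b h
  funext i
  rw [← toPoly_coeff a, h, toPoly_coeff]

lemma toPoly_ne_zero {d : ℕ} (a : Fin d → ℂ) : toPoly a ≠ 0 := (toPoly_monic a).ne_zero

lemma toPoly_eval {d : ℕ} (a : Fin d → ℂ) (z : ℂ) :
    (toPoly a).eval z = z ^ d + ∑ i : Fin d, a i * z ^ (i : ℕ) := by
  unfold toPoly
  simp [eval_finsetSum]

lemma continuous_toPoly_eval {d : ℕ} {Y : Type*} [TopologicalSpace Y] {a : Y → Fin d → ℂ}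
    {z : Y → ℂ} (ha : Continuous a) (hz : Continuous z) :
    Continuous fun y => (toPoly (a y)).eval (z y) := by
  simp only [toPoly_eval]
  fun_prop

lemma toPoly_roots_card {d : ℕ} (a : Fin d → ℂ) : Multiset.card (toPoly a).roots = d := by
  have := (IsAlgClosed.splits (toPoly a)).natDegree_eq_card_roots
  rw [toPoly_natDegree] at this
  exact this.symm

/-- coefficients of the monic polynomial with given roots -/
def Vc {d : ℕ} (β : Fin d → ℂ) : Fin d → ℂ :=
  fun i => (∏ j, (X - C (β j)) : ℂ[X]).coeff i

lemma toPoly_Vc {d : ℕ} (β : Fin d → ℂ) : toPoly (Vc β) = ∏ j, (X - C (β j)) := by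
  unfold Vc
  apply toPoly_of_monic (monic_prod_of_monic _ _ fun i _ => monic_X_sub_C _)
  rw [natDegree_prod_of_monic _ _ fun i _ => monic_X_sub_C _]
  simp

lemma roots_Vc {d : ℕ} (β : Fin d → ℂ) :
    (toPoly (Vc β)).roots = Finset.univ.val.map β := by
  rw [toPoly_Vc]
  exact roots_multiset_prod_X_sub_C (Finset.univ.val.map β) ▸ by
    rw [Multiset.map_map]; rfl

lemma Vc_surj {d : ℕ} (a : Fin d → ℂ) : ∃ β : Fin d → ℂ, Vc β = a := by
  have hc := toPoly_roots_card a
  obtain ⟨l, hl⟩ : ∃ l : List ℂ, (l : Multiset ℂ) = (toPoly a).roots :=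
    ⟨_, Multiset.coe_toList _⟩
  have hlen : l.length = d := by rw [← hc, ← hl]; simp
  subst hlen
  refine ⟨l.get, ?_⟩
  apply toPoly_injective
  rw [toPoly_Vc]
  have h1 := (IsAlgClosed.splits (toPoly a)).eq_prod_roots_of_monic (toPoly_monic a)
  rw [h1, ← hl]
  rw [Multiset.map_coe, Multiset.prod_coe, List.prod_ofFn.symm]
  congr 1
  conv_rhs => rw [← List.ofFn_get l, List.map_ofFn]
  rfl

lemma contDiff_prod_coeff {ι E : Type*} [NormedAddCommGroup E] [NormedSpace ℝ E]
    (s : Finset ι) (β : E → ι → ℂ) (hβ : ∀ j, ContDiff ℝ 1 fun x => β x j) (i : ℕ) :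
    ContDiff ℝ 1 fun x => (∏ j ∈ s, (X - C (β x j)) : ℂ[X]).coeff i := by
  induction s using Finset.induction_on generalizing i with
  | empty => simpa using contDiff_const
  | insert a s ha ih =>
    have : ∀ x, (∏ j ∈ insert a s, (X - C (β x j)) : ℂ[X]).coeff i =
      (if i = 0 then 0 else (∏ j ∈ s, (X - C (β x j)) : ℂ[X]).coeff (i - 1))
        - β x a * (∏ j ∈ s, (X - C (β x j)) : ℂ[X]).coeff i := by
      intro x
      rw [Finset.prod_insert ha, sub_mul, coeff_sub, coeff_C_mul]
      cases i <;> simp [coeff_X_mul]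
    simp only [this]
    refine ContDiff.sub ?_ ((hβ a).mul (ih i))
    by_cases h : i = 0
    · simpa [h] using contDiff_const
    · simpa [h] using ih (i - 1)

lemma contDiff_Vc {d : ℕ} {E : Type*} [NormedAddCommGroup E] [NormedSpace ℝ E]
    (β : E → Fin d → ℂ) (hβ : ∀ j, ContDiff ℝ 1 fun x => β x j) :
    ContDiff ℝ 1 fun x => Vc (β x) := by
  rw [contDiff_pi]
  intro i
  exact contDiff_prod_coeff Finset.univ β hβ i

lemma continuous_Vc {d : ℕ} : Continuous (Vc : (Fin d → ℂ) → Fin d → ℂ) := by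
  apply (contDiff_Vc (fun β : Fin d → ℂ => β) fun j => ?_).continuous
  exact contDiff_apply ℝ ℂ j

lemma root_bound {d : ℕ} (a : Fin d → ℂ) (z : ℂ) (hz : (toPoly a).eval z = 0) :
    ‖z‖ ≤ 1 + ∑ i, ‖a i‖ := by
  by_contra hcon
  push Not at hcon
  have hS : 0 ≤ ∑ i, ‖a i‖ := Finset.sum_nonneg fun i _ => norm_nonneg _
  have hz1 : 1 < ‖z‖ := by linarith
  rcases d with _ | d
  · rw [toPoly_eval] at hz; simp at hz
  rw [toPoly_eval] at hz
  have h1 : ‖z‖ ^ (d + 1) = ‖∑ i : Fin (d + 1), a i * z ^ (i : ℕ)‖ := by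
    rw [← norm_pow, ← norm_neg]
    congr 1
    linear_combination (-1 : ℂ) * hz
  have h2 : ‖∑ i : Fin (d + 1), a i * z ^ (i : ℕ)‖ ≤ (∑ i, ‖a i‖) * ‖z‖ ^ d := by
    rw [Finset.sum_mul]
    refine (norm_sum_le _ _).trans (Finset.sum_le_sum fun i _ => ?_)
    rw [norm_mul, norm_pow]
    gcongr
    · exact hz1.le
    · have := i.2; omega
  have h3 : 0 < ‖z‖ ^ d := by positivity
  rw [← h1, pow_succ'] at h2
  have := le_of_mul_le_mul_right h2 h3
  linarith

lemma eval_Vc_root {d : ℕ} (β : Fin d → ℂ) (j : Fin d) : (toPoly (Vc β)).eval (β j) = 0 := by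
  rw [toPoly_Vc, eval_prod]
  exact Finset.prod_eq_zero (Finset.mem_univ j) (by simp)

lemma eval_Vc_iff {d : ℕ} (β : Fin d → ℂ) (z : ℂ) :
    (toPoly (Vc β)).eval z = 0 ↔ ∃ j, β j = z := by
  rw [toPoly_Vc, eval_prod, Finset.prod_eq_zero_iff]
  simp [sub_eq_zero, eq_comm]

lemma isProperMap_Vc {d : ℕ} : IsProperMap (Vc : (Fin d → ℂ) → Fin d → ℂ) := by
  rw [isProperMap_iff_isCompact_preimage]
  refine ⟨continuous_Vc, fun A hA => ?_⟩
  obtain ⟨R, hR⟩ := hA.isBounded.exists_norm_le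
  apply Metric.isCompact_of_isClosed_isBounded (hA.isClosed.preimage continuous_Vc)
  refine isBounded_iff_forall_norm_le.2 ⟨1 + ∑ i : Fin d, |R|, fun β hβ => ?_⟩
  refine (pi_norm_le_iff_of_nonneg (by positivity)).2 fun j => ?_
  refine (root_bound _ _ (eval_Vc_root β j)).trans ?_
  gcongr with i
  exact (norm_le_pi_norm _ i).trans ((hR _ hβ).trans (le_abs_self R))

lemma isQuotientMap_Vc (Y : Type*) [TopologicalSpace Y] (d : ℕ) :
    Topology.IsQuotientMap (Prod.map id Vc : Y × (Fin d → ℂ) → Y × (Fin d → ℂ)) := by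
  have hcl : IsClosedMap (Prod.map id Vc : Y × (Fin d → ℂ) → Y × (Fin d → ℂ)) :=
    (IsProperMap.prodMap (isProperMap_id) isProperMap_Vc).isClosedMap
  refine hcl.isQuotientMap (by exact continuous_id.prodMap continuous_Vc) ?_
  rintro ⟨y, a⟩
  obtain ⟨β, rfl⟩ := Vc_surj a
  exact ⟨(y, β), rfl⟩

/-- Move the roots of a polynomial by `φ`. -/
def moveP {d : ℕ} (φ : ℂ → ℂ) (a : Fin d → ℂ) : Fin d → ℂ :=
  fun i => ((((toPoly a).roots.map φ).map fun α => X - C α).prod).coeff i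

lemma toPoly_moveP {d : ℕ} (φ : ℂ → ℂ) (a : Fin d → ℂ) :
    toPoly (moveP φ a) = (((toPoly a).roots.map φ).map fun α => X - C α).prod := by
  unfold moveP
  apply toPoly_of_monic (monic_multiset_prod_of_monic _ _ fun i _ => monic_X_sub_C _)
  rw [natDegree_multiset_prod_X_sub_C_eq_card]
  simp [toPoly_roots_card]

lemma moveP_Vc {d : ℕ} (φ : ℂ → ℂ) (β : Fin d → ℂ) : moveP φ (Vc β) = Vc (fun j => φ (β j)) := by
  apply toPoly_injective
  rw [toPoly_moveP, roots_Vc, toPoly_Vc, Multiset.map_map, Multiset.map_map]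
  rfl

lemma moveP_root {d : ℕ} (φ : ℂ → ℂ) (a : Fin d → ℂ) (z : ℂ) :
    (toPoly (moveP φ a)).eval z = 0 ↔ ∃ α, (toPoly a).eval α = 0 ∧ φ α = z := by
  obtain ⟨β, rfl⟩ := Vc_surj a
  rw [moveP_Vc, eval_Vc_iff]
  simp only [eval_Vc_iff]
  constructor
  · rintro ⟨j, hj⟩; exact ⟨β j, ⟨j, rfl⟩, hj⟩
  · rintro ⟨_, ⟨j, rfl⟩, hj⟩; exact ⟨j, hj⟩

lemma moveP_id {d : ℕ} (φ : ℂ → ℂ) (a : Fin d → ℂ)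
    (h : ∀ α, (toPoly a).eval α = 0 → φ α = α) : moveP φ a = a := by
  obtain ⟨β, rfl⟩ := Vc_surj a
  rw [moveP_Vc]
  congr 1
  funext j
  exact h _ (eval_Vc_root β j)

lemma moveP_comp {d : ℕ} (φ ψ : ℂ → ℂ) (a : Fin d → ℂ) :
    moveP φ (moveP ψ a) = moveP (fun z => φ (ψ z)) a := by
  obtain ⟨β, rfl⟩ := Vc_surj a
  simp only [moveP_Vc]

lemma continuous_moveP {d : ℕ} {Y : Type*} [TopologicalSpace Y] {Φ : Y → ℂ → ℂ}
    (hΦ : Continuous fun z : Y × ℂ => Φ z.1 z.2) {f : Y → Fin d → ℂ} (hf : Continuous f) :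
    Continuous fun y => moveP (Φ y) (f y) := by
  have h1 : Continuous fun z : Y × (Fin d → ℂ) => moveP (Φ z.1) z.2 := by
    rw [(isQuotientMap_Vc Y d).continuous_iff]
    have : ((fun z : Y × (Fin d → ℂ) => moveP (Φ z.1) z.2) ∘ Prod.map id Vc)
        = fun z : Y × (Fin d → ℂ) => Vc fun j => Φ z.1 (z.2 j) := by
      funext z
      simp [moveP_Vc]
    rw [this]
    refine continuous_Vc.comp (continuous_pi fun j => ?_)
    exact hΦ.comp (continuous_fst.prodMk ((continuous_apply j).comp continuous_snd))
  have h2 : Continuous fun y => ((y, f y) : Y × (Fin d → ℂ)) := continuous_id.prodMk hf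
  have h3 := h1.comp h2
  simp only [Function.comp_def] at h3
  exact h3

lemma isOpen_exists_root {d : ℕ} {Y : Type*} [TopologicalSpace Y] {W : Set (Y × ℂ)}
    (hW : IsOpen W) {f : Y → Fin d → ℂ} (hf : Continuous f) :
    IsOpen {y | ∃ α, (toPoly (f y)).eval α = 0 ∧ (y, α) ∈ W} := by
  have h1 : IsOpen {z : Y × (Fin d → ℂ) | ∃ α, (toPoly z.2).eval α = 0 ∧ (z.1, α) ∈ W} := by
    rw [← (isQuotientMap_Vc Y d).isOpen_preimage]
    have : (Prod.map id Vc : Y × (Fin d → ℂ) → _) ⁻¹'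
        {z : Y × (Fin d → ℂ) | ∃ α, (toPoly z.2).eval α = 0 ∧ (z.1, α) ∈ W}
        = ⋃ j, {z | (z.1, z.2 j) ∈ W} := by
      ext z
      simp [eval_Vc_iff]
    rw [this]
    refine isOpen_iUnion fun j => hW.preimage ?_
    exact continuous_fst.prodMk ((continuous_apply j).comp continuous_snd)
  exact h1.preimage (continuous_id.prodMk hf)

lemma finite_roots {d : ℕ} (a : Fin d → ℂ) : {z | (toPoly a).eval z = 0}.Finite := by
  have := (toPoly a).rootSet_finite ℂ
  refine this.subset fun z hz => ?_
  rw [mem_rootSet]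
  exact ⟨toPoly_ne_zero a, by simpa using hz⟩

end PartB

/-! ### Part D: the step lemma -/
section PartD
open Polynomial Topology

/-- Real points where the slot `k` polynomial has to be nonzero. -/
def BB {r : ℕ} (K : Set (Finset (Fin r))) {D : Fin r → ℕ} (k : Fin r)
    (f : ∀ k : Fin r, Fin (D k) → ℂ) : Set ℝ :=
  {t | ∃ σ : Finset (Fin r), σ ∉ K ∧ k ∈ σ ∧ ∀ j ∈ σ, j ≠ k → (toPoly (f j)).eval (t : ℂ) = 0}

lemma BB_update {r : ℕ} (K : Set (Finset (Fin r))) {D : Fin r → ℕ} (k : Fin r)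
    (f : ∀ k : Fin r, Fin (D k) → ℂ) (c : Fin (D k) → ℂ) :
    BB K k (Function.update f k c) = BB K k f := by
  have : ∀ (t : ℝ) j, j ≠ k → ((toPoly (Function.update f k c j)).eval (t : ℂ) = 0 ↔
      (toPoly (f j)).eval (t : ℂ) = 0) := by
    intro t j hj
    rw [Function.update_of_ne hj]
  ext t
  constructor
  · rintro ⟨σ, h1, h2, h3⟩
    exact ⟨σ, h1, h2, fun j hj hjk => (this t j hjk).1 (h3 j hj hjk)⟩
  · rintro ⟨σ, h1, h2, h3⟩
    exact ⟨σ, h1, h2, fun j hj hjk => (this t j hjk).2 (h3 j hj hjk)⟩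

lemma BB_ne {r : ℕ} {K : Set (Finset (Fin r))} {D : Fin r → ℕ} {k : Fin r}
    {f : ∀ k : Fin r, Fin (D k) → ℂ} (hf : f ∈ PolSp K D) {t : ℝ} (ht : t ∈ BB K k f) :
    (toPoly (f k)).eval (t : ℂ) ≠ 0 := by
  obtain ⟨σ, h1, h2, h3⟩ := ht
  obtain ⟨j, hj, hjne⟩ := hf σ h1 t
  by_cases hjk : j = k
  · subst hjk; exact hjne
  · exact absurd (h3 j hj hjk) hjne

lemma update_mem_PolSp {r : ℕ} {K : Set (Finset (Fin r))} {D : Fin r → ℕ} {k : Fin r}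
    {f : ∀ k : Fin r, Fin (D k) → ℂ} (hf : f ∈ PolSp K D) {c : Fin (D k) → ℂ}
    (hc : ∀ t ∈ BB K k f, (toPoly c).eval (t : ℂ) ≠ 0) :
    Function.update f k c ∈ PolSp K D := by
  intro σ hσ t
  by_cases h : ∃ j ∈ σ, j ≠ k ∧ (toPoly (f j)).eval (t : ℂ) ≠ 0
  · obtain ⟨j, hj, hjk, hne⟩ := h
    exact ⟨j, hj, by rwa [Function.update_of_ne hjk]⟩
  · push Not at h
    obtain ⟨j, hj, hne⟩ := hf σ hσ t
    have hjk : j = k := by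
      by_contra hjk
      exact hne (h j hj hjk)
    subst hjk
    exact ⟨j, hj, by rw [Function.update_self]; exact hc t ⟨σ, hσ, hj, h⟩⟩

lemma card_erase_pos {r : ℕ} {σ : Finset (Fin r)} (h : 2 ≤ σ.card) (k : Fin r) :
    ∃ j ∈ σ, j ≠ k := by
  obtain ⟨j, hj, hjk⟩ := Finset.exists_mem_ne (by omega : 1 < σ.card) k
  exact ⟨j, hj, hjk⟩

lemma BB_finite {r : ℕ} {K : Set (Finset (Fin r))} (hK : ∀ σ, σ ∉ K → 2 ≤ σ.card)
    {D : Fin r → ℕ} (k : Fin r) (f : ∀ k : Fin r, Fin (D k) → ℂ) : (BB K k f).Finite := by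
  have h : (⋃ j : Fin r, {t : ℝ | (toPoly (f j)).eval (t : ℂ) = 0}).Finite := by
    refine Set.finite_iUnion fun j => ?_
    exact (finite_roots (f j)).preimage (Complex.ofReal_injective.injOn)
  refine h.subset ?_
  rintro t ⟨σ, h1, h2, h3⟩
  obtain ⟨j, hj, hjk⟩ := card_erase_pos (hK σ h1) k
  exact Set.mem_iUnion.2 ⟨j, h3 j hj hjk⟩

lemma isClosed_BB_rel {r : ℕ} {K : Set (Finset (Fin r))} 
    {D : Fin r → ℕ} (k : Fin r) {Y : Type*} [TopologicalSpace Y]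
    {f : Y → ∀ k : Fin r, Fin (D k) → ℂ} (hf : Continuous f) :
    IsClosed {z : Y × ℝ | z.2 ∈ BB K k (f z.1)} := by
  have : {z : Y × ℝ | z.2 ∈ BB K k (f z.1)} = ⋃ σ ∈ {σ : Finset (Fin r) | σ ∉ K ∧ k ∈ σ},
      ⋂ j ∈ {j | j ∈ σ ∧ j ≠ k}, {z : Y × ℝ | (toPoly (f z.1 j)).eval (z.2 : ℂ) = 0} := by
    ext z
    simp only [Set.mem_setOf_eq, Set.mem_iUnion, Set.mem_iInter, BB]
    constructor
    · rintro ⟨σ, h1, h2, h3⟩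
      exact ⟨σ, ⟨h1, h2⟩, fun j hj => h3 j hj.1 hj.2⟩
    · rintro ⟨σ, ⟨h1, h2⟩, h3⟩
      exact ⟨σ, h1, h2, fun j hj hjk => h3 j ⟨hj, hjk⟩⟩
  rw [this]
  refine (Set.toFinite _).isClosed_biUnion fun σ _ => isClosed_biInter fun j _ => ?_
  refine isClosed_eq ?_ continuous_const
  exact continuous_toPoly_eval ((continuous_apply j).comp (hf.comp continuous_fst))
    (Complex.continuous_ofReal.comp continuous_snd)

lemma isClosed_exists_root {d : ℕ} {Y : Type*} [TopologicalSpace Y] {W : Set (Y × ℂ)}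
    (hW : IsClosed W) {f : Y → Fin d → ℂ} (hf : Continuous f) :
    IsClosed {y | ∃ α, (toPoly (f y)).eval α = 0 ∧ (y, α) ∈ W} := by
  have h1 : IsClosed {z : Y × (Fin d → ℂ) | ∃ α, (toPoly z.2).eval α = 0 ∧ (z.1, α) ∈ W} := by
    rw [← (isQuotientMap_Vc Y d).isClosed_preimage]
    have : (Prod.map id Vc : Y × (Fin d → ℂ) → _) ⁻¹'
        {z : Y × (Fin d → ℂ) | ∃ α, (toPoly z.2).eval α = 0 ∧ (z.1, α) ∈ W}
        = ⋃ j, {z | (z.1, z.2 j) ∈ W} := by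
      ext z
      simp [eval_Vc_iff]
    rw [this]
    refine isClosed_iUnion_of_finite fun j => hW.preimage ?_
    exact continuous_fst.prodMk ((continuous_apply j).comp continuous_snd)
  exact h1.preimage (continuous_id.prodMk hf)

/-- projection of closed subsets of the relation `BB` are closed -/
lemma isClosed_exists_BB {r : ℕ} {K : Set (Finset (Fin r))} (hK : ∀ σ, σ ∉ K → 2 ≤ σ.card)
    {D : Fin r → ℕ} (k : Fin r) {Y : Type*} [TopologicalSpace Y]
    {f : Y → ∀ k : Fin r, Fin (D k) → ℂ} (hf : Continuous f) {W : Set (Y × ℝ)}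
    (hW : IsClosed W) : IsClosed {y | ∃ t ∈ BB K k (f y), (y, t) ∈ W} := by
  have : {y | ∃ t ∈ BB K k (f y), (y, t) ∈ W} = ⋃ j : Fin r,
      {y | ∃ α, (toPoly (f y j)).eval α = 0 ∧ (y, α) ∈ {z : Y × ℂ | z.2.im = 0 ∧
        z.2.re ∈ BB K k (f z.1) ∧ (z.1, z.2.re) ∈ W}} := by
    ext y
    simp only [Set.mem_setOf_eq, Set.mem_iUnion]
    constructor
    · rintro ⟨t, ht, htW⟩
      obtain ⟨σ, h1, h2, h3⟩ := id ht
      obtain ⟨j, hj, hjk⟩ := card_erase_pos (hK σ h1) k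
      exact ⟨j, t, h3 j hj hjk, by simp, by simpa using ht, by simpa using htW⟩
    · rintro ⟨j, α, -, -, h2, h3⟩
      exact ⟨α.re, h2, h3⟩
  rw [this]
  refine isClosed_iUnion_of_finite fun j => isClosed_exists_root ?_ ((continuous_apply j).comp hf)
  have hre : Continuous fun z : Y × ℂ => (z.1, z.2.re) :=
    continuous_fst.prodMk (Complex.continuous_re.comp continuous_snd)
  refine (isClosed_eq (Complex.continuous_im.comp continuous_snd) continuous_const).inter ?_
  exact ((isClosed_BB_rel k hf).preimage hre).inter (hW.preimage hre)

/-- subtract the value at `ω` from the constant coefficient -/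
lemma toPoly_add_eval {d : ℕ} (a w : Fin d → ℂ) (z : ℂ) :
    (toPoly (a + w)).eval z = (toPoly a).eval z + ∑ i, w i * z ^ (i : ℕ) := by
  simp only [toPoly_eval, Pi.add_apply, add_mul, Finset.sum_add_distrib]
  ring

lemma toPoly_convex_eval {d : ℕ} (a b : Fin d → ℂ) (s : ℝ) (z : ℂ) :
    (toPoly ((1 - s) • a + s • b)).eval z =
      (1 - s : ℝ) * (toPoly a).eval z + (s : ℝ) * (toPoly b).eval z := by
  simp only [toPoly_eval, Pi.add_apply, Pi.smul_apply, add_mul, Finset.sum_add_distrib,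
    Complex.real_smul, mul_add, Finset.mul_sum]
  push_cast
  simp only [mul_assoc]
  ring

def corrC {d : ℕ} (ω : ℂ) (a : Fin d → ℂ) : Fin d → ℂ :=
  a + fun i : Fin d => if (i : ℕ) = 0 then - (toPoly a).eval ω else 0

lemma corrC_eval {d : ℕ} (hd : 0 < d) (ω : ℂ) (a : Fin d → ℂ) (z : ℂ) :
    (toPoly (corrC ω a)).eval z = (toPoly a).eval z - (toPoly a).eval ω := by
  unfold corrC
  rw [toPoly_add_eval, sub_eq_add_neg]
  congr 1
  rw [Finset.sum_eq_single (⟨0, hd⟩ : Fin d)]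
  · simp
  · intro b _ hb
    rw [if_neg, zero_mul]
    intro h; exact hb (Fin.ext h)
  · simp

lemma corrC_eq {d : ℕ} (ω : ℂ) (a : Fin d → ℂ) (h : (toPoly a).eval ω = 0) : corrC ω a = a := by
  unfold corrC
  funext i
  simp [h]

lemma continuous_corrC {d : ℕ} (ω : ℂ) {Y : Type*} [TopologicalSpace Y] {a : Y → Fin d → ℂ}
    (ha : Continuous a) : Continuous fun y => corrC ω (a y) := by
  unfold corrC
  refine ha.add (continuous_pi fun i => ?_)
  split_ifs
  · exact (continuous_toPoly_eval ha continuous_const).neg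
  · exact continuous_const

/-- the root-near-`ω` condition -/
def OO {d : ℕ} (ω : ℂ) (a : Fin d → ℂ) : Prop :=
  ∃ α, (toPoly a).eval α = 0 ∧ α ∈ Metric.ball ω (|ω.im| / 2)

lemma OO_of_root {d : ℕ} {ω : ℂ} (hω : ω.im ≠ 0) {a : Fin d → ℂ}
    (h : (toPoly a).eval ω = 0) : OO ω a :=
  ⟨ω, h, by simpa using hω⟩

lemma isOpen_OO {d : ℕ} (ω : ℂ) : IsOpen {a : Fin d → ℂ | OO ω a} := by
  exact isOpen_exists_root (W := {z : (Fin d → ℂ) × ℂ | z.2 ∈ Metric.ball ω (|ω.im| / 2)})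
    (Metric.isOpen_ball.preimage continuous_snd) continuous_id

lemma target_of_OO {d : ℕ} {ω : ℂ} (a : Fin d → ℂ) (h : OO ω a) (B : Set ℝ)
    (hB : ∀ t ∈ B, (toPoly a).eval (t : ℂ) ≠ 0) :
    ∃ c : Fin d → ℂ, (toPoly c).eval ω = 0 ∧
      ∀ t ∈ B, 0 < ((toPoly c).eval (t : ℂ) * starRingEnd ℂ ((toPoly a).eval (t : ℂ))).re := by
  obtain ⟨α, hα, hball⟩ := h
  obtain ⟨β, rfl⟩ := Vc_surj a
  obtain ⟨j, rfl⟩ := (eval_Vc_iff β α).1 hα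
  refine ⟨Vc (Function.update β j ω), (eval_Vc_iff _ _).2 ⟨j, by simp⟩, fun t ht => ?_⟩
  have h1 := hB t ht
  have hne : (t : ℂ) - β j ≠ 0 := by
    intro h0
    apply h1
    rw [eval_Vc_iff]
    exact ⟨j, by rw [sub_eq_zero] at h0; exact h0.symm⟩
  have key : (toPoly (Vc (Function.update β j ω))).eval (t : ℂ) =
      (1 + (β j - ω) / (t - β j)) * (toPoly (Vc β)).eval (t : ℂ) := by
    have e1 : (1 + (β j - ω) / (t - β j)) = ((t : ℂ) - ω) / (t - β j) := by
      field_simp; ring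
    rw [e1, toPoly_Vc, toPoly_Vc, eval_prod, eval_prod,
      ← Finset.mul_prod_erase _ _ (Finset.mem_univ j),
      ← Finset.mul_prod_erase _ _ (Finset.mem_univ j)]
    have e2 : ∏ x ∈ Finset.univ.erase j, eval (t : ℂ) (X - C (Function.update β j ω x)) =
        ∏ x ∈ Finset.univ.erase j, eval (t : ℂ) (X - C (β x)) := by
      refine Finset.prod_congr rfl fun x hx => ?_
      rw [Function.update_of_ne (Finset.ne_of_mem_erase hx)]
    rw [e2]
    simp only [eval_sub, eval_X, eval_C, Function.update_self]
    field_simp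
  rw [key, mul_assoc, Complex.mul_conj, Complex.re_mul_ofReal]
  refine mul_pos ?_ (Complex.normSq_pos.2 h1)
  rw [Complex.add_re, Complex.one_re]
  have h2 : ‖(β j - ω) / (t - β j)‖ < 1 := by
    rw [norm_div, div_lt_one (norm_pos_iff.2 hne)]
    rw [Metric.mem_ball, dist_eq_norm] at hball
    have h3 := Complex.abs_im_le_norm ((t : ℂ) - β j)
    have h4 := Complex.abs_im_le_norm (β j - ω)
    simp only [Complex.sub_im, Complex.ofReal_im, zero_sub, abs_neg] at h3 h4
    have h5 := abs_sub_abs_le_abs_sub ω.im (β j).im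
    rw [abs_sub_comm] at h5
    linarith
  have h3 := (abs_le.1 (Complex.abs_re_le_norm ((β j - ω) / (t - β j)))).1
  linarith

lemma target_of_small {d : ℕ} {ω : ℂ} (hω : ω.im ≠ 0) (a : Fin d → ℂ) (B : Set ℝ)
    (hfin : B.Finite) (hcard : B.ncard < d)
    (hB : ∀ t ∈ B, (toPoly a).eval (t : ℂ) ≠ 0) :
    ∃ c : Fin d → ℂ, (toPoly c).eval ω = 0 ∧
      ∀ t ∈ B, 0 < ((toPoly c).eval (t : ℂ) * starRingEnd ℂ ((toPoly a).eval (t : ℂ))).re := by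
  obtain ⟨T, rfl⟩ := hfin.exists_finset_coe
  rw [Set.ncard_coe_finset] at hcard
  set L : ℂ[X] := ∏ t ∈ T, (X - C (t : ℂ)) with hL
  have hLdeg : L.natDegree < d := by
    rw [hL, natDegree_prod_of_monic _ _ fun i _ => monic_X_sub_C _]
    simpa using hcard
  have hLev : ∀ z, L.eval z = ∑ i : Fin d, L.coeff i * z ^ (i : ℕ) := by
    intro z
    rw [eval_eq_sum_range' hLdeg, Finset.sum_range]
  have hLω : L.eval ω ≠ 0 := by
    rw [hL, eval_prod, Finset.prod_ne_zero_iff]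
    intro t _ h0
    apply hω
    have : ω = t := by simpa [sub_eq_zero] using h0
    rw [this]; simp
  set m : ℂ := - (toPoly a).eval ω / L.eval ω
  have hev : ∀ z, (toPoly (a + fun i : Fin d => m * L.coeff i)).eval z
      = (toPoly a).eval z + m * L.eval z := by
    intro z
    rw [toPoly_add_eval, hLev, Finset.mul_sum]
    simp only [mul_assoc]
  refine ⟨a + fun i : Fin d => m * L.coeff i, ?_, fun t ht => ?_⟩
  · rw [hev]
    simp only [m]
    field_simp
    ring
  · have : L.eval (t : ℂ) = 0 := by
      rw [hL, eval_prod]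
      exact Finset.prod_eq_zero ht (by simp)
    rw [hev, this, mul_zero, add_zero, Complex.mul_conj, Complex.ofReal_re]
    exact Complex.normSq_pos.2 (hB t ht)

/-- constructor for homotopies in `PolSp` -/
lemma homotopicRel_mk {r : ℕ} {K : Set (Finset (Fin r))} {D : Fin r → ℕ} {Y : Type*}
    [TopologicalSpace Y] {Bd : Set Y} (f g : C(Y, ↥(PolSp K D)))
    (H : ℝ → Y → ∀ k : Fin r, Fin (D k) → ℂ) (hH : Continuous fun z : ℝ × Y => H z.1 z.2)
    (h0 : ∀ y, H 0 y = (f y).1) (h1 : ∀ y, H 1 y = (g y).1)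
    (hB : ∀ s, ∀ y ∈ Bd, H s y = (f y).1)
    (hmem : ∀ s : ℝ, 0 ≤ s → s ≤ 1 → ∀ y, H s y ∈ PolSp K D) : f.HomotopicRel g Bd := by
  refine ⟨⟨⟨⟨fun z => ⟨H z.1 z.2, hmem _ z.1.2.1 z.1.2.2 _⟩, ?_⟩, fun y => ?_, fun y => ?_⟩, ?_⟩⟩
  · refine Continuous.subtype_mk ?_ _
    exact hH.comp ((continuous_subtype_val.comp continuous_fst).prodMk continuous_snd)
  · exact Subtype.ext (by simpa using h0 y)
  · exact Subtype.ext (by simpa using h1 y)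
  · intro s y hy
    exact Subtype.ext (hB _ y hy)

/-- Stage 2 -/
lemma stage2 {r : ℕ} {K : Set (Finset (Fin r))} (hK : ∀ σ, σ ∉ K → 2 ≤ σ.card)
    {D : Fin r → ℕ} (k : Fin r) (hDk : 0 < D k) {ω : ℂ} (hω : ω.im ≠ 0)
    {Y : Type*} [TopologicalSpace Y] [NormalSpace Y] [ParacompactSpace Y]
    {Bd : Set Y} (hBd : IsClosed Bd) (f : C(Y, ↥(PolSp K D)))
    (hfB : ∀ y ∈ Bd, (toPoly ((f y).1 k)).eval ω = 0)
    (h : ∀ y, OO ω ((f y).1 k) ∨ (BB K k (f y).1).ncard < D k) :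
    ∃ g : C(Y, ↥(PolSp K D)), f.HomotopicRel g Bd ∧ ∀ y, (toPoly ((g y).1 k)).eval ω = 0 := by
  have hfc : Continuous fun y => (f y).1 := continuous_subtype_val.comp f.continuous
  have hfk : Continuous fun y => (f y).1 k := (continuous_apply k).comp hfc
  let T : Y → Set (Fin (D k) → ℂ) := fun y => {c | (toPoly c).eval ω = 0 ∧
    (y ∈ Bd → c = (f y).1 k) ∧ ∀ t ∈ BB K k (f y).1,
      0 < ((toPoly c).eval (t : ℂ) * starRingEnd ℂ ((toPoly ((f y).1 k)).eval (t : ℂ))).re}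
  have hopen : ∀ c : Y → Fin (D k) → ℂ, Continuous c → IsOpen {y | ∀ t ∈ BB K k (f y).1,
      0 < ((toPoly (c y)).eval (t : ℂ) *
        starRingEnd ℂ ((toPoly ((f y).1 k)).eval (t : ℂ))).re} := by
    intro c hc
    rw [← isClosed_compl_iff]
    have := isClosed_exists_BB hK k hfc (W := {z : Y × ℝ | ((toPoly (c z.1)).eval (z.2 : ℂ) *
        starRingEnd ℂ ((toPoly ((f z.1).1 k)).eval (z.2 : ℂ))).re ≤ 0}) (by
      refine isClosed_le ?_ continuous_const
      refine Complex.continuous_re.comp (Continuous.mul ?_ (Complex.continuous_conj.comp ?_))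
      · exact continuous_toPoly_eval (hc.comp continuous_fst)
          (Complex.continuous_ofReal.comp continuous_snd)
      · exact continuous_toPoly_eval (hfk.comp continuous_fst)
          (Complex.continuous_ofReal.comp continuous_snd))
    convert this using 1
    ext y
    simp
  have hconv : ∀ y, Convex ℝ (T y) := by
    intro y c1 hc1 c2 hc2 u v hu hv huv
    have hu' : u = 1 - v := by linarith
    subst hu'
    have hev := fun z => toPoly_convex_eval c1 c2 v z
    refine ⟨?_, ?_, ?_⟩
    · rw [hev, hc1.1, hc2.1]; simp
    · intro hy
      rw [hc1.2.1 hy, hc2.2.1 hy, ← add_smul]; simp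
    · intro t ht
      have p1 := hc1.2.2 t ht
      have p2 := hc2.2.2 t ht
      rw [hev, add_mul, Complex.add_re, mul_assoc, mul_assoc, Complex.re_ofReal_mul,
        Complex.re_ofReal_mul]
      rcases eq_or_lt_of_le hv with h0 | h0
      · rw [← h0]; simpa using p1
      · have := mul_pos h0 p2
        have := mul_nonneg hu p1.le
        linarith
  obtain ⟨c, hc⟩ := exists_continuous_forall_mem_convex_of_local hconv (by
    intro y
    by_cases hy : y ∈ Bd
    · refine ⟨_, (hopen (fun y => corrC ω ((f y).1 k)) (continuous_corrC ω hfk)).mem_nhds ?_,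
        fun y => corrC ω ((f y).1 k), (continuous_corrC ω hfk).continuousOn, ?_⟩
      · intro t ht
        rw [corrC_eq _ _ (hfB y hy), Complex.mul_conj, Complex.ofReal_re]
        exact Complex.normSq_pos.2 (BB_ne (f y).2 ht)
      · intro y' hy'
        refine ⟨by rw [corrC_eval hDk]; simp, fun hb => corrC_eq _ _ (hfB y' hb), hy'⟩
    · obtain ⟨c0, hc0, hc1⟩ : ∃ c : Fin (D k) → ℂ, (toPoly c).eval ω = 0 ∧
          ∀ t ∈ BB K k (f y).1, 0 < ((toPoly c).eval (t : ℂ) *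
            starRingEnd ℂ ((toPoly ((f y).1 k)).eval (t : ℂ))).re := by
        rcases h y with h | h
        · exact target_of_OO _ h _ fun t ht => BB_ne (f y).2 ht
        · exact target_of_small hω _ _ (BB_finite hK k _) h fun t ht => BB_ne (f y).2 ht
      refine ⟨_, Filter.inter_mem (hBd.isOpen_compl.mem_nhds hy)
        ((hopen (fun _ => c0) continuous_const).mem_nhds hc1), fun _ => c0,
        continuousOn_const, ?_⟩
      rintro y' ⟨h1, h2⟩
      exact ⟨hc0, fun hb => absurd hb h1, h2⟩)
  have hmem : ∀ s : ℝ, 0 ≤ s → s ≤ 1 → ∀ y, Function.update (f y).1 k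
      ((1 - s) • (f y).1 k + s • c y) ∈ PolSp K D := by
    intro s hs0 hs1 y
    refine update_mem_PolSp (f y).2 fun t ht h0 => ?_
    have p1 := (hc y).2.2 t ht
    have p2 := Complex.normSq_pos.2 (BB_ne (f y).2 ht)
    rw [toPoly_convex_eval] at h0
    have h1 := congrArg (fun z => (z * starRingEnd ℂ ((toPoly ((f y).1 k)).eval (t : ℂ))).re) h0
    simp only [zero_mul, Complex.zero_re] at h1
    rw [add_mul, Complex.add_re, mul_assoc, mul_assoc, Complex.re_ofReal_mul,
        Complex.re_ofReal_mul, Complex.mul_conj, Complex.ofReal_re] at h1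
    rcases eq_or_lt_of_le hs0 with h | h
    · rw [← h] at h1
      simp only [sub_zero, one_mul, zero_mul, add_zero] at h1
      linarith
    · have := mul_pos h p1
      have := mul_nonneg (by linarith : 0 ≤ 1 - s) p2.le
      linarith
  have hcont : Continuous fun z : ℝ × Y => Function.update (f z.2).1 k
      ((1 - z.1) • (f z.2).1 k + z.1 • c z.2) := by
    refine Continuous.update (hfc.comp continuous_snd) k ?_
    have h1 : Continuous fun z : ℝ × Y => (f z.2).1 k := hfk.comp continuous_snd
    have h2 : Continuous fun z : ℝ × Y => c z.2 := c.continuous.comp continuous_snd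
    fun_prop
  refine ⟨⟨fun y => ⟨Function.update (f y).1 k ((1 - (1 : ℝ)) • (f y).1 k + (1 : ℝ) • c y),
    hmem 1 zero_le_one le_rfl y⟩, ?_⟩, ?_, ?_⟩
  · exact Continuous.subtype_mk (hcont.comp (continuous_const.prodMk continuous_id)) _
  · refine homotopicRel_mk f _ (fun s y => Function.update (f y).1 k
      ((1 - s) • (f y).1 k + s • c y)) hcont ?_ ?_ ?_ hmem
    · intro y; simp
    · intro y; rfl
    · intro s y hy
      rw [(hc y).2.1 hy, ← add_smul]; simp
  · intro y
    simpa using (hc y).1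

end PartD

section PartD2
open Polynomial Topology

lemma exists_zero_fun {Z : Type*} [MetricSpace Z] {C : Set Z} (hC : IsClosed C) :
    ∃ g : Z → ℝ, Continuous g ∧ (∀ z, 0 ≤ g z) ∧ ∀ z, g z = 0 ↔ z ∈ C := by
  rcases C.eq_empty_or_nonempty with h | h
  · exact ⟨fun _ => 1, continuous_const, fun _ => zero_le_one, fun z => by simp [h]⟩
  · exact ⟨fun z => Metric.infDist z C, Metric.continuous_infDist_pt C,
      fun z => Metric.infDist_nonneg, fun z => (hC.mem_iff_infDist_zero h).symm⟩

/-- The root `α` is bad: it would cross a forbidden real point while moving to `ω`. -/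
def BadR (B : Set ℝ) (ω α : ℂ) : Prop :=
  ∃ t ∈ B, ∃ l : ℝ, 0 ≤ l ∧ α = t + l * (t - ω)

lemma BadR_iff {ω : ℂ} (hω : ω.im ≠ 0) (B : Set ℝ) (α : ℂ) : BadR B ω α ↔
    0 ≤ -α.im / ω.im ∧
      (α + ((-α.im / ω.im : ℝ) : ℂ) * ω).re / (1 + |-α.im / ω.im|) ∈ B := by
  constructor
  · rintro ⟨t, ht, l, hl, rfl⟩
    have h1 : -((t : ℂ) + l * (t - ω)).im / ω.im = l := by
      simp; field_simp
    rw [h1]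
    refine ⟨hl, ?_⟩
    rw [abs_of_nonneg hl]
    have : ((t : ℂ) + l * (t - ω) + l * ω).re / (1 + l) = t := by
      have : (1 + l) ≠ 0 := by positivity
      simp; field_simp; ring
    rw [this]; exact ht
  · rintro ⟨h1, h2⟩
    refine ⟨_, h2, _, h1, ?_⟩
    rw [abs_of_nonneg h1]
    have h3 : (1 + -α.im / ω.im) ≠ 0 := by positivity
    set l := -α.im / ω.im with hl
    have h4 : α.im = - l * ω.im := by rw [hl]; field_simp
    apply Complex.ext
    · simp only [Complex.add_re, Complex.re_ofReal_mul, Complex.sub_re, Complex.ofReal_re]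
      field_simp; ring
    · simp only [Complex.add_im, Complex.im_ofReal_mul, Complex.sub_im, Complex.ofReal_im]
      rw [h4]; ring

lemma isClosed_BadR {r : ℕ} {K : Set (Finset (Fin r))} 
    {D : Fin r → ℕ} (k : Fin r) {ω : ℂ} (hω : ω.im ≠ 0) {Y : Type*} [TopologicalSpace Y]
    {f : Y → ∀ k : Fin r, Fin (D k) → ℂ} (hf : Continuous f) :
    IsClosed {z : Y × ℂ | BadR (BB K k (f z.1)) ω z.2} := by
  simp only [BadR_iff hω]
  have hl : Continuous fun α : ℂ => -α.im / ω.im := by fun_prop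
  refine IsClosed.inter (isClosed_le continuous_const (hl.comp continuous_snd)) ?_
  refine (isClosed_BB_rel (K := K) k hf).preimage
    (f := fun z : Y × ℂ => (z.1, (z.2 + ((-z.2.im / ω.im : ℝ) : ℂ) * ω).re /
      (1 + |-z.2.im / ω.im|))) ?_
  refine continuous_fst.prodMk (Continuous.comp (g := fun α : ℂ =>
    (α + ((-α.im / ω.im : ℝ) : ℂ) * ω).re / (1 + |-α.im / ω.im|)) ?_ continuous_snd)
  refine Continuous.div ?_ ?_ ?_
  · fun_prop
  · fun_prop
  · intro α; positivity

lemma stage1 {r : ℕ} {K : Set (Finset (Fin r))} 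
    {D : Fin r → ℕ} (k : Fin r) {ω : ℂ} (hω : ω.im ≠ 0)
    {Y : Type*} [MetricSpace Y] [CompactSpace Y]
    {Bd : Set Y} (hBd : IsClosed Bd) (f : C(Y, ↥(PolSp K D)))
    (hfB : ∀ y ∈ Bd, (toPoly ((f y).1 k)).eval ω = 0)
    (Ec : Set (∀ k : Fin r, Fin (D k) → ℂ)) (hEc : IsClosed Ec)
    (hE : ∀ f ∉ Ec, (BB K k f).ncard < D k)
    (h : ∀ y, OO ω ((f y).1 k) ∨ (f y).1 ∉ Ec ∨
      ∃ α, (toPoly ((f y).1 k)).eval α = 0 ∧ ¬ BadR (BB K k (f y).1) ω α) :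
    ∃ g : C(Y, ↥(PolSp K D)), f.HomotopicRel g Bd ∧
      ∀ y, OO ω ((g y).1 k) ∨ (BB K k (g y).1).ncard < D k := by
  have hfc : Continuous fun y => (f y).1 := continuous_subtype_val.comp f.continuous
  have hfk : Continuous fun y => (f y).1 k := (continuous_apply k).comp hfc
  obtain ⟨g, hg, hg0, hgC⟩ := exists_zero_fun
    ((isClosed_BadR (K := K) k hω hfc).union (hBd.preimage (continuous_fst : Continuous
      (Prod.fst : Y × ℂ → Y))))
  have hY1 : IsClosed {y | (f y).1 ∈ Ec ∧ ¬ OO ω ((f y).1 k)} :=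
    (hEc.preimage hfc).inter ((isOpen_OO ω).isClosed_compl.preimage hfk)
  obtain ⟨m, hm⟩ := hY1.isCompact.elim_directed_cover
    (fun m : ℕ => {y | ∃ α, (toPoly ((f y).1 k)).eval α = 0 ∧
      (y, α) ∈ {z : Y × ℂ | 1 < (m + 1) * g z}})
    (fun m => isOpen_exists_root (isOpen_lt continuous_const (by fun_prop)) hfk) (by
      rintro y ⟨hy1, hy2⟩
      rcases h y with h | h | ⟨α, h1, h2⟩
      · exact absurd h hy2
      · exact absurd hy1 h
      · have hpos : 0 < g (y, α) := by
          refine lt_of_le_of_ne (hg0 _) fun h0 => ?_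
          rcases (hgC _).1 h0.symm with h3 | h3
          · exact h2 h3
          · exact hy2 (OO_of_root hω (hfB y h3))
        obtain ⟨m, hm⟩ := exists_nat_gt (1 / g (y, α))
        rw [Set.mem_iUnion]
        refine ⟨m, α, h1, ?_⟩
        rw [div_lt_iff₀ hpos] at hm
        show 1 < ((m : ℝ) + 1) * g (y, α)
        nlinarith) (by
      refine directed_of_isDirected_le fun a b hab y hy => ?_
      obtain ⟨α, h1, h2⟩ := hy
      refine ⟨α, h1, lt_of_lt_of_le (show 1 < ((a : ℝ) + 1) * g (y, α) from h2) ?_⟩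
      have : (a : ℝ) ≤ b := by exact_mod_cast hab
      exact mul_le_mul_of_nonneg_right (by linarith) (hg0 _))
  let w : Y × ℂ → ℝ := fun z => min 1 ((m + 1) * g z)
  have hw : Continuous w := by fun_prop
  have hw0 : ∀ z, 0 ≤ w z := fun z => le_min zero_le_one (mul_nonneg (by positivity) (hg0 z))
  have hw1 : ∀ z, w z ≤ 1 := fun z => min_le_left _ _
  let Φ : ℝ → Y → ℂ → ℂ := fun s y α => α + (s * w (y, α) : ℝ) * (ω - α)
  have hΦ : Continuous fun z : (ℝ × Y) × ℂ => Φ z.1.1 z.1.2 z.2 := by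
    have h1 : Continuous fun z : (ℝ × Y) × ℂ => w (z.1.2, z.2) := by
      exact hw.comp (by fun_prop)
    have h2 : Continuous fun z : (ℝ × Y) × ℂ => ((z.1.1 * w (z.1.2, z.2) : ℝ) : ℂ) := by fun_prop
    show Continuous fun z : (ℝ × Y) × ℂ => z.2 + ((z.1.1 * w (z.1.2, z.2) : ℝ) : ℂ) * (ω - z.2)
    fun_prop
  have hΦm : Continuous fun z : ℝ × Y => moveP (Φ z.1 z.2) ((f z.2).1 k) := by
    have h3 := continuous_moveP (Φ := fun z : ℝ × Y => Φ z.1 z.2) hΦ (hfk.comp continuous_snd)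
    simp only [Function.comp_def] at h3
    exact h3
  let H : ℝ → Y → ∀ k : Fin r, Fin (D k) → ℂ := fun s y =>
    Function.update (f y).1 k (moveP (Φ s y) ((f y).1 k))
  have hH : Continuous fun z : ℝ × Y => H z.1 z.2 :=
    Continuous.update (hfc.comp continuous_snd) k hΦm
  have hmem : ∀ s : ℝ, 0 ≤ s → s ≤ 1 → ∀ y, H s y ∈ PolSp K D := by
    intro s hs0 hs1 y
    refine update_mem_PolSp (f y).2 fun t ht h0 => ?_
    obtain ⟨α, hα, he⟩ := (moveP_root _ _ _).1 h0
    change α + (s * w (y, α) : ℝ) * (ω - α) = t at he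
    set u := s * w (y, α) with hu
    have hu0 : 0 ≤ u := mul_nonneg hs0 (hw0 _)
    have hu1 : u ≤ 1 := mul_le_one₀ hs1 (hw0 _) (hw1 _)
    have hne : u ≠ 1 := by
      intro h1
      rw [h1] at he
      have := congrArg Complex.im he
      simp at this
      exact hω this
    have hlt : 0 < 1 - u := by
      have := lt_of_le_of_ne hu1 hne
      linarith
    have hbad : BadR (BB K k (f y).1) ω α := by
      refine ⟨t, ht, u / (1 - u), by positivity, ?_⟩
      have : (1 - u : ℂ) ≠ 0 := by
        have : ((1 - u : ℝ) : ℂ) ≠ 0 := by exact_mod_cast hlt.ne'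
        simpa using this
      rw [← he]
      push_cast
      field_simp
      ring
    have hw00 : w (y, α) = 0 := by
      have : g (y, α) = 0 := (hgC _).2 (Or.inl hbad)
      simp [w, this]
    rw [hu, hw00] at he
    simp at he
    rw [he] at hα
    exact BB_ne (f y).2 ht hα
  refine ⟨⟨fun y => ⟨H 1 y, hmem 1 zero_le_one le_rfl y⟩, ?_⟩, ?_, ?_⟩
  · exact Continuous.subtype_mk (hH.comp (continuous_const.prodMk continuous_id)) _
  · refine homotopicRel_mk f _ H hH ?_ ?_ ?_ hmem
    · intro y
      show Function.update (f y).1 k (moveP (Φ 0 y) ((f y).1 k)) = _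
      rw [moveP_id, Function.update_eq_self]
      intro α _
      simp [Φ]
    · intro y; rfl
    · intro s y hy
      show Function.update (f y).1 k (moveP (Φ s y) ((f y).1 k)) = _
      rw [moveP_id, Function.update_eq_self]
      intro α _
      have : g (y, α) = 0 := (hgC _).2 (Or.inr hy)
      simp [Φ, w, this]
  · intro y
    show OO ω (Function.update (f y).1 k (moveP (Φ 1 y) ((f y).1 k)) k) ∨
      (BB K k (Function.update (f y).1 k (moveP (Φ 1 y) ((f y).1 k)))).ncard < D k
    rw [BB_update, Function.update_self]
    by_cases hO : OO ω ((f y).1 k)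
    · left
      obtain ⟨α, hα, hb⟩ := hO
      refine ⟨Φ 1 y α, (moveP_root _ _ _).2 ⟨α, hα, rfl⟩, ?_⟩
      rw [Metric.mem_ball, dist_eq_norm] at hb ⊢
      have : Φ 1 y α - ω = ((1 - w (y, α) : ℝ) : ℂ) * (α - ω) := by
        simp only [Φ]; push_cast; ring
      rw [this, norm_mul, Complex.norm_real, Real.norm_eq_abs,
        abs_of_nonneg (by linarith [hw1 (y, α)])]
      have := norm_nonneg (α - ω)
      nlinarith [hw0 (y, α)]
    · by_cases hc : (f y).1 ∈ Ec
      · left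
        obtain ⟨α, hα, h1⟩ := hm ⟨hc, hO⟩
        refine OO_of_root hω ((moveP_root _ _ _).2 ⟨α, hα, ?_⟩)
        have : w (y, α) = 1 := min_eq_left (le_of_lt h1)
        simp [Φ, this]
      · right
        exact hE _ hc

end PartD2

section PartD3
open Polynomial Topology

/-- index set of all roots -/
abbrev RX {r : ℕ} (D : Fin r → ℕ) : Type := Σ j : Fin r, Fin (D j)

lemma BB_count {r : ℕ} {K : Set (Finset (Fin r))} {p : ℕ} (hK : ∀ σ, σ ∉ K → p + 1 ≤ σ.card)
    {D : Fin r → ℕ} (k : Fin r) (β : ∀ j, Fin (D j) → ℂ) {t : ℝ}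
    (ht : t ∈ BB K k (fun j => Vc (β j))) :
    p ≤ (Finset.univ.filter fun x : RX D => x.1 ≠ k ∧ β x.1 x.2 = t).card := by
  obtain ⟨σ, h1, h2, h3⟩ := ht
  have h4 := hK σ h1
  have h5 : p ≤ (σ.erase k).card := by rw [Finset.card_erase_of_mem h2]; omega
  refine h5.trans (le_trans (Finset.card_le_card ?_) (Finset.card_image_le (f := Sigma.fst)))
  intro j hj
  rw [Finset.mem_erase] at hj
  obtain ⟨i, hi⟩ := (eval_Vc_iff (β j) t).1 (h3 j hj.2 hj.1)
  rw [Finset.mem_image]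
  exact ⟨⟨j, i⟩, by simp [hj.1, hi], rfl⟩

/-- the conditions on root tuples -/
def EcB {r : ℕ} {D : Fin r → ℕ} (k : Fin r) (p : ℕ) (g : RX D → Option (Fin (D k))) :
    Set (∀ j, Fin (D j) → ℂ) :=
  {β | (∀ x, x.1 = k → g x = none) ∧
    (∀ c, p ≤ (Finset.univ.filter fun x => g x = some c).card) ∧
    ∀ x c, g x = some c → (β x.1 x.2).im = 0 ∧ ∀ y, g y = some c → β y.1 y.2 = β x.1 x.2}

def Ec {r : ℕ} {D : Fin r → ℕ} (k : Fin r) (p : ℕ) : Set (∀ j, Fin (D j) → ℂ) :=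
  ⋃ g : RX D → Option (Fin (D k)), (fun β j => Vc (β j)) '' EcB k p g

lemma isClosed_EcB {r : ℕ} {D : Fin r → ℕ} (k : Fin r) (p : ℕ) (g : RX D → Option (Fin (D k))) :
    IsClosed (EcB k p g) := by
  refine isClosed_const.inter (isClosed_const.inter ?_)
  have : {β : ∀ j, Fin (D j) → ℂ | ∀ x c, g x = some c → (β x.1 x.2).im = 0 ∧
      ∀ y, g y = some c → β y.1 y.2 = β x.1 x.2} =
      ⋂ x, ⋂ c, ⋂ (_ : g x = some c), ({β | (β x.1 x.2).im = 0} ∩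
        ⋂ y, ⋂ (_ : g y = some c), {β | β y.1 y.2 = β x.1 x.2}) := by
    ext β; simp
  have hc : ∀ x : RX D, Continuous fun β : ∀ j, Fin (D j) → ℂ => β x.1 x.2 := fun x => by fun_prop
  change IsClosed {β : ∀ j, Fin (D j) → ℂ | ∀ x c, g x = some c → (β x.1 x.2).im = 0 ∧
      ∀ y, g y = some c → β y.1 y.2 = β x.1 x.2}
  rw [this]
  refine isClosed_iInter fun x => isClosed_iInter fun c => isClosed_iInter fun _ =>
    IsClosed.inter ?_ (isClosed_iInter fun y => isClosed_iInter fun _ => ?_)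
  · exact isClosed_eq (Complex.continuous_im.comp (hc x)) continuous_const
  · exact isClosed_eq (hc y) (hc x)

lemma isClosed_Ec {r : ℕ} {D : Fin r → ℕ} (k : Fin r) (p : ℕ) :
    IsClosed (Ec k p : Set (∀ j, Fin (D j) → ℂ)) := by
  refine isClosed_iUnion_of_finite fun g => ?_
  have : IsProperMap (fun (β : ∀ j, Fin (D j) → ℂ) j => Vc (β j)) :=
    IsProperMap.pi_map (fun j => isProperMap_Vc)
  exact this.isClosedMap _ (isClosed_EcB k p g)

lemma Vc_surj_all {r : ℕ} {D : Fin r → ℕ} (f : ∀ j, Fin (D j) → ℂ) :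
    ∃ β : ∀ j, Fin (D j) → ℂ, f = fun j => Vc (β j) := by
  choose β hβ using fun j => Vc_surj (f j)
  exact ⟨β, funext fun j => (hβ j).symm⟩

lemma ncard_lt_of_notMem_Ec {r : ℕ} {K : Set (Finset (Fin r))} {p : ℕ}
    (hK : ∀ σ, σ ∉ K → p + 1 ≤ σ.card) {D : Fin r → ℕ} (k : Fin r)
    (f : ∀ j, Fin (D j) → ℂ) (hf : f ∉ Ec k p) : (BB K k f).ncard < D k := by
  by_contra hcon
  push Not at hcon
  apply hf
  obtain ⟨β, rfl⟩ := Vc_surj_all f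
  obtain ⟨S, hS, hSc⟩ := Set.exists_subset_card_eq hcon
  have hfin : S.Finite ∨ D k = 0 := by
    by_cases h : S.Finite
    · exact Or.inl h
    · right; rw [← hSc]; exact Set.Infinite.ncard h
  have : ∃ t : Fin (D k) → ℝ, Function.Injective t ∧
      ∀ c, t c ∈ BB K k (fun j => Vc (β j)) := by
    rcases hfin with h | h
    · have hcard : (h.toFinset).card = D k := by
        rw [← hSc, Set.ncard_eq_toFinset_card S h]
      refine ⟨fun c => (h.toFinset.equivFinOfCardEq hcard).symm c, ?_, fun c => ?_⟩
      · exact Subtype.val_injective.comp (Equiv.injective _)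
      · exact hS (h.mem_toFinset.1 ((h.toFinset.equivFinOfCardEq hcard).symm c).2)
    · have : IsEmpty (Fin (D k)) := by rw [h]; infer_instance
      exact ⟨fun _ => 0, fun a => isEmptyElim a, fun a => isEmptyElim a⟩
  obtain ⟨t, hti, ht⟩ := this
  let g : RX D → Option (Fin (D k)) := fun x =>
    if h : x.1 ≠ k ∧ ∃ c, β x.1 x.2 = t c then some h.2.choose else none
  have hg : ∀ x c, g x = some c ↔ x.1 ≠ k ∧ β x.1 x.2 = t c := by
    intro x c
    simp only [g]
    split_ifs with h
    · have h3 := h.2.choose_spec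
      constructor
      · intro hc
        rw [Option.some.injEq] at hc
        rw [hc] at h3
        exact ⟨h.1, h3⟩
      · rintro ⟨_, h4⟩
        have h5 := h4.symm.trans h3
        rw [Option.some.injEq]
        exact (hti (by exact_mod_cast h5)).symm
    · constructor
      · intro hc; cases hc
      · rintro ⟨h1, h2⟩; exact absurd ⟨h1, c, h2⟩ h
  refine Set.mem_iUnion.2 ⟨g, β, ⟨?_, ?_, ?_⟩, rfl⟩
  · intro x hx
    simp [g, hx]
  · intro c
    refine (BB_count hK k β (ht c)).trans (Finset.card_le_card ?_)
    intro x
    simp only [Finset.mem_filter, Finset.mem_univ, true_and]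
    exact (hg x c).2
  · intro x c hx
    have h1 := ((hg x c).1 hx).2
    refine ⟨by rw [h1]; simp, fun y hy => ?_⟩
    rw [h1, ((hg y c).1 hy).2]

/-- The bad set that must be avoided generically. -/
def ZZ {r : ℕ} (K : Set (Finset (Fin r))) {D : Fin r → ℕ} (k : Fin r) (p : ℕ) (ω : ℂ) :
    Set (∀ j, Fin (D j) → ℂ) :=
  {f | f ∈ Ec k p ∧ ∀ α, (toPoly (f k)).eval α = 0 → BadR (BB K k f) ω α}

/-- free root indices of a pattern -/
abbrev WW {r : ℕ} {D : Fin r → ℕ} (k : Fin r) {N : ℕ} (h : RX D → Option (Fin N)) : Type :=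
  {x : RX D // x.1 ≠ k ∧ h x = none}

abbrev PP {r : ℕ} {D : Fin r → ℕ} (k : Fin r) {N : ℕ} (h : RX D → Option (Fin N)) : Type :=
  (Fin N → ℝ) × ({x : RX D // x.1 = k} → ℝ) × (WW k h → ℂ)

def betaP {r : ℕ} {D : Fin r → ℕ} (k : Fin r) (ω : ℂ) {N : ℕ} (h : RX D → Option (Fin N))
    (a : RX D → Fin N) (P : PP k h) (x : RX D) : ℂ :=
  if hx : x.1 = k then (P.1 (a x) : ℂ) + (P.2.1 ⟨x, hx⟩ : ℂ) * ((P.1 (a x) : ℂ) - ω)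
  else if hh : h x = none then P.2.2 ⟨x, hx, hh⟩
  else ((P.1 ((h x).get (Option.isSome_iff_ne_none.2 hh)) : ℝ) : ℂ)

lemma contDiff_betaP {r : ℕ} {D : Fin r → ℕ} (k : Fin r) (ω : ℂ) {N : ℕ}
    (h : RX D → Option (Fin N)) (a : RX D → Fin N) (x : RX D) :
    ContDiff ℝ 1 fun P : PP k h => betaP k ω h a P x := by
  have hof : ContDiff ℝ 1 (fun t : ℝ => (t : ℂ)) := Complex.ofRealCLM.contDiff
  have h1 : ∀ c : Fin N, ContDiff ℝ 1 fun P : PP k h => ((P.1 c : ℝ) : ℂ) := fun c =>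
    hof.comp ((contDiff_apply ℝ ℝ c).comp contDiff_fst)
  unfold betaP
  by_cases hx : x.1 = k
  · simp only [hx, dite_true]
    have h2 : ContDiff ℝ 1 fun P : PP k h => ((P.2.1 ⟨x, hx⟩ : ℝ) : ℂ) :=
      hof.comp ((contDiff_apply ℝ ℝ _).comp (contDiff_fst.comp contDiff_snd))
    exact (h1 _).add (h2.mul ((h1 _).sub contDiff_const))
  · simp only [hx, dite_false]
    by_cases hh : h x = none
    · simp only [hh, dite_true]
      exact (contDiff_apply ℝ ℂ _).comp (contDiff_snd.comp contDiff_snd)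
    · simp only [hh, dite_false]
      exact h1 _

def PsiP {r : ℕ} {D : Fin r → ℕ} (k : Fin r) (ω : ℂ) {N : ℕ} (h : RX D → Option (Fin N))
    (a : RX D → Fin N) (P : PP k h) : ∀ j, Fin (D j) → ℂ :=
  fun j => Vc fun i => betaP k ω h a P ⟨j, i⟩

lemma contDiff_PsiP {r : ℕ} {D : Fin r → ℕ} (k : Fin r) (ω : ℂ) {N : ℕ}
    (h : RX D → Option (Fin N)) (a : RX D → Fin N) : ContDiff ℝ 1 (PsiP k ω h a) := by
  rw [contDiff_pi]
  intro j
  exact contDiff_Vc _ fun i => contDiff_betaP k ω h a ⟨j, i⟩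

lemma card_RX {r : ℕ} (D : Fin r → ℕ) : Fintype.card (RX D) = ∑ j, D j := by
  simp [RX]

lemma card_slot {r : ℕ} (D : Fin r → ℕ) (k : Fin r) :
    (Finset.univ.filter fun x : RX D => x.1 = k).card = D k := by
  have : (Finset.univ.filter fun x : RX D => x.1 = k) =
      (Finset.univ : Finset (Fin (D k))).map ⟨fun i => ⟨k, i⟩, fun a b h => by
        simpa using h⟩ := by
    ext ⟨j, i⟩
    simp only [Finset.mem_filter, Finset.mem_univ, true_and, Finset.mem_map,
      Function.Embedding.coeFn_mk]
    constructor
    · rintro rfl; exact ⟨i, rfl⟩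
    · rintro ⟨a, ha⟩
      exact (congrArg Sigma.fst ha).symm
  rw [this]; simp

lemma ZZ_cover {r : ℕ} {K : Set (Finset (Fin r))} {p : ℕ} (hp : 1 ≤ p)
    (hK : ∀ σ, σ ∉ K → p + 1 ≤ σ.card) {D : Fin r → ℕ} (k : Fin r) (hk : 0 < D k) (ω : ℂ)
    (f : ∀ j, Fin (D j) → ℂ) (hf : f ∈ ZZ K k p ω) :
    ∃ (N : ℕ) (h : RX D → Option (Fin N)) (a : RX D → Fin N) (P : PP k h),
      N + D k + 2 * Fintype.card (WW k h) + 2 * p * D k ≤ 2 * ∑ j, D j ∧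
      PsiP k ω h a P = f := by
  obtain ⟨hE, hbad⟩ := hf
  obtain ⟨g, hg⟩ := Set.mem_iUnion.1 hE
  obtain ⟨β, ⟨hg1, hg2, hg3⟩, rfl⟩ := hg
  have hb2 : ∀ i : Fin (D k), ∃ t ∈ BB K k (fun j => Vc (β j)), ∃ l : ℝ,
      β k i = t + l * (t - ω) := by
    intro i
    obtain ⟨t, ht, l, _, h⟩ := hbad (β k i) (eval_Vc_root (β k) i)
    exact ⟨t, ht, l, h⟩
  choose t ht l htl using hb2
  have hne : ∀ c, ∃ x, g x = some c := by
    intro c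
    have := lt_of_lt_of_le (by omega : 0 < p) (hg2 c)
    obtain ⟨x, hx⟩ := Finset.card_pos.1 this
    exact ⟨x, by simpa using hx⟩
  choose xc hxc using hne
  let vc : Fin (D k) → ℝ := fun c => (β (xc c).1 (xc c).2).re
  have hvc : ∀ c x, g x = some c → β x.1 x.2 = vc c := by
    intro c x hx
    have h1 := hg3 (xc c) c (hxc c)
    rw [h1.2 x hx]
    apply Complex.ext <;> simp [vc, h1.1]
  let Val : Finset ℝ := Finset.univ.image vc ∪ Finset.univ.image t
  let cnt : ℝ → Finset (RX D) := fun v =>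
    Finset.univ.filter fun x : RX D => x.1 ≠ k ∧ β x.1 x.2 = v
  have hcnt : ∀ v ∈ Val, 2 * p * (Finset.univ.filter fun c => vc c = v).card + 1 ≤
      2 * (cnt v).card + (Finset.univ.filter fun c => vc c = v).card := by
    intro v hv
    have h1 : p * (Finset.univ.filter fun c => vc c = v).card ≤ (cnt v).card := by
      have hsub : (Finset.univ.filter fun c => vc c = v).biUnion
          (fun c => Finset.univ.filter fun x => g x = some c) ⊆ cnt v := by
        intro x hx
        simp only [Finset.mem_biUnion, Finset.mem_filter, Finset.mem_univ, true_and] at hx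
        obtain ⟨c, hc, hx⟩ := hx
        simp only [cnt, Finset.mem_filter, Finset.mem_univ, true_and]
        refine ⟨fun h => ?_, ?_⟩
        · rw [hg1 x h] at hx; cases hx
        · rw [hvc c x hx, hc]
      refine le_trans ?_ (Finset.card_le_card hsub)
      rw [Finset.card_biUnion, mul_comm, ← smul_eq_mul]
      · exact Finset.card_nsmul_le_sum _ _ _ fun c _ => hg2 c
      · intro c _ c' _ hcc
        rw [Function.onFun, Finset.disjoint_left]
        intro x hx hx'
        simp only [Finset.mem_filter, Finset.mem_univ, true_and] at hx hx'
        rw [hx] at hx'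
        exact hcc (Option.some.inj hx')
    have h2 : p ≤ (cnt v).card ∨ 1 ≤ (Finset.univ.filter fun c => vc c = v).card := by
      rcases Finset.mem_union.1 hv with h | h
      · right
        obtain ⟨c, _, hc⟩ := Finset.mem_image.1 h
        exact Finset.card_pos.2 ⟨c, by simp [hc]⟩
      · left
        obtain ⟨i, _, hi⟩ := Finset.mem_image.1 h
        rw [← hi]
        exact BB_count hK k β (ht i)
    set G := (Finset.univ.filter fun c => vc c = v).card
    have h3 : 2 * p * G = 2 * (p * G) := by ring
    rw [h3]
    rcases Nat.eq_zero_or_pos G with h | h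
    · rw [h] at h2 ⊢
      omega
    · omega
  have hsum : ∑ v ∈ Val, (Finset.univ.filter fun c => vc c = v).card = D k := by
    rw [← Finset.card_eq_sum_card_fiberwise]
    · simp
    · intro c _
      exact Finset.mem_coe.2 (Finset.mem_union_left _ (Finset.mem_image_of_mem _ (Finset.mem_univ _)))
  have hsum2 := Finset.sum_le_sum hcnt
  rw [Finset.sum_add_distrib, Finset.sum_add_distrib, ← Finset.mul_sum, ← Finset.mul_sum, hsum]
    at hsum2
  simp only [Finset.sum_const, smul_eq_mul, mul_one] at hsum2
  let e := Val.equivFin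
  let hpat : RX D → Option (Fin Val.card) := fun x =>
    if hx : (β x.1 x.2).im = 0 ∧ (β x.1 x.2).re ∈ Val then some (e ⟨_, hx.2⟩) else none
  have hVpos : 0 < Val.card := by
    refine Finset.card_pos.2 ⟨t ⟨0, hk⟩, Finset.mem_union_right _ ?_⟩
    exact Finset.mem_image_of_mem _ (Finset.mem_univ _)
  have htmem : ∀ i, t i ∈ Val := fun i =>
    Finset.mem_union_right _ (Finset.mem_image_of_mem _ (Finset.mem_univ _))
  let a : RX D → Fin Val.card := fun x =>
    if hx : x.1 = k then e ⟨t (hx ▸ x.2), htmem _⟩ else ⟨0, hVpos⟩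
  let P : PP k hpat := (fun c => (e.symm c : ℝ), fun x => l (x.2 ▸ x.1.2), fun x => β x.1.1 x.1.2)
  refine ⟨Val.card, hpat, a, P, ?_, ?_⟩
  · have hW : Fintype.card (WW k hpat) + ∑ v ∈ Val, (cnt v).card + D k = ∑ j, D j := by
      have hd : ∑ v ∈ Val, (cnt v).card = (Val.biUnion cnt).card := by
        rw [Finset.card_biUnion]
        intro v _ v' _ hvv
        rw [Function.onFun, Finset.disjoint_left]
        intro x hx hx'
        simp only [cnt, Finset.mem_filter, Finset.mem_univ, true_and] at hx hx'
        rw [hx.2] at hx'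
        exact hvv (by exact_mod_cast hx'.2)
      rw [hd, Fintype.card_subtype, ← card_RX D, ← card_slot D k,
        ← Finset.card_union_of_disjoint, ← Finset.card_union_of_disjoint, ← Finset.card_univ]
      · congr 1
        ext x
        simp only [Finset.mem_union, Finset.mem_filter, Finset.mem_univ, true_and,
          Finset.mem_biUnion, cnt, iff_true, hpat]
        by_cases hx : x.1 = k
        · right; exact hx
        · left
          by_cases h : (β x.1 x.2).im = 0 ∧ (β x.1 x.2).re ∈ Val
          · right
            exact ⟨_, h.2, hx, by apply Complex.ext <;> simp [h.1]⟩
          · left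
            exact ⟨hx, by rw [dif_neg h]⟩
      · rw [Finset.disjoint_left]
        intro x hx hx'
        simp only [Finset.mem_union, Finset.mem_filter, Finset.mem_univ, true_and,
          Finset.mem_biUnion, cnt] at hx hx'
        rcases hx with h | ⟨_, _, h, _⟩
        · exact h.1 hx'
        · exact h hx'
      · rw [Finset.disjoint_left]
        intro x hx hx'
        simp only [Finset.mem_filter, Finset.mem_univ, true_and,
          Finset.mem_biUnion, cnt, hpat] at hx hx'
        obtain ⟨v, hv, _, h⟩ := hx'
        have h2 : (β x.1 x.2).im = 0 ∧ (β x.1 x.2).re ∈ Val := by rw [h]; simpa using hv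
        rw [dif_pos h2] at hx
        simp at hx
    omega
  · funext j
    show Vc (fun i => betaP k ω hpat a P ⟨j, i⟩) = Vc (β j)
    congr 1
    funext i
    unfold betaP
    by_cases hx : j = k
    · subst hx
      simp only [dite_true, P, a, Equiv.symm_apply_apply]
      exact (htl i).symm
    · simp only [hx, dite_false]
      split_ifs with hh
      · rfl
      · simp only [P]
        have h2 : (β j i).im = 0 ∧ (β j i).re ∈ Val := by
          by_contra hc
          exact hh (by simp only [hpat]; rw [dif_neg hc])
        have h3 : hpat ⟨j, i⟩ = some (e ⟨_, h2.2⟩) := by simp only [hpat]; rw [dif_pos h2]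
        simp only [h3, Option.get_some, Equiv.symm_apply_apply]
        apply Complex.ext <;> simp [h2.1]

lemma dense_avoid {r : ℕ} {K : Set (Finset (Fin r))} {p : ℕ} (hp : 1 ≤ p)
    (hK : ∀ σ, σ ∉ K → p + 1 ≤ σ.card) {D : Fin r → ℕ} (k : Fin r) (hk : 0 < D k) (ω : ℂ)
    {E : Type*} [NormedAddCommGroup E] [NormedSpace ℝ E] [FiniteDimensional ℝ E]
    (hdim : Module.finrank ℝ E < 2 * p * D k)
    (G : E → ∀ j, Fin (D j) → ℂ) (hG : ContDiff ℝ 1 G) :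
    Dense {v : ∀ j, Fin (D j) → ℂ | ∀ e, G e + v ∉ ZZ K k p ω} := by
  let ι : Type := Σ N : ℕ, (RX D → Option (Fin N)) × (RX D → Fin N)
  let S : Set (∀ j, Fin (D j) → ℂ) := ⋃ i : ι,
    ⋃ (_ : i.1 + D k + 2 * Fintype.card (WW k i.2.1) + 2 * p * D k ≤ 2 * ∑ j, D j),
      Set.range fun z : PP k i.2.1 × E => PsiP k ω i.2.1 i.2.2 z.1 - G z.2
  have hfr : Module.finrank ℝ (∀ j, Fin (D j) → ℂ) = 2 * ∑ j, D j := by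
    rw [Module.finrank_pi_fintype]
    simp [Module.finrank_pi_fintype, Complex.finrank_real_complex, mul_comm]
    rw [Finset.sum_mul]
  have hS : dimH S < Module.finrank ℝ (∀ j, Fin (D j) → ℂ) := by
    have hle : dimH S ≤ ((2 * ∑ j, D j - 1 : ℕ) : ENNReal) := by
      rw [dimH_iUnion]
      refine iSup_le fun i => ?_
      rw [dimH_iUnion]
      refine iSup_le fun hi => ?_
      have hcd : ContDiff ℝ 1 fun z : PP k i.2.1 × E => PsiP k ω i.2.1 i.2.2 z.1 - G z.2 :=
        ((contDiff_PsiP k ω i.2.1 i.2.2).comp contDiff_fst).sub (hG.comp contDiff_snd)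
      refine hcd.dimH_range_le.trans ?_
      rw [Nat.cast_le]
      have : Module.finrank ℝ (PP k i.2.1 × E) =
          i.1 + (D k + 2 * Fintype.card (WW k i.2.1)) + Module.finrank ℝ E := by
        rw [Module.finrank_prod, Module.finrank_prod, Module.finrank_prod,
          Module.finrank_pi, Module.finrank_pi, Module.finrank_pi_fintype]
        simp only [Complex.finrank_real_complex, Fintype.card_fin, Finset.sum_const,
          Finset.card_univ, smul_eq_mul]
        rw [Fintype.card_subtype (fun x : RX D => x.1 = k), card_slot D k]
        ring
      rw [this]
      omega
    refine lt_of_le_of_lt hle ?_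
    rw [hfr, Nat.cast_lt]
    have : D k ≤ ∑ j, D j := Finset.single_le_sum (f := D) (fun _ _ => Nat.zero_le _) (Finset.mem_univ k)
    omega
  refine (dense_compl_of_dimH_lt_finrank hS).mono ?_
  intro v hv e he
  apply hv
  obtain ⟨N, h, a, P, hN, hP⟩ := ZZ_cover hp hK k hk ω _ he
  refine Set.mem_iUnion.2 ⟨⟨N, h, a⟩, Set.mem_iUnion.2 ⟨hN, (P, e), ?_⟩⟩
  show PsiP k ω h a P - G e = v
  rw [hP]; simp

end PartD3

section PartD4
open Polynomial Topology

lemma isOpen_PolSp {r : ℕ} {K : Set (Finset (Fin r))} (hK : ∀ σ, σ ∉ K → 1 ≤ σ.card)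
    (D : Fin r → ℕ) : IsOpen (PolSp K D) := by
  rw [← isClosed_compl_iff]
  have : (PolSp K D)ᶜ = ⋃ σ ∈ {σ : Finset (Fin r) | σ ∉ K},
      {f : ∀ k : Fin r, Fin (D k) → ℂ | ∃ t : ℝ, ∀ j ∈ σ, (toPoly (f j)).eval (t : ℂ) = 0} := by
    ext f
    simp only [PolSp, Set.mem_compl_iff, Set.mem_iUnion, Set.mem_ofPred_eq]
    push Not
    simp only [exists_prop]
  rw [this]
  refine (Set.toFinite _).isClosed_biUnion fun σ hσ => ?_
  obtain ⟨j0, hj0⟩ := Finset.card_pos.1 (hK σ hσ)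
  have h2 : {f : ∀ k : Fin r, Fin (D k) → ℂ | ∃ t : ℝ, ∀ j ∈ σ, (toPoly (f j)).eval (t : ℂ) = 0} =
      {f | ∃ α, (toPoly (f j0)).eval α = 0 ∧ (f, α) ∈ {z : (∀ k : Fin r, Fin (D k) → ℂ) × ℂ |
        z.2.im = 0 ∧ ∀ j ∈ σ, (toPoly (z.1 j)).eval z.2 = 0}} := by
    ext f
    constructor
    · rintro ⟨t, ht⟩
      exact ⟨t, ht j0 hj0, by simp, ht⟩
    · rintro ⟨α, _, h1, h2⟩
      refine ⟨α.re, fun j hj => ?_⟩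
      have : ((α.re : ℝ) : ℂ) = α := by
        apply Complex.ext <;> simp
        exact h1.symm
      rw [this]; exact h2 j hj
  rw [h2]
  refine isClosed_exists_root ?_ (continuous_apply j0)
  refine IsClosed.inter (isClosed_eq (by fun_prop) continuous_const) ?_
  have : {z : (∀ k : Fin r, Fin (D k) → ℂ) × ℂ | ∀ j ∈ σ, (toPoly (z.1 j)).eval z.2 = 0} =
      ⋂ j ∈ σ, {z | (toPoly (z.1 j)).eval z.2 = 0} := by ext; simp
  change IsClosed {z : (∀ k : Fin r, Fin (D k) → ℂ) × ℂ | ∀ j ∈ σ, (toPoly (z.1 j)).eval z.2 = 0}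
  rw [this]
  refine isClosed_biInter fun j _ => isClosed_eq ?_ continuous_const
  exact continuous_toPoly_eval ((continuous_apply j).comp continuous_fst) continuous_snd

lemma stage0 {r : ℕ} {K : Set (Finset (Fin r))} {p : ℕ} (hp : 1 ≤ p)
    (hK : ∀ σ, σ ∉ K → p + 1 ≤ σ.card) {D : Fin r → ℕ} (k : Fin r) (hk : 0 < D k) {ω : ℂ}
    (hω : ω.im ≠ 0)
    {Y : Type*} [MetricSpace Y] [CompactSpace Y]
    {E : Type*} [NormedAddCommGroup E] [NormedSpace ℝ E] [FiniteDimensional ℝ E]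
    (hdim : Module.finrank ℝ E < 2 * p * D k) (ι : Y → E) (hι : Continuous ι)
    (hinj : Function.Injective ι)
    {Bd : Set Y} (hBd : IsClosed Bd) (f : C(Y, ↥(PolSp K D)))
    (hfB : ∀ y ∈ Bd, (toPoly ((f y).1 k)).eval ω = 0) :
    ∃ g : C(Y, ↥(PolSp K D)), f.HomotopicRel g Bd ∧
      ∀ y, OO ω ((g y).1 k) ∨ (g y).1 ∉ ZZ K k p ω := by
  have hfc : Continuous fun y => (f y).1 := continuous_subtype_val.comp f.continuous
  have hfk : Continuous fun y => (f y).1 k := (continuous_apply k).comp hfc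
  have hOO : IsOpen {a : ∀ j, Fin (D j) → ℂ | OO ω (a k)} :=
    (isOpen_OO (d := D k) ω).preimage (f := fun a : ∀ j, Fin (D j) → ℂ => a k) (continuous_apply k)
  obtain ⟨V, hV, hBV, hVO⟩ := normal_exists_closure_subset hBd (hOO.preimage hfc)
    (fun y hy => OO_of_root hω (hfB y hy))
  obtain ⟨χ, hχ0, hχ1, hχ⟩ := exists_continuous_zero_one_of_isClosed hBd hV.isClosed_compl
    (Set.disjoint_compl_right_iff_subset.2 hBV)
  obtain ⟨δ1, hδ1, hT1⟩ := (isCompact_range hfc).exists_thickening_subset_open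
    (isOpen_PolSp (fun σ hσ => by have := hK σ hσ; omega) D)
    (by rintro _ ⟨y, rfl⟩; exact (f y).2)
  obtain ⟨δ2, hδ2, hT2⟩ := ((isClosed_closure (s := V)).isCompact.image hfc).exists_thickening_subset_open
    hOO (by rintro _ ⟨y, hy, rfl⟩; exact hVO hy)
  let δ := min δ1 δ2
  have hδ : 0 < δ := lt_min hδ1 hδ2
  have hemb : IsClosedEmbedding ι := hι.isClosedEmbedding hinj
  obtain ⟨g0, hg0⟩ := ContinuousMap.exists_extension' hemb ⟨_, hfc⟩
  obtain ⟨G, hG, hGa, -⟩ := Continuous.exists_contDiff_approx (n := 1) g0.continuous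
    (continuous_const (y := δ / 2)) (fun _ => by positivity)
  obtain ⟨v, hv1, hv2⟩ := (dense_avoid hp hK k hk ω hdim G (by exact_mod_cast hG)).exists_dist_lt
    (0 : ∀ j, Fin (D j) → ℂ) (show 0 < δ / 2 by positivity)
  let dl : Y → ∀ j, Fin (D j) → ℂ := fun y => G (ι y) + v - (f y).1
  have hdl : Continuous dl := ((hG.continuous.comp hι).add continuous_const).sub hfc
  have hdn : ∀ y, ‖dl y‖ < δ := by
    intro y
    have h1 := hGa (ι y)
    have h2 : g0 (ι y) = (f y).1 := congrFun hg0 y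
    rw [h2, dist_eq_norm] at h1
    rw [dist_comm, dist_zero_right] at hv2
    have : dl y = (G (ι y) - (f y).1) + v := by simp only [dl]; abel
    rw [this]
    refine (norm_add_le _ _).trans_lt ?_
    linarith
  let H : ℝ → Y → ∀ j, Fin (D j) → ℂ := fun s y => (f y).1 + (s * χ y) • dl y
  have hH : Continuous fun z : ℝ × Y => H z.1 z.2 := by
    have h1 : Continuous fun z : ℝ × Y => (f z.2).1 := hfc.comp continuous_snd
    have h2 : Continuous fun z : ℝ × Y => dl z.2 := hdl.comp continuous_snd
    have h3 : Continuous fun z : ℝ × Y => χ z.2 := χ.continuous.comp continuous_snd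
    exact h1.add ((continuous_fst.mul h3).smul h2)
  have hdist : ∀ s : ℝ, 0 ≤ s → s ≤ 1 → ∀ y, dist (H s y) (f y).1 < δ := by
    intro s hs0 hs1 y
    rw [dist_eq_norm]
    simp only [H, add_sub_cancel_left]
    rw [norm_smul, Real.norm_eq_abs, abs_of_nonneg (mul_nonneg hs0 (hχ y).1)]
    have := mul_le_one₀ hs1 (hχ y).1 (hχ y).2
    have h2 := hdn y
    have := mul_le_mul_of_nonneg_right this (norm_nonneg (dl y))
    linarith
  have hmem : ∀ s : ℝ, 0 ≤ s → s ≤ 1 → ∀ y, H s y ∈ PolSp K D := fun s hs0 hs1 y =>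
    hT1 (Metric.mem_thickening_iff.2 ⟨_, ⟨y, rfl⟩, (hdist s hs0 hs1 y).trans_le (min_le_left _ _)⟩)
  refine ⟨⟨fun y => ⟨H 1 y, hmem 1 zero_le_one le_rfl y⟩, ?_⟩, ?_, ?_⟩
  · exact Continuous.subtype_mk (hH.comp (continuous_const.prodMk continuous_id)) _
  · refine homotopicRel_mk f _ H hH ?_ ?_ ?_ hmem
    · intro y; simp [H]
    · intro y; rfl
    · intro s y hy
      have : χ y = 0 := hχ0 hy
      simp [H, this]
  · intro y
    by_cases hy : y ∈ closure V
    · left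
      exact hT2 (Metric.mem_thickening_iff.2 ⟨_, ⟨y, hy, rfl⟩,
        (hdist 1 zero_le_one le_rfl y).trans_le (min_le_right _ _)⟩)
    · right
      have : χ y = 1 := hχ1 (fun h => hy (subset_closure h))
      have h2 : H 1 y = G (ι y) + v := by simp [H, this, dl]
      show H 1 y ∉ _
      rw [h2]
      exact hv1 _

/-- STEP LEMMA. -/
theorem stepLemma {r : ℕ} {K : Set (Finset (Fin r))} {p : ℕ} (hp : 1 ≤ p)
    (hK : ∀ σ, σ ∉ K → p + 1 ≤ σ.card) {D : Fin r → ℕ} (k : Fin r) (hk : 0 < D k) {ω : ℂ}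
    (hω : ω.im ≠ 0)
    {Y : Type*} [MetricSpace Y] [CompactSpace Y]
    {E : Type*} [NormedAddCommGroup E] [NormedSpace ℝ E] [FiniteDimensional ℝ E]
    (hdim : Module.finrank ℝ E < 2 * p * D k) (ι : Y → E) (hι : Continuous ι)
    (hinj : Function.Injective ι)
    {Bd : Set Y} (hBd : IsClosed Bd) (f : C(Y, ↥(PolSp K D)))
    (hfB : ∀ y ∈ Bd, (toPoly ((f y).1 k)).eval ω = 0) :
    ∃ g : C(Y, ↥(PolSp K D)), f.HomotopicRel g Bd ∧
      ∀ y, (toPoly ((g y).1 k)).eval ω = 0 := by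
  obtain ⟨g0, hg0, h0⟩ := stage0 hp hK k hk hω hdim ι hι hinj hBd f hfB
  have hB0 : ∀ y ∈ Bd, (toPoly ((g0 y).1 k)).eval ω = 0 := fun y hy => by
    rw [← hg0.some.fst_eq_snd hy]; exact hfB y hy
  obtain ⟨g1, hg1, h1⟩ := stage1 k hω hBd g0 hB0 (Ec k p) (isClosed_Ec k p)
    (ncard_lt_of_notMem_Ec hK k) (fun y => by
      rcases h0 y with h | h
      · exact Or.inl h
      · right
        by_cases hE : (g0 y).1 ∈ Ec k p
        · right
          by_contra hc
          push Not at hc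
          exact h ⟨hE, hc⟩
        · exact Or.inl hE)
  have hB1 : ∀ y ∈ Bd, (toPoly ((g1 y).1 k)).eval ω = 0 := fun y hy => by
    rw [← hg1.some.fst_eq_snd hy]; exact hB0 y hy
  obtain ⟨g2, hg2, h2⟩ := stage2 (fun σ hσ => by have := hK σ hσ; omega) k hk hω hBd g1 hB1 h1
  exact ⟨g2, (hg0.trans hg1).trans hg2, h2⟩

end PartD4

section PartC
open Polynomial Topology

lemma ofReal_sub_ne {t : ℝ} {ω : ℂ} (hω : ω.im ≠ 0) : (t : ℂ) - ω ≠ 0 := by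
  intro h
  apply hω
  have := congrArg Complex.im h
  simpa using this

/-- The function `1/(t-ω)` on `ℝ ∪ {∞}`. -/
def vv (ω : ℂ) (hω : ω.im ≠ 0) : C(OnePoint ℝ, ℂ) :=
  OnePoint.continuousMapMk (X := ℝ) ⟨fun t : ℝ => ((t : ℂ) - ω)⁻¹, by
    have h1 : Continuous fun t : ℝ => (t : ℂ) - ω := by fun_prop
    exact h1.inv₀ fun t => ofReal_sub_ne hω⟩ 0 (by
    rw [Filter.coclosedCompact_eq_cocompact]
    have h1 : Filter.Tendsto (fun t : ℝ => ‖(t : ℂ) - ω‖) (Filter.cocompact ℝ) Filter.atTop := by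
      refine Filter.tendsto_atTop_mono (f := fun t : ℝ => ‖t‖ + -‖ω‖) (fun t => ?_)
        (Filter.tendsto_atTop_add_const_right _ _ tendsto_norm_cocompact_atTop)
      have := norm_sub_norm_le (t : ℂ) ω
      rw [Complex.norm_real] at this
      linarith
    have h2 := Filter.tendsto_inv₀_cobounded.comp (tendsto_norm_atTop_iff_cobounded.1 h1)
    exact h2)

@[simp] lemma vv_coe (ω : ℂ) (hω : ω.im ≠ 0) (t : ℝ) :
    vv ω hω (t : OnePoint ℝ) = ((t : ℂ) - ω)⁻¹ := rfl

@[simp] lemma vv_infty (ω : ℂ) (hω : ω.im ≠ 0) : vv ω hω OnePoint.infty = 0 := rfl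

lemma im_I_ne : (Complex.I).im ≠ 0 := by simp
lemma im_negI_ne : (-Complex.I).im ≠ 0 := by simp

/-- The denominators. -/
def den (a b : ℕ) (t : ℝ) : ℂ := ((t : ℂ) - Complex.I) ^ a * ((t : ℂ) - -Complex.I) ^ b

lemma den_ne (a b : ℕ) (t : ℝ) : den a b t ≠ 0 :=
  mul_ne_zero (pow_ne_zero _ (ofReal_sub_ne im_I_ne)) (pow_ne_zero _ (ofReal_sub_ne im_negI_ne))

/-- The function `t^i/((t-I)^a (t+I)^b)`, for `i ≤ a + b`. -/
def mon (a b i : ℕ) : C(OnePoint ℝ, ℂ) :=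
  (1 + Complex.I • vv _ im_I_ne) ^ (min i a) * (vv _ im_I_ne) ^ (a - min i a) *
  ((1 + (-Complex.I) • vv _ im_negI_ne) ^ (i - min i a) *
    (vv _ im_negI_ne) ^ (b - (i - min i a)))

lemma mon_coe (a b i : ℕ) (h : i ≤ a + b) (t : ℝ) :
    mon a b i (t : OnePoint ℝ) = (t : ℂ) ^ i / den a b t := by
  have h1 : (t : ℂ) - Complex.I ≠ 0 := ofReal_sub_ne im_I_ne
  have h2 : (t : ℂ) - -Complex.I ≠ 0 := ofReal_sub_ne im_negI_ne
  have e1 : (1 + Complex.I * ((t : ℂ) - Complex.I)⁻¹) = t * ((t : ℂ) - Complex.I)⁻¹ := by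
    field_simp; ring
  have e2 : (1 + (-Complex.I) * ((t : ℂ) - -Complex.I)⁻¹) = t * ((t : ℂ) - -Complex.I)⁻¹ := by
    field_simp; ring
  simp only [mon, ContinuousMap.mul_apply, ContinuousMap.pow_apply, ContinuousMap.add_apply,
    ContinuousMap.one_apply, ContinuousMap.smul_apply, vv_coe, smul_eq_mul]
  rw [e1, e2, mul_pow, mul_pow, den]
  have ha : (((t : ℂ) - Complex.I)⁻¹) ^ (min i a) * (((t : ℂ) - Complex.I)⁻¹) ^ (a - min i a)
      = (((t : ℂ) - Complex.I) ^ a)⁻¹ := by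
    rw [← pow_add, inv_pow]; congr 2; omega
  have hb : (((t : ℂ) - -Complex.I)⁻¹) ^ (i - min i a) *
      (((t : ℂ) - -Complex.I)⁻¹) ^ (b - (i - min i a)) = (((t : ℂ) - -Complex.I) ^ b)⁻¹ := by
    rw [← pow_add, inv_pow]; congr 2; omega
  have hi : (t : ℂ) ^ (min i a) * (t : ℂ) ^ (i - min i a) = (t : ℂ) ^ i := by
    rw [← pow_add]; congr 1; omega
  rw [div_eq_mul_inv, mul_inv, ← ha, ← hb, ← hi]
  ring

lemma mon_infty (a b i : ℕ) (h : i < a + b) : mon a b i OnePoint.infty = 0 := by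
  simp only [mon, ContinuousMap.mul_apply, ContinuousMap.pow_apply, ContinuousMap.add_apply,
    ContinuousMap.one_apply, ContinuousMap.smul_apply, vv_infty]
  by_cases h1 : i < a
  · rw [min_eq_left h1.le, zero_pow (by omega : a - i ≠ 0)]; simp
  · rw [min_eq_right (by omega), zero_pow (by omega : b - (i - a) ≠ 0)]; simp

lemma mon_infty_top (a b : ℕ) : mon a b (a + b) OnePoint.infty = 1 := by
  simp [mon]

/-- The linear part of `rat`. -/
def ratL (a b : ℕ) : (Fin (a + b) → ℂ) →ₗ[ℂ] C(OnePoint ℝ, ℂ) where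
  toFun c := ∑ i, c i • mon a b i
  map_add' c d := by simp [add_smul, Finset.sum_add_distrib]
  map_smul' z c := by simp [mul_smul, Finset.smul_sum]

/-- `f(t)/((t-I)^a(t+I)^b)` as a function on `ℝ ∪ {∞}`. -/
def rat (a b : ℕ) (c : Fin (a + b) → ℂ) : C(OnePoint ℝ, ℂ) := mon a b (a + b) + ratL a b c

lemma rat_coe (a b : ℕ) (c : Fin (a + b) → ℂ) (t : ℝ) :
    rat a b c (t : OnePoint ℝ) = (toPoly c).eval (t : ℂ) / den a b t := by
  simp only [rat, ratL, LinearMap.coe_mk, AddHom.coe_mk, ContinuousMap.add_apply,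
    ContinuousMap.coe_sum, Finset.sum_apply, ContinuousMap.smul_apply, toPoly_eval]
  rw [mon_coe _ _ _ le_rfl, add_div, Finset.sum_div]
  congr 1
  refine Finset.sum_congr rfl fun i _ => ?_
  rw [mon_coe _ _ _ i.2.le, smul_eq_mul, mul_div_assoc]

lemma rat_infty (a b : ℕ) (c : Fin (a + b) → ℂ) : rat a b c OnePoint.infty = 1 := by
  simp only [rat, ratL, LinearMap.coe_mk, AddHom.coe_mk, ContinuousMap.add_apply,
    ContinuousMap.coe_sum, Finset.sum_apply, ContinuousMap.smul_apply]
  rw [mon_infty_top, Finset.sum_eq_zero, add_zero]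
  intro i _
  rw [mon_infty _ _ _ i.2, smul_zero]

lemma onePoint_ext {X : Type*} {f g : OnePoint ℝ → X} (h0 : f OnePoint.infty = g OnePoint.infty)
    (h : ∀ t : ℝ, f t = g t) : f = g := by
  funext x
  induction x using OnePoint.rec with
  | infty => exact h0
  | coe t => exact h t

lemma poly_eq_of_real {p q : ℂ[X]} (h : ∀ t : ℝ, p.eval (t : ℂ) = q.eval (t : ℂ)) : p = q := by
  refine Polynomial.eq_of_infinite_eval_eq p q ?_
  have : (Set.range fun t : ℝ => (t : ℂ)).Infinite :=
    Set.infinite_range_of_injective Complex.ofReal_injective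
  refine this.mono ?_
  rintro _ ⟨t, rfl⟩
  exact h t

lemma rat_eq_iff {a b a' b' : ℕ} (c : Fin (a + b) → ℂ) (c' : Fin (a' + b') → ℂ) :
    rat a b c = rat a' b' c' ↔
      toPoly c * ((X - C Complex.I) ^ a' * (X - C (-Complex.I)) ^ b') =
        toPoly c' * ((X - C Complex.I) ^ a * (X - C (-Complex.I)) ^ b) := by
  have key : ∀ t : ℝ, rat a b c t = rat a' b' c' t ↔
      (toPoly c * ((X - C Complex.I) ^ a' * (X - C (-Complex.I)) ^ b')).eval (t : ℂ) =
        (toPoly c' * ((X - C Complex.I) ^ a * (X - C (-Complex.I)) ^ b)).eval (t : ℂ) := by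
    intro t
    rw [rat_coe, rat_coe, div_eq_div_iff (den_ne _ _ _) (den_ne _ _ _)]
    simp [den]
  constructor
  · intro h
    exact poly_eq_of_real fun t => (key t).1 (by rw [h])
  · intro h
    apply ContinuousMap.ext
    apply congrFun
    exact onePoint_ext (by rw [rat_infty, rat_infty]) fun t => (key t).2 (by rw [h])

lemma rat_injective (a b : ℕ) : Function.Injective (rat a b) := by
  intro c c' h
  rw [rat_eq_iff] at h
  apply toPoly_injective
  refine mul_right_cancel₀ ?_ h
  exact mul_ne_zero (pow_ne_zero _ (X_sub_C_ne_zero _)) (pow_ne_zero _ (X_sub_C_ne_zero _))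

lemma ratL_ker (a b : ℕ) : LinearMap.ker (ratL a b) = ⊥ := by
  rw [LinearMap.ker_eq_bot]
  intro c c' h
  apply rat_injective
  simp only [rat, h]

lemma continuous_ratL (a b : ℕ) : Continuous (ratL a b) :=
  LinearMap.continuous_of_finiteDimensional _

lemma continuous_rat (a b : ℕ) : Continuous (rat a b) :=
  continuous_const.add (continuous_ratL a b)

lemma isInducing_rat {Y : Type*} [TopologicalSpace Y] {a b : ℕ} {f : Y → Fin (a + b) → ℂ}
    (h : Continuous fun y => rat a b (f y)) : Continuous f := by
  have h1 : IsClosedEmbedding (ratL a b) := LinearMap.isClosedEmbedding_of_injective (ratL_ker a b)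
  rw [h1.isEmbedding.continuous_iff]
  have : (ratL a b) ∘ f = fun y => rat a b (f y) - mon a b (a + b) := by
    funext y; simp [rat]
  rw [this]
  exact h.sub continuous_const

lemma isOpen_UK {r : ℕ} (K : Set (Finset (Fin r))) : IsOpen (UK K) := by
  unfold UK
  rw [isOpen_compl_iff]
  refine (Set.toFinite _).isClosed_biUnion fun σ _ => ?_
  have : LSub σ = ⋂ i ∈ σ, {x : Fin r → ℂ | x i = 0} := by ext; simp [LSub]
  rw [this]
  exact isClosed_biInter fun i _ => isClosed_eq (continuous_apply i) continuous_const

lemma UK_mul {r : ℕ} {K : Set (Finset (Fin r))} {x μ : Fin r → ℂ} (hx : x ∈ UK K)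
    (hμ : ∀ k, μ k ≠ 0) : (fun k => μ k * x k) ∈ UK K := by
  rw [mem_UK] at hx ⊢
  intro σ hσ
  obtain ⟨i, hi, h⟩ := hx σ hσ
  exact ⟨i, hi, mul_ne_zero (hμ i) h⟩

lemma rat_mem_UK {r : ℕ} {K : Set (Finset (Fin r))} (hE : ∅ ∈ K) {a b : Fin r → ℕ}
    (f : ∀ k, Fin (a k + b k) → ℂ) (hf : f ∈ PolSp K fun k => a k + b k) (x : OnePoint ℝ) :
    (fun k => rat (a k) (b k) (f k) x) ∈ UK K := by
  induction x using OnePoint.rec with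
  | infty =>
    simp only [rat_infty]
    exact ones_mem_UK hE
  | coe t =>
    have := UK_mul (polEval_mem_UK ⟨f, hf⟩ t) (μ := fun k => (den (a k) (b k) t)⁻¹)
      fun k => inv_ne_zero (den_ne _ _ _)
    simp only [rat_coe]
    convert this using 2 with k
    rw [div_eq_inv_mul]

lemma mem_PolSp_of_rat {r : ℕ} {K : Set (Finset (Fin r))} {a b : Fin r → ℕ}
    (f : ∀ k, Fin (a k + b k) → ℂ)
    (hf : ∀ x : OnePoint ℝ, (fun k => rat (a k) (b k) (f k) x) ∈ UK K) :
    f ∈ PolSp K fun k => a k + b k := by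
  intro σ hσ t
  obtain ⟨i, hi, h⟩ := mem_UK.1 (hf t) σ hσ
  refine ⟨i, hi, fun h0 => h ?_⟩
  show rat (a i) (b i) (f i) (t : OnePoint ℝ) = 0
  rw [rat_coe, h0, zero_div]

/-- Construct maps into a loop space. -/
def mkLoopMap {Y X : Type*} [TopologicalSpace Y] [TopologicalSpace X] {x₀ : X}
    (F : C(Y × OnePoint ℝ, X)) (hF : ∀ y, F (y, OnePoint.infty) = x₀) : C(Y, Loop X x₀) where
  toFun y := ⟨F.curry y, hF y⟩
  continuous_toFun := Continuous.subtype_mk F.curry.continuous _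

@[simp] lemma mkLoopMap_apply {Y X : Type*} [TopologicalSpace Y] [TopologicalSpace X] {x₀ : X}
    (F : C(Y × OnePoint ℝ, X)) (hF : ∀ y, F (y, OnePoint.infty) = x₀) (y : Y) (x : OnePoint ℝ) :
    (mkLoopMap F hF y).1 x = F (y, x) := rfl

lemma Loop.ext' {X : Type*} [TopologicalSpace X] {x₀ : X} {γ δ : Loop X x₀}
    (h : ∀ x, γ.1 x = δ.1 x) : γ = δ := Subtype.ext (ContinuousMap.ext h)

/-- Uncurrying maps into a loop space. -/
lemma continuous_uncurry_loop {Y X : Type*} [TopologicalSpace Y] [TopologicalSpace X] {x₀ : X}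
    (c : C(Y, Loop X x₀)) : Continuous fun z : Y × OnePoint ℝ => (c z.1).1 z.2 := by
  have h1 : Continuous fun y => (c y).1 := continuous_subtype_val.comp c.continuous
  exact (ContinuousMap.continuous_uncurry_of_continuous ⟨_, h1⟩)

lemma continuous_rat_uncurry {Y : Type*} [TopologicalSpace Y] {a b : ℕ} {f : Y → Fin (a + b) → ℂ}
    (hf : Continuous f) : Continuous fun z : Y × OnePoint ℝ => rat a b (f z.1) z.2 :=
  ContinuousMap.continuous_uncurry_of_continuous ⟨_, (continuous_rat a b).comp hf⟩

/-- The embedding `e_{a,b}`. -/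
def eMap {r : ℕ} {K : Set (Finset (Fin r))} (hE : ∅ ∈ K) (a b : Fin r → ℕ) :
    C(↥(PolSp K fun k => a k + b k), Loop ↥(UK K) (onesUK hE)) :=
  mkLoopMap ⟨fun z => ⟨fun k => rat (a k) (b k) (z.1.1 k) z.2, rat_mem_UK hE _ z.1.2 _⟩, by
    refine Continuous.subtype_mk (continuous_pi fun k => ?_) _
    exact continuous_rat_uncurry (f := fun f : ↥(PolSp K fun k => a k + b k) => f.1 k)
      ((continuous_apply k).comp continuous_subtype_val)⟩ (by
    intro y
    apply Subtype.ext
    funext k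
    exact rat_infty _ _ _)

lemma eMap_apply {r : ℕ} {K : Set (Finset (Fin r))} (hE : ∅ ∈ K) (a b : Fin r → ℕ)
    (f : ↥(PolSp K fun k => a k + b k)) (x : OnePoint ℝ) (k : Fin r) :
    ((eMap hE a b f).1 x).1 k = rat (a k) (b k) (f.1 k) x := rfl

lemma eMap_eq_iff {r : ℕ} {K : Set (Finset (Fin r))} (hE : ∅ ∈ K) {a b a' b' : Fin r → ℕ}
    (f : ↥(PolSp K fun k => a k + b k)) (g : ↥(PolSp K fun k => a' k + b' k)) :
    eMap hE a b f = eMap hE a' b' g ↔ ∀ k, rat (a k) (b k) (f.1 k) = rat (a' k) (b' k) (g.1 k) := by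
  constructor
  · intro h k
    ext x
    have := congrArg (fun l => (l.1 x).1 k) h
    exact this
  · intro h
    refine Loop.ext' fun x => Subtype.ext (funext fun k => ?_)
    rw [eMap_apply, eMap_apply, h]

lemma eMap_injective {r : ℕ} {K : Set (Finset (Fin r))} (hE : ∅ ∈ K) (a b : Fin r → ℕ) :
    Function.Injective (eMap hE a b) := by
  intro f g h
  have h2 := (eMap_eq_iff hE f g).1 h
  have h3 : f.1 = g.1 := funext fun k => rat_injective (a k) (b k) (h2 k)
  exact Subtype.ext h3

attribute [irreducible] mon rat

end PartC

section PartE1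
open Polynomial Topology

lemma denNN (N : ℕ) (t : ℝ) : den N N t = ((t : ℂ) ^ 2 + 1) ^ N := by
  unfold den
  rw [← mul_pow]
  congr 1
  ring_nf
  rw [Complex.I_sq]; ring

lemma tsq_ne (t : ℝ) : ((t : ℂ) ^ 2 + 1) ≠ 0 := by
  have := den_ne 1 1 t
  rw [denNN, pow_one] at this
  exact this

/-- The star algebra of rational functions without real poles. -/
def ratAlg : StarSubalgebra ℂ C(OnePoint ℝ, ℂ) where
  carrier := {h | ∃ (N : ℕ) (P : ℂ[X]), P.natDegree ≤ 2 * N ∧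
    ∀ t : ℝ, h t * ((t : ℂ) ^ 2 + 1) ^ N = P.eval (t : ℂ)}
  mul_mem' := by
    rintro f g ⟨N, P, hP, h1⟩ ⟨M, Q, hQ, h2⟩
    refine ⟨N + M, P * Q, natDegree_mul_le.trans (by omega), fun t => ?_⟩
    rw [eval_mul, ← h1, ← h2, ContinuousMap.mul_apply]; ring
  one_mem' := ⟨0, 1, by simp, fun t => by simp⟩
  zero_mem' := ⟨0, 0, by simp, fun t => by simp⟩
  add_mem' := by
    rintro f g ⟨N, P, hP, h1⟩ ⟨M, Q, hQ, h2⟩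
    refine ⟨N + M, P * (X ^ 2 + 1) ^ M + Q * (X ^ 2 + 1) ^ N, ?_, fun t => ?_⟩
    · have hX : ∀ L, ((X ^ 2 + 1 : ℂ[X]) ^ L).natDegree ≤ 2 * L := fun L => by
        refine natDegree_pow_le.trans ?_
        have : (X ^ 2 + 1 : ℂ[X]).natDegree ≤ 2 := by compute_degree
        nlinarith
      refine (natDegree_add_le _ _).trans (max_le ?_ ?_)
      · refine natDegree_mul_le.trans ?_
        have := hX M; omega
      · refine natDegree_mul_le.trans ?_
        have := hX N; omega
    · simp only [eval_add, eval_mul, eval_pow, eval_X, eval_one, ← h1, ← h2,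
        ContinuousMap.add_apply]; ring
  algebraMap_mem' := fun z => ⟨0, C z, by simp, fun t => by simp⟩
  star_mem' := by
    rintro f ⟨N, P, hP, h1⟩
    refine ⟨N, P.map (starRingEnd ℂ), (natDegree_map_le).trans hP, fun t => ?_⟩
    have h2 : ((P.map (starRingEnd ℂ)).eval (t : ℂ)) = starRingEnd ℂ (P.eval (t : ℂ)) := by
      have := Polynomial.eval₂_hom (p := P) (starRingEnd ℂ) (t : ℂ)
      rw [Complex.conj_ofReal] at this
      rw [eval_map, this]
    rw [h2, ← h1]
    simp

lemma ratAlg_dense (h : C(OnePoint ℝ, ℂ)) {ε : ℝ} (hε : 0 < ε) : ∃ g ∈ ratAlg, ‖g - h‖ < ε := by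
  have h1 : ratAlg.topologicalClosure = ⊤ := by
    apply ContinuousMap.starSubalgebra_topologicalClosure_eq_top_of_separatesPoints
    intro x y hxy
    refine ⟨_, ⟨vv _ im_I_ne, ?_, rfl⟩, ?_⟩
    · refine ⟨1, X + C Complex.I, by simp, fun t => ?_⟩
      have h1 : (t : ℂ) - Complex.I ≠ 0 := ofReal_sub_ne im_I_ne
      have h2 : ((t : ℂ) ^ 2 + 1) = (t - Complex.I) * (t + Complex.I) := by
        ring_nf; rw [Complex.I_sq]; ring
      rw [vv_coe, pow_one, h2]
      simp only [eval_add, eval_X, eval_C]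
      field_simp
    · intro he
      apply hxy
      change vv _ im_I_ne x = vv _ im_I_ne y at he
      induction x using OnePoint.rec with
      | infty =>
        induction y using OnePoint.rec with
        | infty => rfl
        | coe s =>
          rw [vv_infty, vv_coe] at he
          exact absurd he.symm (inv_ne_zero (ofReal_sub_ne im_I_ne))
      | coe t =>
        induction y using OnePoint.rec with
        | infty =>
          rw [vv_infty, vv_coe] at he
          exact absurd he (inv_ne_zero (ofReal_sub_ne im_I_ne))
        | coe s =>
          rw [vv_coe, vv_coe] at he
          have := inv_injective he
          simp only [sub_left_inj, Complex.ofReal_inj] at this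
          rw [this]
  have h2 : h ∈ ratAlg.topologicalClosure := by rw [h1]; trivial
  have h3 : h ∈ closure (ratAlg : Set C(OnePoint ℝ, ℂ)) := h2
  obtain ⟨g, hg, hd⟩ := Metric.mem_closure_iff.1 h3 ε hε
  refine ⟨g, hg, ?_⟩
  rwa [dist_comm, dist_eq_norm] at hd

/-- Multiplication by a monic polynomial on coefficient vectors. -/
def mulC {d : ℕ} (d' : ℕ) (Q : ℂ[X]) (c : Fin d → ℂ) : Fin d' → ℂ :=
  fun i => (toPoly c * Q).coeff i

lemma toPoly_mulC {d d' : ℕ} {Q : ℂ[X]} (hQ : Q.Monic) (h : d + Q.natDegree = d')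
    (c : Fin d → ℂ) : toPoly (mulC d' Q c) = toPoly c * Q := by
  unfold mulC
  apply toPoly_of_monic ((toPoly_monic c).mul hQ)
  rw [(toPoly_monic c).natDegree_mul hQ, toPoly_natDegree, h]

lemma continuous_mulC {d d' : ℕ} {Q : ℂ[X]} : Continuous (mulC d' Q : (Fin d → ℂ) → _) := by
  refine continuous_pi fun i => ?_
  unfold mulC toPoly
  simp only [add_mul, Finset.sum_mul, coeff_add, finsetSum_coeff, mul_assoc, coeff_C_mul]
  fun_prop

lemma rat_dense (h : C(OnePoint ℝ, ℂ)) (h1 : h OnePoint.infty = 1) {ε : ℝ} (hε : 0 < ε)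
    (a b : ℕ) : ∃ N₀, ∀ N, N₀ ≤ N → ∃ c : Fin ((a + N) + (b + N)) → ℂ,
      ‖rat (a + N) (b + N) c - h‖ < ε := by
  obtain ⟨g0, hg0, hgh⟩ := ratAlg_dense h (half_pos hε)
  let L := g0 OnePoint.infty
  let g : C(OnePoint ℝ, ℂ) := g0 + algebraMap ℂ _ (1 - L)
  have hg : g ∈ ratAlg := add_mem hg0 (ratAlg.algebraMap_mem _)
  have hL : ‖(1 : ℂ) - L‖ < ε / 2 := by
    refine lt_of_le_of_lt ?_ hgh
    have := (g0 - h).norm_coe_le_norm OnePoint.infty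
    rw [ContinuousMap.sub_apply, h1, norm_sub_rev] at this
    exact this
  have hgn : ‖g - h‖ < ε := by
    have : g - h = (g0 - h) + algebraMap ℂ _ (1 - L) := by simp only [g]; abel
    rw [this]
    refine (norm_add_le _ _).trans_lt ?_
    rw [norm_algebraMap']
    linarith
  have hg1 : g OnePoint.infty = 1 := by simp [g, L]
  obtain ⟨N₀, P, hP, hgP⟩ := hg
  have hsum : g = ∑ i ∈ Finset.range (2 * N₀ + 1), P.coeff i • mon N₀ N₀ i := by
    apply ContinuousMap.ext
    refine congrFun ?_
    refine OnePoint.denseRange_coe.equalizer g.continuous (ContinuousMap.continuous _) ?_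
    funext t
    simp only [Function.comp, ContinuousMap.coe_sum, Finset.sum_apply, ContinuousMap.smul_apply]
    have h3 := hgP t
    rw [← eq_div_iff (pow_ne_zero _ (tsq_ne t))] at h3
    rw [h3, eval_eq_sum_range' (n := 2 * N₀ + 1) (by omega), Finset.sum_div]
    refine Finset.sum_congr rfl fun i hi => ?_
    rw [mon_coe _ _ _ (by have := Finset.mem_range.1 hi; omega), denNN, smul_eq_mul, mul_div_assoc]
  have hPt : P.coeff (2 * N₀) = 1 := by
    have h3 := congrArg (fun h : C(OnePoint ℝ, ℂ) => h OnePoint.infty) hsum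
    simp only [ContinuousMap.coe_sum, Finset.sum_apply, ContinuousMap.smul_apply] at h3
    rw [hg1, Finset.sum_range_succ, Finset.sum_eq_zero, zero_add] at h3
    · have h4 := mon_infty_top N₀ N₀
      rw [← two_mul] at h4
      rw [h4] at h3
      simpa using h3.symm
    · intro i hi
      rw [mon_infty _ _ _ (by have := Finset.mem_range.1 hi; omega), smul_zero]
  have hPm : P.Monic := monic_of_natDegree_le_of_coeff_eq_one _ hP hPt
  have hPd : P.natDegree = 2 * N₀ := by
    refine le_antisymm hP (le_natDegree_of_ne_zero ?_)
    rw [hPt]; exact one_ne_zero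
  refine ⟨N₀, fun N hN => ?_⟩
  let Q : ℂ[X] := P * ((X - C Complex.I) ^ (a + N - N₀) * (X - C (-Complex.I)) ^ (b + N - N₀))
  have hm1 := (monic_X_sub_C (Complex.I)).pow (a + N - N₀)
  have hm2 := (monic_X_sub_C (-Complex.I)).pow (b + N - N₀)
  have hQ : Q.Monic := hPm.mul (hm1.mul hm2)
  have hQd : Q.natDegree = (a + N) + (b + N) := by
    simp only [Q]
    rw [hPm.natDegree_mul (hm1.mul hm2), hm1.natDegree_mul hm2, natDegree_pow, natDegree_pow,
      natDegree_X_sub_C, natDegree_X_sub_C, hPd]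
    omega
  refine ⟨fun i => Q.coeff i, ?_⟩
  have : rat (a + N) (b + N) (fun i => Q.coeff i) = g := by
    apply ContinuousMap.ext
    refine congrFun (onePoint_ext ?_ fun t => ?_)
    · rw [rat_infty, hg1]
    · rw [rat_coe, toPoly_of_monic hQ hQd, div_eq_iff (den_ne _ _ _)]
      simp only [Q, eval_mul, ← hgP, eval_pow, eval_sub, eval_X, eval_C]
      rw [← denNN]
      simp only [den]
      rw [show a + N = N₀ + (a + N - N₀) by omega, show b + N = N₀ + (b + N - N₀) by omega]
      simp only [pow_add, Nat.add_sub_cancel_left]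
      ring
  rw [this]
  exact hgn

end PartE1

section PartE2
open Polynomial Topology

/-- The polynomial `(X-I)^m (X+I)^m'`. -/
def upQ (m m' : ℕ) : ℂ[X] := (X - C Complex.I) ^ m * (X - C (-Complex.I)) ^ m'

lemma upQ_monic (m m' : ℕ) : (upQ m m').Monic :=
  ((monic_X_sub_C _).pow _).mul ((monic_X_sub_C _).pow _)

lemma upQ_natDegree (m m' : ℕ) : (upQ m m').natDegree = m + m' := by
  unfold upQ
  rw [((monic_X_sub_C _).pow _).natDegree_mul ((monic_X_sub_C _).pow _), natDegree_pow,
    natDegree_pow, natDegree_X_sub_C, natDegree_X_sub_C, mul_one, mul_one]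

lemma rat_mulC {a b a' b' : ℕ} (ha : a ≤ a') (hb : b ≤ b') (c : Fin (a + b) → ℂ) :
    rat a' b' (mulC (a' + b') (upQ (a' - a) (b' - b)) c) = rat a b c := by
  rw [rat_eq_iff, toPoly_mulC (upQ_monic _ _) (by rw [upQ_natDegree]; omega), upQ]
  have h1 : (X - C Complex.I : ℂ[X]) ^ a' = (X - C Complex.I) ^ a * (X - C Complex.I) ^ (a' - a) := by
    rw [← pow_add]; congr 1; omega
  have h2 : (X - C (-Complex.I) : ℂ[X]) ^ b' =
      (X - C (-Complex.I)) ^ b * (X - C (-Complex.I)) ^ (b' - b) := by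
    rw [← pow_add]; congr 1; omega
  rw [h1, h2]
  ring

lemma loop_homotopicRel_mk {r : ℕ} {K : Set (Finset (Fin r))} {hE : ∅ ∈ K} {Y : Type*}
    [TopologicalSpace Y] {Bd : Set Y} (f g : C(Y, Loop ↥(UK K) (onesUK hE)))
    (H : ℝ → Y → OnePoint ℝ → Fin r → ℂ)
    (hH : Continuous fun z : (ℝ × Y) × OnePoint ℝ => H z.1.1 z.1.2 z.2)
    (hmem : ∀ s : ℝ, 0 ≤ s → s ≤ 1 → ∀ y x, H s y x ∈ UK K)
    (h0 : ∀ y x, H 0 y x = ((f y).1 x).1) (h1 : ∀ y x, H 1 y x = ((g y).1 x).1)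
    (hi : ∀ s y, H s y OnePoint.infty = onesC)
    (hB : ∀ s, ∀ y ∈ Bd, ∀ x, H s y x = ((f y).1 x).1) : f.HomotopicRel g Bd := by
  let F : C((unitInterval × Y) × OnePoint ℝ, ↥(UK K)) :=
    ⟨fun z => ⟨H z.1.1 z.1.2 z.2, hmem _ z.1.1.2.1 z.1.1.2.2 _ _⟩, by
      refine Continuous.subtype_mk ?_ _
      exact hH.comp (by fun_prop : Continuous fun z : (unitInterval × Y) × OnePoint ℝ =>
        (((z.1.1 : ℝ), z.1.2), z.2))⟩
  have hF : ∀ z, F (z, OnePoint.infty) = onesUK hE := fun z => Subtype.ext (hi _ _)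
  refine ⟨⟨⟨mkLoopMap F hF, fun y => ?_, fun y => ?_⟩, ?_⟩⟩
  · refine Loop.ext' fun x => Subtype.ext ?_
    exact h0 y x
  · refine Loop.ext' fun x => Subtype.ext ?_
    exact h1 y x
  · intro s y hy
    refine Loop.ext' fun x => Subtype.ext ?_
    exact hB s y hy x

lemma continuous_lin_aux {Y : Type*} [TopologicalSpace Y] {a b : ℕ} {u : Y → OnePoint ℝ → ℂ}
    (hu : Continuous fun z : Y × OnePoint ℝ => u z.1 z.2) {g : Y → Fin (a + b) → ℂ}
    (hg : Continuous g) : Continuous fun z : (ℝ × Y) × OnePoint ℝ =>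
      (1 - (z.1.1 : ℂ)) * u z.1.2 z.2 + (z.1.1 : ℂ) * rat a b (g z.1.2) z.2 := by
  have h0 : Continuous fun z : (ℝ × Y) × OnePoint ℝ => (z.1.2, z.2) := by fun_prop
  have h1 := hu.comp h0
  have h2 := (continuous_rat_uncurry hg).comp h0
  have h3 : Continuous fun z : (ℝ × Y) × OnePoint ℝ => ((z.1.1 : ℝ) : ℂ) := by fun_prop
  exact ((continuous_const.sub h3).mul h1).add (h3.mul h2)

set_option maxHeartbeats 800000 in
theorem approxE {r : ℕ} {K : Set (Finset (Fin r))} (hE : ∅ ∈ K) (a b : Fin r → ℕ)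
    {Y : Type*} [MetricSpace Y] [CompactSpace Y] {Bd : Set Y} (hBd : IsClosed Bd)
    (c : C(Y, Loop ↥(UK K) (onesUK hE))) (hcB : ∀ y ∈ Bd, ∃ f, eMap hE a b f = c y) :
    ∃ N : ℕ, ∃ g : C(Y, ↥(PolSp K fun k => (a k + N) + (b k + N))),
      c.HomotopicRel ((eMap hE (fun k => a k + N) (fun k => b k + N)).comp g) Bd := by
  let Cu : Y → OnePoint ℝ → Fin r → ℂ := fun y x => ((c y).1 x).1
  have hCu : Continuous fun z : Y × OnePoint ℝ => Cu z.1 z.2 :=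
    continuous_subtype_val.comp (continuous_uncurry_loop c)
  let ck : Fin r → C(Y, C(OnePoint ℝ, ℂ)) := fun k =>
    ContinuousMap.curry ⟨fun z : Y × OnePoint ℝ => Cu z.1 z.2 k, (continuous_apply k).comp hCu⟩
  have hck : ∀ k y x, ck k y x = Cu y x k := fun _ _ _ => rfl
  have hcki : ∀ k y, ck k y OnePoint.infty = 1 := by
    intro k y
    rw [hck]
    simp only [Cu]
    rw [(c y).2]; rfl
  -- the boundary lift
  have hcB2 : ∀ y ∈ Bd, ∃ f : ∀ k, Fin (a k + b k) → ℂ, ∀ k, rat (a k) (b k) (f k) = ck k y := by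
    intro y hy
    obtain ⟨f, hf⟩ := hcB y hy
    refine ⟨f.1, fun k => ?_⟩
    ext x
    rw [hck]
    simp only [Cu]
    rw [← hf]; rfl
  choose! fB hfB' using hcB2
  have hfBc : Continuous fun y : Bd => fB y := by
    refine continuous_pi fun k => ?_
    apply isInducing_rat
    have : (fun y : Bd => rat (a k) (b k) (fB y k)) = fun y : Bd => ck k y :=
      funext fun y => hfB' y y.2 k
    rw [this]
    exact (ck k).continuous.comp continuous_subtype_val
  obtain ⟨F, hF⟩ := ContinuousMap.exists_restrict_eq hBd (⟨_, hfBc⟩ : C(Bd, ∀ k, Fin (a k + b k) → ℂ))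
  have hF' : ∀ y ∈ Bd, F y = fB y := fun y hy => by
    have := congrArg (fun h => h ⟨y, hy⟩) hF
    exact this
  -- the thickening
  obtain ⟨δ, hδ, hT⟩ := (isCompact_range hCu).exists_thickening_subset_open (isOpen_UK K)
    (by rintro _ ⟨z, rfl⟩; exact ((c z.1).1 z.2).2)
  -- uniform N
  let O : ℕ → Set Y := fun N => {y | ∃ d : ∀ k, Fin ((a k + N) + (b k + N)) → ℂ,
    ∀ k, ‖rat (a k + N) (b k + N) (d k) - ck k y‖ < δ}
  have hOo : ∀ N, IsOpen (O N) := by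
    intro N
    have : O N = ⋃ d : ∀ k, Fin ((a k + N) + (b k + N)) → ℂ, ⋂ k,
        {y | ‖rat (a k + N) (b k + N) (d k) - ck k y‖ < δ} := by
      ext y; simp [O]
    rw [this]
    refine isOpen_iUnion fun d => isOpen_iInter_of_finite fun k => ?_
    exact isOpen_lt ((continuous_const.sub (ck k).continuous).norm) continuous_const
  have hOmono : Monotone O := by
    intro N M hNM y
    rintro ⟨d, hd⟩
    refine ⟨fun k => mulC _ (upQ (a k + M - (a k + N)) (b k + M - (b k + N))) (d k), fun k => ?_⟩
    rw [rat_mulC (by omega) (by omega)]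
    exact hd k
  have hOcov : ∀ y, ∃ N, y ∈ O N := by
    intro y
    choose N0 hN0 using fun k => rat_dense (ck k y) (hcki k y) hδ (a k) (b k)
    refine ⟨∑ k, N0 k, ?_⟩
    choose d hd using fun k => hN0 k (∑ k, N0 k)
      (Finset.single_le_sum (f := N0) (fun _ _ => Nat.zero_le _) (Finset.mem_univ k))
    exact ⟨d, hd⟩
  obtain ⟨N, hN⟩ := isCompact_univ.elim_directed_cover O hOo
    (fun y _ => Set.mem_iUnion.2 (hOcov y)) hOmono.directed_le
  refine ⟨N, ?_⟩
  let up : Y → ∀ k, Fin ((a k + N) + (b k + N)) → ℂ := fun y k =>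
    mulC _ (upQ (a k + N - a k) (b k + N - b k)) (F y k)
  have hup : ∀ k, Continuous fun y => up y k := fun k =>
    continuous_mulC.comp ((continuous_apply k).comp F.continuous)
  have hupr : ∀ y k, rat (a k + N) (b k + N) (up y k) = rat (a k) (b k) (F y k) := fun y k =>
    rat_mulC (by omega) (by omega) _
  let t : Y → Set (∀ k, Fin ((a k + N) + (b k + N)) → ℂ) := fun y =>
    {d | (y ∈ Bd → d = 0) ∧ ∀ k, rat (a k + N) (b k + N) (up y k + d k) - ck k y ∈
      Metric.ball (0 : C(OnePoint ℝ, ℂ)) δ}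
  have htconv : ∀ y, Convex ℝ (t y) := by
    intro y d1 hd1 d2 hd2 s1 s2 hs1 hs2 hs
    refine ⟨fun hy => by simp [hd1.1 hy, hd2.1 hy], fun k => ?_⟩
    have := convex_ball (0 : C(OnePoint ℝ, ℂ)) δ (hd1.2 k) (hd2.2 k) hs1 hs2 hs
    convert this using 1
    have hs' : s2 = 1 - s1 := by linarith
    subst hs'
    have e1 : ∀ (s : ℝ) (v : Fin ((a k + N) + (b k + N)) → ℂ), ratL (a k + N) (b k + N) (s • v) =
        s • ratL (a k + N) (b k + N) v := fun s v =>
      LinearMap.map_smul_of_tower _ s v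
    simp only [rat, map_add, Pi.add_apply, Pi.smul_apply, e1]
    module
  have htloc : ∀ y, ∃ d, ∀ᶠ y' in 𝓝 y, d ∈ t y' := by
    intro y
    have key : ∀ d : ∀ k, Fin ((a k + N) + (b k + N)) → ℂ, d ∈ t y →
        ∀ᶠ y' in 𝓝 y, ∀ k, rat (a k + N) (b k + N) (up y' k + d k) - ck k y' ∈
          Metric.ball (0 : C(OnePoint ℝ, ℂ)) δ := by
      intro d hd
      rw [Filter.eventually_all]
      intro k
      have hcont : Continuous fun y' => rat (a k + N) (b k + N) (up y' k + d k) - ck k y' :=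
        ((continuous_rat _ _).comp ((hup k).add continuous_const)).sub (ck k).continuous
      exact hcont.continuousAt.eventually_mem (Metric.isOpen_ball.mem_nhds (hd.2 k))
    by_cases hy : y ∈ Bd
    · have h0 : (0 : ∀ k, Fin ((a k + N) + (b k + N)) → ℂ) ∈ t y := by
        refine ⟨fun _ => rfl, fun k => ?_⟩
        have : rat (a k + N) (b k + N) (up y k + 0) = ck k y := by
          rw [add_zero, hupr, hF' y hy, hfB' y hy]
        rw [Pi.zero_apply, this, sub_self]
        exact Metric.mem_ball_self hδ
      refine ⟨0, ?_⟩
      filter_upwards [key 0 h0] with y' h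
      exact ⟨fun _ => rfl, h⟩
    · obtain ⟨d, hd⟩ := hN (Set.mem_univ y)
      have h0 : (fun k => d k - up y k) ∈ t y := by
        refine ⟨fun h => absurd h hy, fun k => ?_⟩
        rw [add_sub_cancel, mem_ball_zero_iff]
        exact hd k
      refine ⟨fun k => d k - up y k, ?_⟩
      filter_upwards [key _ h0, hBd.isOpen_compl.mem_nhds hy] with y' h h'
      exact ⟨fun h2 => absurd h2 h', h⟩
  obtain ⟨d, hd⟩ := exists_continuous_forall_mem_convex_of_local_const htconv htloc
  let g : Y → ∀ k, Fin ((a k + N) + (b k + N)) → ℂ := fun y k => up y k + d y k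
  have hg : ∀ k, Continuous fun y => g y k := fun k =>
    (hup k).add ((continuous_apply k).comp d.continuous)
  let H : ℝ → Y → OnePoint ℝ → Fin r → ℂ := fun s y x k =>
    (1 - s) * Cu y x k + s * rat (a k + N) (b k + N) (g y k) x
  have hHc : Continuous fun z : (ℝ × Y) × OnePoint ℝ => H z.1.1 z.1.2 z.2 := by
    refine continuous_pi fun k => ?_
    exact continuous_lin_aux (a := a k + N) (b := b k + N) (u := fun y x => Cu y x k)
      ((continuous_apply k).comp hCu) (g := fun y => g y k) (hg k)
  have hmem : ∀ s : ℝ, 0 ≤ s → s ≤ 1 → ∀ y x, H s y x ∈ UK K := by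
    intro s hs0 hs1 y x
    refine hT (Metric.mem_thickening_iff.2 ⟨_, ⟨(y, x), rfl⟩, ?_⟩)
    rw [dist_pi_lt_iff hδ]
    intro k
    have h1 := (hd y).2 k
    rw [mem_ball_zero_iff] at h1
    have h2 := (ContinuousMap.norm_coe_le_norm (rat (a k + N) (b k + N) (g y k) - ck k y) x).trans_lt h1
    rw [ContinuousMap.sub_apply, hck] at h2
    have h3 : H s y x k - Cu y x k = s * (rat (a k + N) (b k + N) (g y k) x - Cu y x k) := by
      simp only [H]; ring
    rw [dist_eq_norm, h3, norm_mul, Complex.norm_real, Real.norm_eq_abs, abs_of_nonneg hs0]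
    have := mul_le_mul_of_nonneg_right hs1 (norm_nonneg (rat (a k + N) (b k + N) (g y k) x - Cu y x k))
    linarith
  have hH1 : ∀ y x k, H 1 y x k = rat (a k + N) (b k + N) (g y k) x := by
    intro y x k; simp [H]
  have hgP : ∀ y, g y ∈ PolSp K fun k => (a k + N) + (b k + N) := by
    intro y
    apply mem_PolSp_of_rat (a := fun k => a k + N) (b := fun k => b k + N)
    intro x
    have := hmem 1 zero_le_one le_rfl y x
    have h2 : H 1 y x = fun k => rat (a k + N) (b k + N) (g y k) x := funext fun k => hH1 y x k
    rw [h2] at this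
    exact this
  refine ⟨⟨fun y => ⟨g y, hgP y⟩, Continuous.subtype_mk (continuous_pi hg) _⟩, ?_⟩
  refine loop_homotopicRel_mk _ _ H hHc hmem ?_ ?_ ?_ ?_
  · intro y x; funext k; simp [H, Cu]
  · intro y x; funext k; exact hH1 y x k
  · intro s y
    funext k
    have : Cu y OnePoint.infty k = 1 := hcki k y
    simp only [H, rat_infty, this, onesC]; ring
  · intro s y hy x
    funext k
    have h1 : d y = 0 := (hd y).1 hy
    have h2 : rat (a k + N) (b k + N) (g y k) = ck k y := by
      simp only [g, h1, Pi.zero_apply, add_zero]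
      rw [hupr, hF' y hy, hfB' y hy]
    simp only [H, h2, hck]
    show _ = Cu y x k
    ring

end PartE2

section PartE3
open Polynomial Topology

lemma reduce_eMap {r : ℕ} {K : Set (Finset (Fin r))} (hE : ∅ ∈ K) {a b a' b' : Fin r → ℕ}
    (ha : ∀ k, a k ≤ a' k) (hb : ∀ k, b k ≤ b' k) {Y : Type*} [TopologicalSpace Y]
    (g : C(Y, ↥(PolSp K fun k => a' k + b' k)))
    (hdiv : ∀ y k, upQ (a' k - a k) (b' k - b k) ∣ toPoly ((g y).1 k)) :
    ∃ g' : C(Y, ↥(PolSp K fun k => a k + b k)),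
      (eMap hE a b).comp g' = (eMap hE a' b').comp g := by
  have key : ∀ y k, ∃ c : Fin (a k + b k) → ℂ, rat (a k) (b k) c = rat (a' k) (b' k) ((g y).1 k) := by
    intro y k
    obtain ⟨Q, hQ⟩ := hdiv y k
    have hQm : Q.Monic := by
      have := toPoly_monic ((g y).1 k)
      rw [hQ] at this
      exact (upQ_monic _ _).of_mul_monic_left this
    have hQd : Q.natDegree = a k + b k := by
      have h1 := toPoly_natDegree ((g y).1 k)
      rw [hQ, (upQ_monic _ _).natDegree_mul hQm, upQ_natDegree] at h1
      have := ha k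
      have := hb k
      omega
    refine ⟨fun i => Q.coeff i, ?_⟩
    rw [← rat_mulC (ha k) (hb k)]
    congr 1
    apply toPoly_injective
    rw [toPoly_mulC (upQ_monic _ _) (by rw [upQ_natDegree]; have := ha k; have := hb k; omega),
      toPoly_of_monic hQm hQd, hQ, mul_comm]
  choose c hc using key
  have hcc : Continuous c := by
    refine continuous_pi fun k => isInducing_rat ?_
    simp only [hc]
    exact (continuous_rat _ _).comp
      ((continuous_apply k).comp (continuous_subtype_val.comp g.continuous))
  have hmem : ∀ y, c y ∈ PolSp K fun k => a k + b k := by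
    intro y
    apply mem_PolSp_of_rat
    intro x
    simp only [hc]
    exact rat_mem_UK hE _ (g y).2 x
  refine ⟨⟨fun y => ⟨c y, hmem y⟩, Continuous.subtype_mk hcc _⟩, ?_⟩
  apply ContinuousMap.ext
  intro y
  exact (eMap_eq_iff hE _ _).2 fun k => hc y k

lemma chainE {r : ℕ} {K : Set (Finset (Fin r))} (hE : ∅ ∈ K) {p : ℕ} (hp : 1 ≤ p)
    (hK : ∀ σ, σ ∉ K → p + 1 ≤ σ.card) (a b : Fin r → ℕ)
    {Y : Type*} [MetricSpace Y] [CompactSpace Y]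
    {E : Type*} [NormedAddCommGroup E] [NormedSpace ℝ E] [FiniteDimensional ℝ E]
    (hdim : ∀ k, Module.finrank ℝ E < 2 * p * (a k + b k)) (ι : Y → E) (hι : Continuous ι)
    (hinj : Function.Injective ι) {Bd : Set Y} (hBd : IsClosed Bd)
    (c : C(Y, Loop ↥(UK K) (onesUK hE))) (hcB : ∀ y ∈ Bd, ∃ f, eMap hE a b f = c y) :
    ∀ (M : ℕ) (a' b' : Fin r → ℕ), (∀ k, a k ≤ a' k) → (∀ k, b k ≤ b' k) →
      ∑ k, (a' k + b' k) = M →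
      (∃ g : C(Y, ↥(PolSp K fun k => a' k + b' k)), c.HomotopicRel ((eMap hE a' b').comp g) Bd) →
      ∃ g : C(Y, ↥(PolSp K fun k => a k + b k)), c.HomotopicRel ((eMap hE a b).comp g) Bd := by
  intro M
  induction M using Nat.strong_induction_on with
  | _ M ih =>
  intro a' b' ha hb hM ⟨g, hg⟩
  have hbd : ∀ y ∈ Bd, ∀ k, upQ (a' k - a k) (b' k - b k) ∣ toPoly ((g y).1 k) := by
    intro y hy k
    obtain ⟨f, hf⟩ := hcB y hy
    have h1 : c y = eMap hE a' b' (g y) := hg.some.fst_eq_snd hy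
    rw [← hf, eMap_eq_iff] at h1
    have h2 := h1 k
    rw [← rat_mulC (ha k) (hb k)] at h2
    have h3 := rat_injective _ _ h2
    rw [← h3, toPoly_mulC (upQ_monic _ _) (by rw [upQ_natDegree]; have := ha k; have := hb k; omega)]
    exact dvd_mul_left _ _
  have hdim' : ∀ k, Module.finrank ℝ E < 2 * p * (a' k + b' k) := fun k =>
    (hdim k).trans_le (Nat.mul_le_mul_left _ (add_le_add (ha k) (hb k)))
  have hpos : ∀ k, 0 < a' k + b' k := fun k => by
    have := hdim' k
    rcases Nat.eq_zero_or_pos (a' k + b' k) with h | h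
    · rw [h] at this; omega
    · exact h
  by_cases h1 : ∃ k, a k < a' k
  · obtain ⟨k, hk⟩ := h1
    obtain ⟨g1, hg1, hz⟩ := stepLemma hp hK (D := fun k => a' k + b' k) k (hpos k)
      (ω := Complex.I) im_I_ne (hdim' k) ι hι hinj hBd g (by
        intro y hy
        obtain ⟨Q, hQ⟩ := hbd y hy k
        rw [hQ, upQ]
        simp only [eval_mul, eval_pow, eval_sub, eval_X, eval_C, sub_self]
        rw [zero_pow (by omega)]; ring)
    obtain ⟨g2, hg2⟩ := reduce_eMap hE (a := Function.update a' k (a' k - 1)) (b := b')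
      (a' := a') (b' := b') (fun j => by
        by_cases hj : j = k
        · subst hj; simp
        · simp [hj]) (fun j => le_rfl) g1 (by
        intro y j
        by_cases hj : j = k
        · subst hj
          have : a' j - Function.update a' j (a' j - 1) j = 1 := by simp; omega
          rw [this, upQ, Nat.sub_self, pow_one, pow_zero, mul_one]
          exact dvd_iff_isRoot.2 (hz y)
        · have : a' j - Function.update a' k (a' k - 1) j = 0 := by simp [hj]
          rw [this, upQ, Nat.sub_self, pow_zero, pow_zero, mul_one]
          exact one_dvd _)
    refine ih _ ?_ (Function.update a' k (a' k - 1)) b' ?_ hb rfl ⟨g2, ?_⟩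
    · rw [← hM]
      refine Finset.sum_lt_sum (fun j _ => ?_) ⟨k, Finset.mem_univ _, ?_⟩
      · by_cases hj : j = k
        · subst hj; simp
        · simp [hj]
      · simp; omega
    · intro j
      by_cases hj : j = k
      · subst hj; simp; omega
      · simp [hj, ha j]
    · rw [hg2]
      exact hg.trans (hg1.comp_continuousMap _)
  · by_cases h2 : ∃ k, b k < b' k
    · obtain ⟨k, hk⟩ := h2
      obtain ⟨g1, hg1, hz⟩ := stepLemma hp hK (D := fun k => a' k + b' k) k (hpos k)
        (ω := -Complex.I) im_negI_ne (hdim' k) ι hι hinj hBd g (by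
          intro y hy
          obtain ⟨Q, hQ⟩ := hbd y hy k
          rw [hQ, upQ]
          simp only [eval_mul, eval_pow, eval_sub, eval_X, eval_C, sub_self]
          rw [zero_pow (by omega : b' k - b k ≠ 0)]; ring)
      obtain ⟨g2, hg2⟩ := reduce_eMap hE (a := a') (b := Function.update b' k (b' k - 1))
        (a' := a') (b' := b') (fun j => le_rfl) (fun j => by
          by_cases hj : j = k
          · subst hj; simp
          · simp [hj]) g1 (by
          intro y j
          by_cases hj : j = k
          · subst hj
            have : b' j - Function.update b' j (b' j - 1) j = 1 := by simp; omega
            rw [this, upQ, Nat.sub_self, pow_one, pow_zero, one_mul]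
            exact dvd_iff_isRoot.2 (hz y)
          · have : b' j - Function.update b' k (b' k - 1) j = 0 := by simp [hj]
            rw [this, upQ, Nat.sub_self, pow_zero, pow_zero, mul_one]
            exact one_dvd _)
      refine ih _ ?_ a' (Function.update b' k (b' k - 1)) ha ?_ rfl ⟨g2, ?_⟩
      · rw [← hM]
        refine Finset.sum_lt_sum (fun j _ => ?_) ⟨k, Finset.mem_univ _, ?_⟩
        · by_cases hj : j = k
          · subst hj; simp
          · simp [hj]
        · simp; omega
      · intro j
        by_cases hj : j = k
        · subst hj; simp; omega
        · simp [hj, hb j]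
      · rw [hg2]
        exact hg.trans (hg1.comp_continuousMap _)
    · push Not at h1 h2
      obtain rfl : a' = a := funext fun k => le_antisymm (h1 k) (ha k)
      obtain rfl : b' = b := funext fun k => le_antisymm (h2 k) (hb k)
      exact ⟨g, hg⟩

theorem mainE {r : ℕ} {K : Set (Finset (Fin r))} (hE : ∅ ∈ K) {p : ℕ} (hp : 1 ≤ p)
    (hK : ∀ σ, σ ∉ K → p + 1 ≤ σ.card) (a b : Fin r → ℕ)
    {Y : Type*} [MetricSpace Y] [CompactSpace Y]
    {E : Type*} [NormedAddCommGroup E] [NormedSpace ℝ E] [FiniteDimensional ℝ E]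
    (hdim : ∀ k, Module.finrank ℝ E < 2 * p * (a k + b k)) (ι : Y → E) (hι : Continuous ι)
    (hinj : Function.Injective ι) {Bd : Set Y} (hBd : IsClosed Bd)
    (c : C(Y, Loop ↥(UK K) (onesUK hE))) (hcB : ∀ y ∈ Bd, ∃ f, eMap hE a b f = c y) :
    ∃ g : C(Y, ↥(PolSp K fun k => a k + b k)), c.HomotopicRel ((eMap hE a b).comp g) Bd := by
  obtain ⟨N, g, hg⟩ := approxE hE a b hBd c hcB
  exact chainE hE hp hK a b hdim ι hι hinj hBd c hcB _ (fun k => a k + N) (fun k => b k + N)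
    (fun k => by simp) (fun k => by simp) rfl ⟨g, hg⟩

lemma isClosed_cube_boundary (k : ℕ) : IsClosed (Cube.boundary (Fin k)) := by
  have : Cube.boundary (Fin k) = ⋃ i : Fin k, {y | y i = 0 ∨ y i = 1} := by
    ext y; simp [Cube.boundary]
  rw [this]
  refine isClosed_iUnion_of_finite fun i => ?_
  exact (isClosed_eq (continuous_apply i) continuous_const).union
    (isClosed_eq (continuous_apply i) continuous_const)

theorem piMap_eMap {r : ℕ} {K : Set (Finset (Fin r))} (hE : ∅ ∈ K) {p : ℕ} (hp : 1 ≤ p)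
    (hK : ∀ σ, σ ∉ K → p + 1 ≤ σ.card) (a b : Fin r → ℕ) (k : ℕ)
    (hk : ∀ l, k + 1 < 2 * p * (a l + b l)) (x) :
    Function.Bijective (piMap k (eMap hE a b) x) := by
  constructor
  · rw [piMap_injective_iff]
    intro f0 f1 h0 h1 ⟨H⟩
    let Bd : Set (unitInterval × (Fin k → unitInterval)) := {y | y.1 = 0 ∨ y.1 = 1} ∪ {y | y.2 ∈ Cube.boundary (Fin k)}
    have hBd : IsClosed Bd :=
      ((isClosed_eq continuous_fst continuous_const).union
        (isClosed_eq continuous_fst continuous_const)).union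
        ((isClosed_cube_boundary k).preimage continuous_snd)
    obtain ⟨g, hg⟩ := mainE hE hp hK a b (Y := unitInterval × (Fin k → unitInterval)) (E := ℝ × (Fin k → ℝ)) (fun l => by
      simpa [add_comm] using hk l) (fun y : unitInterval × (Fin k → unitInterval) => ((y.1 : ℝ), fun i => (y.2 i : ℝ)))
      (by fun_prop) (by
        rintro ⟨y1, y2⟩ ⟨z1, z2⟩ h
        simp only [Prod.mk.injEq] at h
        refine Prod.ext (Subtype.ext h.1) (funext fun i => Subtype.ext (congrFun h.2 i))) hBd
      H.toContinuousMap (by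
        rintro ⟨s, v⟩ ((h | h) | h)
        · change s = 0 at h
          subst h
          exact ⟨f0 v, (H.map_zero_left v).symm⟩
        · change s = 1 at h
          subst h
          exact ⟨f1 v, (H.map_one_left v).symm⟩
        · refine ⟨f0 v, ?_⟩
          exact (H.eq_fst s h).symm)
    have hgB : ∀ y ∈ Bd, H y = eMap hE a b (g y) := fun y hy => hg.some.fst_eq_snd hy
    refine ⟨⟨⟨g, fun v => ?_, fun v => ?_⟩, ?_⟩⟩
    · apply eMap_injective hE a b
      exact (hgB (0, v) (Or.inl (Or.inl rfl))).symm.trans (H.map_zero_left v)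
    · apply eMap_injective hE a b
      exact (hgB (1, v) (Or.inl (Or.inr rfl))).symm.trans (H.map_one_left v)
    · intro s v hv
      apply eMap_injective hE a b
      exact (hgB (s, v) (Or.inr hv)).symm.trans (H.eq_fst s hv)
  · rw [piMap_surjective_iff]
    intro c hc
    obtain ⟨g, hg⟩ := mainE hE hp hK a b (Y := Fin k → unitInterval) (E := Fin k → ℝ) (fun l => by
      have := hk l
      rw [Module.finrank_fin_fun]
      omega) (fun y => fun i => (y i : ℝ))
      (by fun_prop) (by
        intro y z h
        exact (funext fun i => Subtype.ext (congrFun h i))) (isClosed_cube_boundary k) c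
      (fun y hy => ⟨x, (hc y hy).symm⟩)
    refine ⟨g, fun v hv => ?_, hg.symm⟩
    apply eMap_injective hE a b
    have : c v = eMap hE a b (g v) := hg.some.fst_eq_snd hv
    rw [← this, hc v hv]

end PartE3

section PartF1
open Polynomial Topology

/-- smooth dual-vector property of the complex `K`. -/
def DualProp {n r : ℕ} (N : Fin r → Fin n → ℤ) (K : Set (Finset (Fin r))) : Prop :=
  ∀ σ ∈ K, ∃ m : Fin r → Fin n → ℤ, ∀ i ∈ σ, ∀ j ∈ σ,
    ∑ l, N j l * m i l = if i = j then 1 else 0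

lemma zr_smul_aux {n : ℕ} (c : ℕ) (v : Fin n → ℤ) : (c : ℝ) • zr v = zr ((c : ℤ) • v) := by
  ext i; simp [zr]

lemma zr_inj {n : ℕ} {v w : Fin n → ℤ} (h : zr v = zr w) : v = w := by
  ext i
  have := congrFun h i
  simp only [zr] at this
  exact_mod_cast this

lemma zr_mem_cone {n r : ℕ} (N : Fin r → Fin n → ℤ) {σ : Finset (Fin r)} {j} (hj : j ∈ σ) :
    zr (N j) ∈ coneIdx N σ := by
  refine ⟨fun i => if i = j then 1 else 0, fun i => by dsimp only; split_ifs <;> norm_num, ?_⟩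
  simp [ite_smul, hj]

lemma zr_mem_ray {n : ℕ} (v : Fin n → ℝ) : v ∈ ray v := ⟨1, zero_le_one, by simp⟩

/-- every generator of a cone of a nonsingular fan is a basis vector -/
lemma gen_eq_basis {n r : ℕ} (F : Fan n) (N : Fin r → Fin n → ℤ) (hPG : IsPrimGens F N)
    {σ : Finset (Fin r)} (hσ : coneIdx N σ ∈ F.cones)
    (b : Module.Basis (Fin n) ℤ (Fin n → ℤ)) (s : Finset (Fin n))
    (hs : coneIdx N σ = {x | ∃ lam : Fin n → ℝ, (∀ i, 0 ≤ lam i) ∧ x = ∑ i ∈ s, lam i • zr (b i)})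
    {j : Fin r} (hj : j ∈ σ) : ∃ i, N j = b i := by
  have hmem := zr_mem_cone N hj
  obtain ⟨L, hL, hface⟩ := F.inter_face _ hσ _ (hPG.ray_mem j)
  have hjf : zr (N j) ∈ coneIdx N σ ∩ ray (zr (N j)) := ⟨hmem, zr_mem_ray _⟩
  rw [hface] at hjf
  have hL0 : L (zr (N j)) = 0 := hjf.2
  have hm2 := hmem
  rw [hs] at hm2
  obtain ⟨lam, hlam, hx⟩ := hm2
  have hb : ∀ i ∈ s, zr (b i) ∈ coneIdx N σ := by
    intro i hi
    rw [hs]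
    refine ⟨fun l => if l = i then 1 else 0, fun l => by dsimp only; split_ifs <;> norm_num, ?_⟩
    simp [ite_smul, hi]
  have hne : ∃ i ∈ s, lam i ≠ 0 := by
    by_contra hcon
    push Not at hcon
    apply hPG.ne_zero j
    apply zr_inj
    rw [hx, Finset.sum_eq_zero (fun i hi => by rw [hcon i hi, zero_smul])]
    ext; simp [zr]
  obtain ⟨i, hi, hli⟩ := hne
  have hLi : L (zr (b i)) = 0 := by
    rw [hx, map_sum] at hL0
    have h1 := (Finset.sum_eq_zero_iff_of_nonneg (fun l hl => by
      rw [map_smul]; exact mul_nonneg (hlam l) (hL _ (hb l hl)))).1 hL0 i hi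
    rw [map_smul, smul_eq_mul] at h1
    exact (mul_eq_zero.1 h1).resolve_left hli
  have hbr : zr (b i) ∈ coneIdx N σ ∩ ray (zr (N j)) := by
    rw [hface]; exact ⟨hb i hi, hLi⟩
  have hbl : zr (b i) ∈ ray (zr (N j)) ∩ {x | IsLatticePoint x} :=
    ⟨hbr.2, fun l => ⟨b i l, rfl⟩⟩
  rw [hPG.primitive] at hbl
  obtain ⟨c, hc⟩ := hbl
  rw [zr_smul_aux] at hc
  have hc' := zr_inj hc
  have h1 : b.coord i (b i) = 1 := by simp
  rw [hc', map_smul, smul_eq_mul] at h1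
  have : (c : ℤ) = 1 := by
    have := Int.eq_one_or_neg_one_of_mul_eq_one h1
    omega
  rw [this, one_smul] at hc'
  exact ⟨i, hc'.symm⟩

theorem dualProp_of_fan {n r : ℕ} (F : Fan n) (N : Fin r → Fin n → ℤ) (hPG : IsPrimGens F N)
    (hNS : F.NonSingular) (K : Set (Finset (Fin r))) (hK : ∀ σ ∈ K, coneIdx N σ ∈ F.cones) :
    DualProp N K := by
  intro σ hσ
  obtain ⟨b, s, hs⟩ := hNS _ (hK σ hσ)
  have hex : ∀ j : Fin r, ∃ i : Fin n, j ∈ σ → N j = b i := by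
    intro j
    by_cases hj : j ∈ σ
    · obtain ⟨i, hi⟩ := gen_eq_basis F N hPG (hK σ hσ) b s hs hj
      exact ⟨i, fun _ => hi⟩
    · -- need some element of Fin n
      have : Nonempty (Fin n) := by
        by_contra hcon
        rw [not_nonempty_iff] at hcon
        exact hPG.ne_zero j (Subsingleton.elim _ _)
      exact ⟨this.some, fun h => absurd h hj⟩
  choose ix hix using hex
  refine ⟨fun i l => b.coord (ix i) (Pi.single l 1), fun i hi j hj => ?_⟩
  have h1 : ∑ l, N j l * b.coord (ix i) (Pi.single l 1) = b.coord (ix i) (N j) := by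
    conv_rhs => rw [pi_eq_sum_univ' (N j), map_sum]
    refine Finset.sum_congr rfl fun l _ => ?_
    rw [map_smul, smul_eq_mul]
  rw [h1, hix j hj, Module.Basis.coord_apply, Module.Basis.repr_self, Finsupp.single_apply]
  by_cases hij : i = j
  · subst hij; simp
  · rw [if_neg hij, if_neg]
    intro h
    apply hij
    apply hPG.inj
    rw [hix i hi, hix j hj, h]

lemma prod_zpow_sum {ι : Type*} (s : Finset ι) (a : ℂ) (ha : a ≠ 0) (e : ι → ℤ) :
    ∏ k ∈ s, a ^ e k = a ^ ∑ k ∈ s, e k := by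
  induction s using Finset.induction_on with
  | empty => simp
  | insert i s hi ih => rw [Finset.prod_insert hi, Finset.sum_insert hi, zpow_add₀ ha, ih]

/-- the characters -/
def chi {n r : ℕ} (N : Fin r → Fin n → ℤ) (l : Fin n) (μ : Fin r → ℂ) : ℂ := ∏ k, μ k ^ N k l

lemma chi_mul {n r : ℕ} (N : Fin r → Fin n → ℤ) (l : Fin n) (μ ν : Fin r → ℂ) :
    chi N l (fun k => μ k * ν k) = chi N l μ * chi N l ν := by
  simp [chi, mul_zpow, Finset.prod_mul_distrib]

lemma chi_ne {n r : ℕ} (N : Fin r → Fin n → ℤ) (l : Fin n) (μ : Fin r → ℂ) (h : ∀ k, μ k ≠ 0) :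
    chi N l μ ≠ 0 := Finset.prod_ne_zero_iff.2 fun k _ => zpow_ne_zero _ (h k)

lemma prod_chi {n r : ℕ} (N : Fin r → Fin n → ℤ) (μ : Fin r → ℂ) (h : ∀ k, μ k ≠ 0)
    (m : Fin n → ℤ) : ∏ k, μ k ^ (∑ j, N k j * m j) = ∏ l, chi N l μ ^ m l := by
  have h1 : ∀ k, μ k ^ (∑ j, N k j * m j) = ∏ j, (μ k ^ N k j) ^ m j := by
    intro k
    rw [← prod_zpow_sum _ _ (h k)]
    exact Finset.prod_congr rfl fun j _ => zpow_mul _ _ _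
  simp_rw [h1]
  rw [Finset.prod_comm]
  refine Finset.prod_congr rfl fun l _ => ?_
  rw [chi, Finset.prod_zpow]

lemma mem_GSet_iff {n r : ℕ} (N : Fin r → Fin n → ℤ) (μ : Fin r → ℂ) :
    μ ∈ GSet N ↔ (∀ k, μ k ≠ 0) ∧ ∀ l, chi N l μ = 1 := by
  constructor
  · rintro ⟨h, h1⟩
    refine ⟨h, fun l => ?_⟩
    have := h1 (Pi.single l 1)
    simpa [Pi.single_apply, chi] using this
  · rintro ⟨h, h1⟩
    refine ⟨h, fun m => ?_⟩
    rw [prod_chi N μ h]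
    simp [h1]

lemma GSet_mul {n r : ℕ} {N : Fin r → Fin n → ℤ} {μ ν : Fin r → ℂ} (hμ : μ ∈ GSet N)
    (hν : ν ∈ GSet N) : (fun k => μ k * ν k) ∈ GSet N := by
  rw [mem_GSet_iff] at *
  refine ⟨fun k => mul_ne_zero (hμ.1 k) (hν.1 k), fun l => ?_⟩
  rw [chi_mul, hμ.2, hν.2, mul_one]

lemma GSet_inv {n r : ℕ} {N : Fin r → Fin n → ℤ} {μ : Fin r → ℂ} (hμ : μ ∈ GSet N) :
    (fun k => (μ k)⁻¹) ∈ GSet N := by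
  rw [mem_GSet_iff] at *
  refine ⟨fun k => inv_ne_zero (hμ.1 k), fun l => ?_⟩
  have : chi N l (fun k => (μ k)⁻¹) = (chi N l μ)⁻¹ := by simp [chi]
  rw [this, hμ.2, inv_one]

lemma GSet_one {n r : ℕ} (N : Fin r → Fin n → ℤ) : (fun _ => 1 : Fin r → ℂ) ∈ GSet N := by
  rw [mem_GSet_iff]; simp [chi]

/-- retraction of the torus onto `G` -/
theorem exists_retr {n r : ℕ} (N : Fin r → Fin n → ℤ) (h2 : Cond2 N) :
    ∃ R : (Fin r → ℂ) → (Fin r → ℂ), ContinuousOn R {μ | ∀ k, μ k ≠ 0} ∧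
      (∀ μ, (∀ k, μ k ≠ 0) → R μ ∈ GSet N) ∧
      ∀ μ ∈ GSet N, ∀ ν, (∀ k, ν k ≠ 0) → R (fun k => μ k * ν k) = fun k => μ k * R ν k := by
  have hS : ∀ l : Fin n, ∃ S : Fin r → ℤ, ∑ k, S k • N k = Pi.single l 1 := by
    intro l
    have : (Pi.single l 1 : Fin n → ℤ) ∈ Submodule.span ℤ (Set.range N) := by
      rw [h2]; trivial
    rwa [Submodule.mem_span_range_iff_exists_fun] at this
  choose S hS using hS
  refine ⟨fun μ k => μ k * ∏ l, chi N l μ ^ (- S l k), ?_, ?_, ?_⟩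
  · refine continuousOn_pi.2 fun k => ContinuousOn.mul (continuous_apply k).continuousOn ?_
    refine continuousOn_finset_prod _ fun l _ => ContinuousOn.zpow₀ ?_ _ ?_
    · refine continuousOn_finset_prod _ fun k _ => ContinuousOn.zpow₀ ?_ _ ?_
      · exact (continuous_apply k).continuousOn
      · exact fun μ hμ => Or.inl (hμ k)
    · exact fun μ hμ => Or.inl (chi_ne N l μ hμ)
  · intro μ hμ
    rw [mem_GSet_iff]
    refine ⟨fun k => mul_ne_zero (hμ k) (Finset.prod_ne_zero_iff.2 fun l _ =>
      zpow_ne_zero _ (chi_ne N l μ hμ)), fun l' => ?_⟩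
    rw [chi_mul]
    have : chi N l' (fun k => ∏ l, chi N l μ ^ (- S l k)) = (chi N l' μ)⁻¹ := by
      have h1 : ∀ k, (∏ l, chi N l μ ^ (- S l k)) ^ N k l' = ∏ l, chi N l μ ^ (-(S l k * N k l')) := by
        intro k
        rw [← Finset.prod_zpow]
        refine Finset.prod_congr rfl fun l _ => ?_
        rw [← zpow_mul, neg_mul]
      rw [chi]
      simp_rw [h1]
      rw [Finset.prod_comm]
      have h3 : ∀ l, ∏ k, chi N l μ ^ (-(S l k * N k l')) = if l = l' then (chi N l' μ)⁻¹ else 1 := by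
        intro l
        rw [prod_zpow_sum _ _ (chi_ne N l μ hμ), Finset.sum_neg_distrib]
        have := congrFun (hS l) l'
        simp only [Finset.sum_apply, Pi.smul_apply, smul_eq_mul] at this
        rw [this]
        by_cases hl : l = l'
        · subst hl; simp
        · simp [hl, Pi.single_apply, Ne.symm hl]
      simp_rw [h3]
      simp
    rw [this, mul_inv_cancel₀ (chi_ne N l' μ hμ)]
  · intro μ hμ ν hν
    rw [mem_GSet_iff] at hμ
    funext k
    simp only [chi_mul, hμ.2, one_mul]
    ring

/-- the chart -/
def US {r : ℕ} (σ : Finset (Fin r)) : Set (Fin r → ℂ) := {x | ∀ k ∉ σ, x k ≠ 0}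

lemma isOpen_US {r : ℕ} (σ : Finset (Fin r)) : IsOpen (US σ) := by
  have : US σ = ⋂ k ∈ (Finset.univ.filter fun k => k ∉ σ), {x : Fin r → ℂ | x k ≠ 0} := by
    ext x; simp [US]
  rw [this]
  exact isOpen_biInter_finset fun k _ => isOpen_ne.preimage (continuous_apply k)

lemma exists_US {r : ℕ} {K : Set (Finset (Fin r))} {x : Fin r → ℂ} (hx : x ∈ UK K) :
    ∃ σ ∈ K, x ∈ US σ := by
  refine ⟨Finset.univ.filter fun k => x k = 0, ?_, ?_⟩
  · by_contra h
    obtain ⟨i, hi, hne⟩ := mem_UK.1 hx _ h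
    exact hne (by simpa using hi)
  · intro k hk
    simpa using hk

lemma US_mul {r : ℕ} {σ : Finset (Fin r)} {x μ : Fin r → ℂ} (hx : x ∈ US σ) (hμ : ∀ k, μ k ≠ 0) :
    (fun k => μ k * x k) ∈ US σ := fun k hk => mul_ne_zero (hμ k) (hx k hk)

theorem exists_equivar {n r : ℕ} (N : Fin r → Fin n → ℤ) (h2 : Cond2 N)
    {K : Set (Finset (Fin r))} (hK : DualProp N K) {σ : Finset (Fin r)} (hσ : σ ∈ K) :
    ∃ ρ : (Fin r → ℂ) → (Fin r → ℂ), ContinuousOn ρ (US σ) ∧ (∀ x ∈ US σ, ρ x ∈ GSet N) ∧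
      ∀ μ ∈ GSet N, ∀ x ∈ US σ, ρ (fun k => μ k * x k) = fun k => μ k * ρ x k := by
  obtain ⟨R, hRc, hRG, hRe⟩ := exists_retr N h2
  obtain ⟨m, hm⟩ := hK σ hσ
  let ρ : (Fin r → ℂ) → Fin r → ℂ := fun x k =>
    if k ∈ σ then ∏ l ∈ σᶜ, x l ^ (-∑ i, N l i * m k i) else x k
  have hne : ∀ x ∈ US σ, ∀ k, ρ x k ≠ 0 := by
    intro x hx k
    by_cases hk : k ∈ σ
    · simp only [ρ, hk, if_true]
      exact Finset.prod_ne_zero_iff.2 fun l hl => zpow_ne_zero _ (hx l (by simpa using hl))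
    · simp only [ρ, hk, if_false]
      exact hx k hk
  have hρc : ContinuousOn ρ (US σ) := by
    refine continuousOn_pi.2 fun k => ?_
    by_cases hk : k ∈ σ
    · simp only [ρ, hk, if_true]
      refine continuousOn_finset_prod _ fun l hl => ContinuousOn.zpow₀ ?_ _ ?_
      · exact (continuous_apply l).continuousOn
      · exact fun x hx => Or.inl (hx l (by simpa using hl))
    · simp only [ρ, hk, if_false]
      exact (continuous_apply k).continuousOn
  have hρe : ∀ μ ∈ GSet N, ∀ x, ρ (fun k => μ k * x k) = fun k => μ k * ρ x k := by
    intro μ hμ x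
    funext k
    by_cases hk : k ∈ σ
    · simp only [ρ, hk, if_true, mul_zpow, Finset.prod_mul_distrib]
      congr 1
      have h1 := hμ.2 (m k)
      rw [← Finset.prod_mul_prod_compl σ] at h1
      have h3 : ∏ i ∈ σ, μ i ^ (∑ j, N i j * m k j) = μ k := by
        rw [Finset.prod_congr rfl fun i hi => by rw [hm k hk i hi]]
        rw [Finset.prod_eq_single k]
        · simp
        · intro b _ hb; simp [Ne.symm hb]
        · intro h; exact absurd hk h
      rw [h3] at h1
      simp_rw [zpow_neg, Finset.prod_inv_distrib]
      exact (eq_inv_of_mul_eq_one_left h1).symm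
    · simp only [ρ, hk, if_false]
  refine ⟨fun x => R (ρ x), hRc.comp hρc (fun x hx => hne x hx), fun x hx => hRG _ (hne x hx), ?_⟩
  intro μ hμ x hx
  simp only [hρe μ hμ x]
  exact hRe μ hμ _ (hne x hx)

/-- orbit relation description of fibres -/
lemma qmap_eq_iff {n r : ℕ} {N : Fin r → Fin n → ℤ} {K : Set (Finset (Fin r))} (x y : ↥(UK K)) :
    qmap N K x = qmap N K y ↔ toricRel N K x y := by
  have heq : Equivalence (toricRel N K) := by
    refine ⟨fun x => ⟨_, GSet_one N, by simp⟩, ?_, ?_⟩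
    · rintro x y ⟨μ, hμ, h⟩
      refine ⟨_, GSet_inv hμ, ?_⟩
      rw [← h]
      funext k
      simp [inv_mul_cancel_left₀ (hμ.1 k)]
    · rintro x y z ⟨μ, hμ, h⟩ ⟨ν, hν, h'⟩
      refine ⟨_, GSet_mul hν hμ, ?_⟩
      rw [← h', ← h]
      funext k
      simp [mul_assoc]
  exact Quot.eq.trans (by rw [heq.eqvGen_iff])

end PartF1

section PartF2
open Polynomial Topology

/-- Cayley transform, embedding the circle `ℝ ∪ {∞}` in `ℂ`. -/
def cay : C(OnePoint ℝ, ℂ) := 1 + (-2 * Complex.I) • vv (-Complex.I) im_negI_ne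

lemma cay_coe (t : ℝ) : cay (t : OnePoint ℝ) = 1 - 2 * Complex.I * ((t : ℂ) - -Complex.I)⁻¹ := by
  simp only [cay, ContinuousMap.add_apply, ContinuousMap.one_apply, ContinuousMap.smul_apply,
    vv_coe, smul_eq_mul]; ring

lemma cay_infty : cay OnePoint.infty = 1 := by
  simp only [cay, ContinuousMap.add_apply, ContinuousMap.one_apply, ContinuousMap.smul_apply,
    vv_infty, smul_eq_mul]; ring

lemma cay_injective : Function.Injective cay := by
  have h0 : ∀ t : ℝ, cay (t : OnePoint ℝ) ≠ 1 := by
    intro t h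
    rw [cay_coe] at h
    have := inv_ne_zero (ofReal_sub_ne (t := t) im_negI_ne)
    have h2 : 2 * Complex.I * ((t : ℂ) - -Complex.I)⁻¹ = 0 := by linear_combination -h
    simp [Complex.I_ne_zero] at h2
    exact this (by simpa using h2)
  intro x y h
  induction x using OnePoint.rec with
  | infty =>
    induction y using OnePoint.rec with
    | infty => rfl
    | coe t => rw [cay_infty] at h; exact absurd h.symm (h0 t)
  | coe t =>
    induction y using OnePoint.rec with
    | infty => rw [cay_infty] at h; exact absurd h (h0 t)
    | coe t' =>
      rw [cay_coe, cay_coe] at h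
      have h1 : ((t : ℂ) - -Complex.I)⁻¹ = ((t' : ℂ) - -Complex.I)⁻¹ := by
        have h3 : (2 * Complex.I) ≠ 0 := by simp [Complex.I_ne_zero]
        exact mul_left_cancel₀ h3 (by linear_combination -h)
      have h2 := inv_injective h1
      have h3 : (t : ℂ) = t' := by linear_combination h2
      rw [Complex.ofReal_injective h3]

/-- The wrapping map. -/
def wfun (s : unitInterval) : OnePoint ℝ :=
  if 0 < (s : ℝ) ∧ (s : ℝ) < 1 then ((Real.tan (Real.pi * (s - 1 / 2)) : ℝ) : OnePoint ℝ)
  else OnePoint.infty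

lemma wfun_ang {s : ℝ} (h : 0 < s ∧ s < 1) :
    Real.pi * (s - 1 / 2) ∈ Set.Ioo (-(Real.pi / 2)) (Real.pi / 2) := by
  have := Real.pi_pos
  constructor <;> nlinarith [h.1, h.2]

lemma cay_alg {c s : ℂ} (hc : c ≠ 0) (h : s ^ 2 + c ^ 2 = 1) :
    1 - 2 * Complex.I * (s / c - -Complex.I)⁻¹ = -(c + s * Complex.I) ^ 2 := by
  have h1 : (s / c - -Complex.I)⁻¹ = c * (s - Complex.I * c) := by
    refine inv_eq_of_mul_eq_one_right ?_
    field_simp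
    linear_combination h - c ^ 2 * Complex.I_sq
  rw [h1]
  linear_combination (2 * c ^ 2 + s ^ 2) * Complex.I_sq - h

lemma cay_wfun (s : unitInterval) : cay (wfun s) = Complex.exp (2 * Real.pi * s * Complex.I) := by
  unfold wfun
  split_ifs with h
  · rw [cay_coe]
    have hθ := wfun_ang h
    set θ := Real.pi * ((s : ℝ) - 1 / 2) with hθd
    have hc : Real.cos θ ≠ 0 := (Real.cos_pos_of_mem_Ioo hθ).ne'
    have e1 : Complex.exp (2 * Real.pi * s * Complex.I) = - Complex.exp (θ * Complex.I) ^ 2 := by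
      rw [← Complex.exp_nat_mul]
      have : (2 * Real.pi * s * Complex.I : ℂ) = ((2 : ℕ) : ℂ) * (θ * Complex.I) + Real.pi * Complex.I := by
        rw [hθd]; push_cast; ring
      rw [this, Complex.exp_add, Complex.exp_pi_mul_I]; ring
    rw [e1, Complex.exp_mul_I, Real.tan_eq_sin_div_cos, ← Complex.ofReal_cos, ← Complex.ofReal_sin]
    have hc' : (Real.cos θ : ℂ) ≠ 0 := by exact_mod_cast hc
    have hsc : (Real.sin θ : ℂ) ^ 2 + (Real.cos θ : ℂ) ^ 2 = 1 := by
      exact_mod_cast Real.sin_sq_add_cos_sq θ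
    rw [Complex.ofReal_div]
    exact cay_alg hc' hsc
  · rw [cay_infty, eq_comm]
    have hs := s.2
    have : (s : ℝ) = 0 ∨ (s : ℝ) = 1 := by
      rcases eq_or_lt_of_le hs.1 with h1 | h1
      · exact Or.inl h1.symm
      · right
        by_contra h2
        exact h ⟨h1, lt_of_le_of_ne hs.2 h2⟩
    rcases this with h1 | h1 <;> rw [h1]
    · simp
    · simpa using Complex.exp_two_pi_mul_I

lemma continuous_wfun : Continuous wfun := by
  have h1 : IsClosedEmbedding cay := cay.continuous.isClosedEmbedding cay_injective
  rw [h1.isEmbedding.continuous_iff]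
  have : (cay ∘ wfun) = fun s : unitInterval => Complex.exp (2 * Real.pi * s * Complex.I) :=
    funext cay_wfun
  rw [this]
  fun_prop

lemma wfun_zero : wfun 0 = OnePoint.infty := by simp [wfun]
lemma wfun_one : wfun 1 = OnePoint.infty := by simp [wfun]

lemma wfun_coe_surj (t : ℝ) : ∃ s, wfun s = (t : OnePoint ℝ) := by
  have hp := Real.pi_pos
  have h1 := Real.neg_pi_div_two_lt_arctan t
  have h2 := Real.arctan_lt_pi_div_two t
  have h3 : 0 < Real.arctan t / Real.pi + 1 / 2 := by
    have : -(1/2) < Real.arctan t / Real.pi := by rw [lt_div_iff₀ hp]; linarith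
    linarith
  have h4 : Real.arctan t / Real.pi + 1 / 2 < 1 := by
    have : Real.arctan t / Real.pi < 1 / 2 := by rw [div_lt_iff₀ hp]; linarith
    linarith
  refine ⟨⟨Real.arctan t / Real.pi + 1 / 2, h3.le, h4.le⟩, ?_⟩
  unfold wfun
  rw [if_pos ⟨h3, h4⟩]
  have : Real.pi * (Real.arctan t / Real.pi + 1 / 2 - 1 / 2) = Real.arctan t := by
    field_simp; ring
  simp only [this, Real.tan_arctan]

lemma wfun_surj : Function.Surjective wfun := by
  intro x
  induction x using OnePoint.rec with
  | infty => exact ⟨0, wfun_zero⟩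
  | coe t => exact wfun_coe_surj t

lemma wfun_eq {s s' : unitInterval} (h : wfun s = wfun s') :
    s = s' ∨ ((s = 0 ∨ s = 1) ∧ (s' = 0 ∨ s' = 1)) := by
  have hend : ∀ s : unitInterval, ¬ (0 < (s : ℝ) ∧ (s : ℝ) < 1) → s = 0 ∨ s = 1 := by
    intro s h
    rcases eq_or_lt_of_le s.2.1 with h1 | h1
    · exact Or.inl (Subtype.ext h1.symm)
    · right
      by_contra h2
      exact h ⟨h1, lt_of_le_of_ne s.2.2 fun h3 => h2 (Subtype.ext h3)⟩
  unfold wfun at h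
  split_ifs at h with h1 h2 h2
  · left
    have h3 := Real.injOn_tan (wfun_ang h1) (wfun_ang h2) (OnePoint.coe_injective h)
    have h4 := mul_left_cancel₀ Real.pi_pos.ne' h3
    exact Subtype.ext (by linarith)
  · exact absurd h (OnePoint.coe_ne_infty _)
  · exact absurd h.symm (OnePoint.coe_ne_infty _)
  · exact Or.inr ⟨hend _ h1, hend _ h2⟩

lemma isQuotientMap_wfun (Y : Type*) [TopologicalSpace Y] :
    IsQuotientMap (Prod.map (id : Y → Y) wfun) := by
  have h1 : IsProperMap wfun := continuous_wfun.isProperMap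
  have h2 : IsProperMap (Prod.map (id : Y → Y) wfun) := IsProperMap.prodMap isProperMap_id h1
  exact h2.isClosedMap.isQuotientMap h2.continuous
    (Function.Surjective.prodMap Function.surjective_id wfun_surj)

lemma descend {Y Z : Type*} [TopologicalSpace Y] [TopologicalSpace Z] (G : C(Y × unitInterval, Z))
    (hG : ∀ y, G (y, 0) = G (y, 1)) :
    ∃ G' : C(Y × OnePoint ℝ, Z), ∀ y s, G' (y, wfun s) = G (y, s) := by
  have hfac : Function.FactorsThrough G
      (⟨_, (isQuotientMap_wfun Y).continuous⟩ : C(Y × unitInterval, Y × OnePoint ℝ)) := by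
    rintro ⟨y, s⟩ ⟨y', s'⟩ h
    have h1 : y = y' := congrArg Prod.fst h
    have h2 : wfun s = wfun s' := congrArg Prod.snd h
    subst h1
    rcases wfun_eq h2 with rfl | ⟨ha, hb⟩
    · rfl
    · rcases ha with rfl | rfl <;> rcases hb with rfl | rfl <;> simp [hG]
  refine ⟨IsQuotientMap.lift (f := ⟨_, (isQuotientMap_wfun Y).continuous⟩)
    (isQuotientMap_wfun Y) G hfac, fun y s => ?_⟩
  exact DFunLike.congr_fun (IsQuotientMap.lift_comp
    (f := ⟨_, (isQuotientMap_wfun Y).continuous⟩) (isQuotientMap_wfun Y) G hfac) (y, s)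

lemma const_of_int {Z : Type*} [TopologicalSpace Z] [PreconnectedSpace Z] (g : Z → ℂ)
    (hg : Continuous g) (hz : ∀ z, ∃ n : ℤ, g z = n * (2 * Real.pi * Complex.I)) (z zz : Z) :
    g z = g zz := by
  have hpi : (2 * Real.pi * Complex.I : ℂ) ≠ 0 := by
    simp [Complex.I_ne_zero, Real.pi_ne_zero]
  choose n hn using hz
  have hc : Continuous n := by
    have h1 : Continuous fun z => (n z : ℝ) := by
      have : (fun z => (n z : ℝ)) = fun z => (g z / (2 * Real.pi * Complex.I)).re := by
        funext z
        rw [hn z, mul_div_assoc, div_self hpi]; simp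
      rw [this]
      exact Complex.continuous_re.comp (hg.div_const _)
    exact (Int.isClosedEmbedding_coe_real.isEmbedding.continuous_iff).2 h1
  rw [hn, hn, PreconnectedSpace.constant inferInstance hc (x := z) (y := zz)]

/-- logarithms of families of loops -/
lemma log_family {Y : Type*} [TopologicalSpace Y] [PreconnectedSpace Y]
    (h : C(Y × OnePoint ℝ, ℂ)) (hne : ∀ z, h z ≠ 0) (hinf : ∀ y, h (y, OnePoint.infty) = 1)
    (y0 : Y) (hy0 : ∀ x, h (y0, x) = 1) :
    ∃ ψ : C(Y × OnePoint ℝ, ℂ), (∀ z, Complex.exp (ψ z) = h z) ∧ ∀ y, ψ (y, OnePoint.infty) = 0 := by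
  let cov := Complex.isCoveringMap_exp
  let H : C(unitInterval × Y, {z : ℂ // z ≠ 0}) :=
    ⟨fun z => ⟨h (z.2, wfun z.1), hne _⟩, by
      refine Continuous.subtype_mk (h.continuous.comp ?_) _
      exact continuous_snd.prodMk (continuous_wfun.comp continuous_fst)⟩
  have H0 : ∀ y, H (0, y) = ⟨Complex.exp ((ContinuousMap.const Y (0:ℂ)) y), Complex.exp_ne_zero _⟩ := by
    intro y
    refine Subtype.ext ?_
    show h (y, wfun 0) = _
    rw [wfun_zero, hinf]; simp
  let L := cov.liftHomotopy H (ContinuousMap.const Y (0:ℂ)) H0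
  have hL : ∀ s y, Complex.exp (L (s, y)) = h (y, wfun s) := fun s y =>
    congrArg Subtype.val (congrFun (cov.liftHomotopy_lifts H _ H0) (s, y))
  have hL0 : ∀ y, L (0, y) = 0 := fun y => cov.liftHomotopy_zero H _ H0 y
  -- the endpoint is locally constant
  have hintZ : ∀ y, ∃ n : ℤ, L (1, y) = n * (2 * Real.pi * Complex.I) := by
    intro y
    rw [← Complex.exp_eq_one_iff, hL, wfun_one, hinf]
  have h10 : L (1, y0) = 0 := by
    have := const_of_int (fun s => L (s, y0)) (L.continuous.comp (by fun_prop)) (fun s => by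
      rw [← Complex.exp_eq_one_iff, hL, hy0]) 1 0
    rw [this, hL0]
  have h1 : ∀ y, L (1, y) = 0 := by
    intro y
    rw [← h10]
    exact const_of_int (fun y => L (1, y)) (L.continuous.comp (by fun_prop)) hintZ y y0
  obtain ⟨ψ, hψ⟩ := descend (Y := Y) ⟨fun z => L (z.2, z.1), L.continuous.comp (by fun_prop)⟩
    (fun y => by simp [hL0, h1])
  refine ⟨ψ, ?_, ?_⟩
  · rintro ⟨y, x⟩
    obtain ⟨s, rfl⟩ := wfun_surj x
    rw [hψ]
    exact hL s y
  · intro y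
    rw [← wfun_zero, hψ]
    exact hL0 y

end PartF2

section PartF3
open Polynomial Topology

lemma slot_join {r : ℕ} {K : Set (Finset (Fin r))} (hK : ∀ σ, σ ∉ K → 2 ≤ σ.card)
    {D : Fin r → ℕ} {f : ∀ k, Fin (D k) → ℂ} (hf : f ∈ PolSp K D) (k : Fin r) (c : Fin (D k) → ℂ)
    (hc : ∀ t : ℝ, (toPoly c).eval (t : ℂ) ≠ 0) :
    JoinedIn (PolSp K D) f (Function.update f k c) := by
  let A : ℂ → ∀ k, Fin (D k) → ℂ := fun s => Function.update f k (f k + s • (c - f k))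
  have hA : Continuous A := continuous_const.update k (by fun_prop)
  have hAev : ∀ s : ℂ, ∀ z : ℂ, (toPoly (A s k)).eval z
      = (toPoly (f k)).eval z + s * ((toPoly c).eval z - (toPoly (f k)).eval z) := by
    intro s z
    simp only [A, Function.update_self, toPoly_eval, Pi.add_apply, Pi.smul_apply, Pi.sub_apply,
      smul_eq_mul, add_mul, Finset.sum_add_distrib, sub_mul, mul_assoc, ← Finset.mul_sum,
      Finset.sum_sub_distrib]
    ring
  have hAne : ∀ s j, j ≠ k → A s j = f j := fun s j hj => by simp [A, hj]
  have hA0 : A 0 = f := by simp [A]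
  have hA1 : A 1 = Function.update f k c := by simp [A]
  let T : Set ℝ := {t | ∃ j, j ≠ k ∧ (toPoly (f j)).eval (t : ℂ) = 0}
  have hT : T.Countable := by
    have : T ⊆ ⋃ j : Fin r, (fun t : ℝ => (t : ℂ)) ⁻¹' {z | (toPoly (f j)).eval z = 0} := by
      rintro t ⟨j, -, hj⟩
      exact Set.mem_iUnion.2 ⟨j, hj⟩
    refine Set.Countable.mono this (Set.countable_iUnion fun j => ?_)
    exact ((finite_roots (f j)).preimage Complex.ofReal_injective.injOn).countable
  let Z : ℝ → Set ℂ := fun t => {s | (toPoly (A s k)).eval (t : ℂ) = 0}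
  have hZ : ∀ t, (Z t).Countable := by
    intro t
    apply Set.Subsingleton.countable
    intro s hs s' hs'
    simp only [Z, Set.mem_ofPred_eq, hAev] at hs hs'
    have h1 : (s - s') * ((toPoly c).eval (t : ℂ) - (toPoly (f k)).eval (t : ℂ)) = 0 := by
      linear_combination hs - hs'
    rcases mul_eq_zero.1 h1 with h | h
    · exact sub_eq_zero.1 h
    · exfalso
      rw [h, mul_zero, add_zero] at hs
      rw [hs, sub_zero] at h
      exact hc t h
  let S : Set ℂ := {s | A s ∉ PolSp K D}
  have hSsub : S ⊆ ⋃ t ∈ T, Z t := by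
    intro s hs
    simp only [S, Set.mem_ofPred_eq, PolSp] at hs
    push Not at hs
    obtain ⟨σ, hσ, t, ht⟩ := hs
    have hk : k ∈ σ := by
      by_contra hk
      obtain ⟨j, hj, hj'⟩ := hf σ hσ t
      apply hj'
      rw [← hAne s j (fun h => hk (h ▸ hj))]
      exact ht j hj
    obtain ⟨j, hj, hjk⟩ := Finset.exists_mem_ne (s := σ) (by have := hK σ hσ; omega) k
    refine Set.mem_biUnion (x := t) ⟨j, hjk, ?_⟩ (ht k hk)
    rw [← hAne s j hjk]
    exact ht j hj
  have hS : S.Countable := (hT.biUnion fun t _ => hZ t).mono hSsub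
  have hpc : IsPathConnected Sᶜ :=
    hS.isPathConnected_compl_of_one_lt_rank (by rw [Complex.rank_real_complex]; norm_num)
  have h0 : (0 : ℂ) ∈ Sᶜ := by
    simp only [S, Set.mem_compl_iff, Set.mem_ofPred_eq, not_not, hA0]; exact hf
  have h1 : (1 : ℂ) ∈ Sᶜ := by
    intro h
    obtain ⟨t, ht, h2⟩ := Set.mem_iUnion₂.1 (hSsub h)
    simp only [Z, Set.mem_ofPred_eq, hAev] at h2
    apply hc t
    linear_combination h2
  have := (hpc.image hA).joinedIn (A 0) ⟨0, h0, rfl⟩ (A 1) ⟨1, h1, rfl⟩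
  rw [hA0, hA1] at this
  refine this.mono ?_
  rintro _ ⟨s, hs, rfl⟩
  simpa [S] using hs

lemma polSp_isPreconnected {r : ℕ} {K : Set (Finset (Fin r))} (hK : ∀ σ, σ ∉ K → 2 ≤ σ.card)
    (D : Fin r → ℕ) : IsPreconnected (PolSp K D) := by
  let g : ∀ k, Fin (D k) → ℂ := fun k i => ((X - C Complex.I) ^ D k : ℂ[X]).coeff i
  have hg : ∀ k, toPoly (g k) = (X - C Complex.I) ^ D k := fun k =>
    toPoly_of_monic ((monic_X_sub_C _).pow _) (by simp)
  have hgne : ∀ k (t : ℝ), (toPoly (g k)).eval (t : ℂ) ≠ 0 := by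
    intro k t
    rw [hg]
    simp only [eval_pow, eval_sub, eval_X, eval_C]
    exact pow_ne_zero _ (ofReal_sub_ne im_I_ne)
  have key : ∀ f ∈ PolSp K D, JoinedIn (PolSp K D) f g := by
    intro f hf
    have : ∀ S : Finset (Fin r), JoinedIn (PolSp K D) f (fun k => if k ∈ S then g k else f k) := by
      intro S
      induction S using Finset.induction_on with
      | empty => simpa using JoinedIn.refl hf
      | insert i S hi ih =>
        have h1 := slot_join hK ih.target_mem i (g i) (hgne i)
        refine ih.trans ?_
        convert h1 using 1
        funext k
        by_cases hk : k = i
        · subst hk; simp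
        · simp [hk]
    simpa using this Finset.univ
  by_cases hne : (PolSp K D).Nonempty
  · obtain ⟨f0, hf0⟩ := hne
    have h0 := (key f0 hf0).target_mem
    have : IsPathConnected (PolSp K D) := ⟨g, h0, fun {f} hf => (key f hf).symm⟩
    exact this.isConnected.isPreconnected
  · rw [Set.not_nonempty_iff_eq_empty.1 hne]
    exact isPreconnected_empty

/-- two lifts of the same map differ by a continuous function to `G`. -/
theorem exists_cocycle {n r : ℕ} {N : Fin r → Fin n → ℤ} (h2 : Cond2 N)
    {K : Set (Finset (Fin r))} (hK : DualProp N K) {Y : Type*} [TopologicalSpace Y]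
    (u v : Y → ↥(UK K)) (hu : Continuous u) (hv : Continuous v)
    (huv : ∀ y, qmap N K (u y) = qmap N K (v y)) :
    ∃ g : Y → Fin r → ℂ, Continuous g ∧ (∀ y, g y ∈ GSet N) ∧
      ∀ y k, (u y).1 k = g y k * (v y).1 k := by
  have h1 : ∀ y, ∃ μ ∈ GSet N, (fun i => μ i * (v y).1 i) = (u y).1 := fun y =>
    (qmap_eq_iff _ _).1 (huv y).symm
  choose g hg hgu using h1
  refine ⟨g, ?_, hg, fun y k => (congrFun (hgu y) k).symm⟩
  rw [continuous_iff_continuousAt]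
  intro y0
  obtain ⟨σ, hσ, hy0⟩ := exists_US (v y0).2
  obtain ⟨ρ, hρc, hρG, hρe⟩ := exists_equivar N h2 hK hσ
  have hev : ∀ᶠ y in 𝓝 y0, (v y).1 ∈ US σ :=
    (continuous_subtype_val.comp hv).continuousAt.eventually ((isOpen_US σ).mem_nhds hy0)
  have heq : ∀ᶠ y in 𝓝 y0, (fun k => ρ (u y).1 k / ρ (v y).1 k) = g y := by
    filter_upwards [hev] with y hy
    funext k
    have h3 := hρe (g y) (hg y) (v y).1 hy
    rw [hgu y] at h3
    rw [h3, mul_div_assoc, div_self ((hρG _ hy).1 k), mul_one]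
  refine ContinuousAt.congr ?_ heq
  have hu0 : (u y0).1 ∈ US σ := by
    rw [← hgu y0]; exact US_mul hy0 (hg y0).1
  have hcu : ContinuousAt (fun y => ρ (u y).1) y0 :=
    ContinuousAt.comp (f := fun y => (u y).1) (hρc.continuousAt ((isOpen_US σ).mem_nhds hu0))
      (continuous_subtype_val.comp hu).continuousAt
  have hcv : ContinuousAt (fun y => ρ (v y).1) y0 :=
    ContinuousAt.comp (f := fun y => (v y).1) (hρc.continuousAt ((isOpen_US σ).mem_nhds hy0))
      (continuous_subtype_val.comp hv).continuousAt
  rw [continuousAt_pi] at hcu hcv ⊢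
  intro k
  exact (hcu k).div (hcv k) ((hρG _ hy0).1 k)

/-- multiplication by a loop in the torus -/
def mulLoop {r : ℕ} {K : Set (Finset (Fin r))} (hE : ∅ ∈ K) (l : C(OnePoint ℝ, Fin r → ℂ))
    (hl : ∀ x k, l x k ≠ 0) (hl1 : l OnePoint.infty = onesC) :
    C(Loop ↥(UK K) (onesUK hE), Loop ↥(UK K) (onesUK hE)) :=
  mkLoopMap ⟨fun z => ⟨fun k => l z.2 k * (z.1.1 z.2).1 k, UK_mul (z.1.1 z.2).2 (hl z.2)⟩, by
    refine Continuous.subtype_mk (continuous_pi fun k => ?_) _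
    refine Continuous.mul ((continuous_apply k).comp (l.continuous.comp continuous_snd)) ?_
    exact (continuous_apply k).comp (continuous_subtype_val.comp
      (continuous_uncurry_loop (ContinuousMap.id (Loop ↥(UK K) (onesUK hE)))))⟩ (by
    intro γ
    refine Subtype.ext (funext fun k => ?_)
    simp only [ContinuousMap.coe_mk, hl1, γ.2]
    simp [onesUK, onesC])

lemma mulLoop_apply {r : ℕ} {K : Set (Finset (Fin r))} (hE : ∅ ∈ K) (l : C(OnePoint ℝ, Fin r → ℂ))
    (hl : ∀ x k, l x k ≠ 0) (hl1 : l OnePoint.infty = onesC) (γ : Loop ↥(UK K) (onesUK hE)) (x k) :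
    ((mulLoop hE l hl hl1 γ).1 x).1 k = l x k * (γ.1 x).1 k := rfl

lemma piMap_mulLoop {r : ℕ} {K : Set (Finset (Fin r))} (hE : ∅ ∈ K) (l : C(OnePoint ℝ, Fin r → ℂ))
    (hl : ∀ x k, l x k ≠ 0) (hl1 : l OnePoint.infty = onesC) (k : ℕ) (x) :
    Function.Bijective (piMap k (mulLoop hE l hl hl1) x) := by
  let l' : C(OnePoint ℝ, Fin r → ℂ) := ⟨fun x k => (l x k)⁻¹, by
    refine continuous_pi fun k => Continuous.inv₀ ?_ fun x => hl x k
    exact (continuous_apply k).comp l.continuous⟩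
  have hl' : ∀ x k, l' x k ≠ 0 := fun x k => inv_ne_zero (hl x k)
  have hl1' : l' OnePoint.infty = onesC := by
    funext k; simp [l', hl1, onesC]
  refine piMap_bijective_of_homeo _ (mulLoop hE l' hl' hl1') ?_ ?_ x
  · intro γ
    refine Loop.ext' fun x => Subtype.ext (funext fun k => ?_)
    rw [mulLoop_apply, mulLoop_apply]
    exact inv_mul_cancel_left₀ (hl x k) _
  · intro γ
    refine Loop.ext' fun x => Subtype.ext (funext fun k => ?_)
    rw [mulLoop_apply, mulLoop_apply]
    exact mul_inv_cancel_left₀ (hl x k) _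

end PartF3

section PartF4
open Polynomial Topology

theorem jLemma {n r : ℕ} {N : Fin r → Fin n → ℤ} (h2 : Cond2 N)
    {K : Set (Finset (Fin r))} (hDP : DualProp N K) (hE : ∅ ∈ K)
    (hK : ∀ σ, σ ∉ K → 2 ≤ σ.card) (D : Fin r → ℕ)
    (j : C(↥(PolSp K D), Loop ↥(UK K) (onesUK hE))) (hj : IsLiftOfID N K hE D j)
    (f0 : ↥(PolSp K D)) :
    ∃ (l : C(OnePoint ℝ, Fin r → ℂ)) (hl : ∀ x k, l x k ≠ 0) (hl1 : l OnePoint.infty = onesC),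
      j.Homotopic ((mulLoop hE l hl hl1).comp (eMap hE D (fun _ => 0))) := by
  have hju := continuous_uncurry_loop j
  have heu := continuous_uncurry_loop (eMap hE D (fun _ => 0))
  obtain ⟨g, hg, hgG, hgu⟩ := exists_cocycle h2 hDP (Y := ↥(PolSp K D) × ℝ)
    (fun z => (j z.1).1 (z.2 : OnePoint ℝ))
    (fun z => ⟨fun k => (toPoly (z.1.1 k)).eval (z.2 : ℂ), polEval_mem_UK z.1 z.2⟩)
    (hju.comp (continuous_fst.prodMk (OnePoint.continuous_coe.comp continuous_snd)))
    (by
      refine Continuous.subtype_mk (continuous_pi fun k => ?_) _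
      exact continuous_toPoly_eval ((continuous_apply k).comp
        (continuous_subtype_val.comp continuous_fst))
        (Complex.continuous_ofReal.comp continuous_snd))
    (fun z => hj z.1 z.2)
  let h : ↥(PolSp K D) × OnePoint ℝ → Fin r → ℂ := fun z =>
    OnePoint.elim z.2 (onesC : Fin r → ℂ) (fun (t : ℝ) k => den (D k) 0 t * g (z.1, t) k)
  have hcoe : ∀ f (t : ℝ), h (f, (t : OnePoint ℝ)) = fun k => den (D k) 0 t * g (f, t) k :=
    fun f t => rfl
  have hinf : ∀ f, h (f, OnePoint.infty) = onesC := fun f => rfl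
  have hne : ∀ z k, h z k ≠ 0 := by
    rintro ⟨f, x⟩ k
    induction x using OnePoint.rec with
    | infty => rw [hinf]; exact one_ne_zero
    | coe t => rw [hcoe]; exact mul_ne_zero (den_ne _ _ _) ((hgG _).1 k)
  have hmul : ∀ f x k, ((j f).1 x).1 k = h (f, x) k * ((eMap hE D (fun _ => 0) f).1 x).1 k := by
    intro f x k
    induction x using OnePoint.rec with
    | infty =>
      rw [hinf, (j f).2, (eMap hE D (fun _ => 0) f).2]; simp [onesUK, onesC]
    | coe t =>
      rw [hcoe, eMap_apply, rat_coe]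
      have h1 := hgu (f, t) k
      have h3 := den_ne (D k) 0 t
      simp only at h1
      rw [h1]
      field_simp
  have hc : Continuous h := by
    rw [continuous_iff_continuousAt]
    rintro ⟨f, x⟩
    induction x using OnePoint.rec with
    | infty =>
      rw [continuousAt_pi]
      intro k
      have e1 : Continuous fun z : ↥(PolSp K D) × OnePoint ℝ =>
          ((eMap hE D (fun _ => 0) z.1).1 z.2).1 k :=
        (continuous_apply k).comp (continuous_subtype_val.comp heu)
      have e2 : Continuous fun z : ↥(PolSp K D) × OnePoint ℝ => ((j z.1).1 z.2).1 k :=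
        (continuous_apply k).comp (continuous_subtype_val.comp hju)
      have e3 : ((eMap hE D (fun _ => 0) f).1 OnePoint.infty).1 k ≠ 0 := by
        rw [(eMap hE D (fun _ => 0) f).2]; simp [onesUK, onesC]
      refine ContinuousAt.congr (e2.continuousAt.div e1.continuousAt e3) ?_
      filter_upwards [e1.continuousAt.eventually_ne e3] with z hz
      rw [Pi.div_apply, hmul z.1 z.2 k, mul_div_assoc, div_self hz, mul_one]
    | coe t =>
      have hoe : IsOpenEmbedding (Prod.map (id : ↥(PolSp K D) → ↥(PolSp K D))
          ((↑) : ℝ → OnePoint ℝ)) := IsOpenEmbedding.id.prodMap OnePoint.isOpenEmbedding_coe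
      have := hoe.continuousAt_iff (g := h) (x := (f, t))
      refine this.1 (Continuous.continuousAt ?_)
      show Continuous fun z : ↥(PolSp K D) × ℝ => h (z.1, (z.2 : OnePoint ℝ))
      simp only [hcoe]
      refine continuous_pi fun k => ?_
      unfold den
      have : Continuous fun z => g z k := (continuous_apply k).comp hg
      fun_prop
  let l : C(OnePoint ℝ, Fin r → ℂ) := ⟨fun x => h (f0, x), by fun_prop⟩
  have hl : ∀ x k, l x k ≠ 0 := fun x k => hne _ k
  have hl1 : l OnePoint.infty = onesC := rfl
  refine ⟨l, hl, hl1, ?_⟩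
  haveI : PreconnectedSpace ↥(PolSp K D) :=
    isPreconnected_iff_preconnectedSpace.1 (polSp_isPreconnected hK D)
  have hlog : ∀ k, ∃ ψ : C(↥(PolSp K D) × OnePoint ℝ, ℂ),
      (∀ z, Complex.exp (ψ z) = h z k / l z.2 k) ∧ ∀ y, ψ (y, OnePoint.infty) = 0 := by
    intro k
    refine log_family ⟨fun z => h z k / l z.2 k, ?_⟩ (fun z => div_ne_zero (hne z k) (hl _ k))
      (fun y => ?_) f0 (fun x => div_self (hl x k))
    · refine Continuous.div ((continuous_apply k).comp hc)
        ((continuous_apply k).comp (l.continuous.comp continuous_snd)) fun z => hl _ k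
    · simp [hinf, hl1, onesC]
  choose ψ hψ hψ1 using hlog
  have main : j.HomotopicRel ((mulLoop hE l hl hl1).comp (eMap hE D (fun _ => 0))) ∅ := by
    refine loop_homotopicRel_mk _ _ (fun s f x k => Complex.exp (((1 - s : ℝ) : ℂ) * ψ k (f, x)) *
      (l x k * ((eMap hE D (fun _ => 0) f).1 x).1 k)) ?_ ?_ ?_ ?_ ?_ ?_
    · refine continuous_pi fun k => ?_
      refine Continuous.mul ?_ (Continuous.mul ?_ ?_)
      · refine Complex.continuous_exp.comp (Continuous.mul (by fun_prop) ?_)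
        exact (ψ k).continuous.comp (by fun_prop)
      · exact (continuous_apply k).comp (l.continuous.comp continuous_snd)
      · exact (continuous_apply k).comp (continuous_subtype_val.comp (heu.comp
          (by fun_prop : Continuous fun z : (ℝ × ↥(PolSp K D)) × OnePoint ℝ => (z.1.2, z.2))))
    · intro s _ _ f x
      exact UK_mul (UK_mul ((eMap hE D (fun _ => 0) f).1 x).2 (hl x)) fun k => Complex.exp_ne_zero _
    · intro f x
      funext k
      have := hl x k
      rw [hmul f x k]
      simp only [sub_zero, Complex.ofReal_one, one_mul, hψ]
      field_simp
    · intro f x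
      funext k
      simp only [sub_self, Complex.ofReal_zero, zero_mul, Complex.exp_zero, one_mul]
      exact (mulLoop_apply hE l hl hl1 _ _ _).symm
    · intro s f
      funext k
      rw [(eMap hE D (fun _ => 0) f).2]
      simp [hψ1, hl1, onesC, onesUK]
    · intro s f hf
      exact hf.elim
  obtain ⟨H⟩ := main
  exact ⟨H.toHomotopy⟩

end PartF4

section PartG
open Polynomial Topology

theorem piMap_lift {n r : ℕ} {N : Fin r → Fin n → ℤ} (h2 : Cond2 N)
    {K : Set (Finset (Fin r))} (hDP : DualProp N K) (hE : ∅ ∈ K) {p : ℕ} (hp : 1 ≤ p)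
    (hK : ∀ σ, σ ∉ K → p + 1 ≤ σ.card) (D : Fin r → ℕ) (k : ℕ) (hk : ∀ l, k + 1 < 2 * p * D l)
    (j : C(↥(PolSp K D), Loop ↥(UK K) (onesUK hE))) (hj : IsLiftOfID N K hE D j)
    (x : ↥(PolSp K D)) : Function.Bijective (piMap k j x) := by
  obtain ⟨l, hl, hl1, hh⟩ := jLemma h2 hDP hE (fun σ hσ => by have := hK σ hσ; omega) D j hj x
  refine piMap_bijective_of_homotopic hh x ?_
  refine piMap_bijective_comp (piMap_mulLoop _ _ _ _ _ _) ?_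
  exact piMap_eMap hE hp hK D (fun _ => 0) k (fun l => by simpa using hk l) x

/-- slotwise root moving preserves `PolSp` -/
lemma move_mem {r : ℕ} {K : Set (Finset (Fin r))} (hE : ∅ ∈ K) {D : Fin r → ℕ} {φ : ℂ → ℂ}
    (hφ : ∀ z z', (φ z).im = 0 → φ z' = φ z → z' = z ∧ z.im = 0)
    {f : ∀ k, Fin (D k) → ℂ} (hf : f ∈ PolSp K D) : (fun k => moveP φ (f k)) ∈ PolSp K D := by
  intro σ hσ t
  by_contra hc
  push Not at hc
  have hc' : ∀ k ∈ σ, ∃ α, (toPoly (f k)).eval α = 0 ∧ φ α = t := fun k hk =>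
    (moveP_root _ _ _).1 (hc k hk)
  obtain ⟨k0, hk0⟩ : σ.Nonempty := by
    rw [Finset.nonempty_iff_ne_empty]
    rintro rfl
    exact hσ hE
  obtain ⟨α, -, hα⟩ := hc' k0 hk0
  have hα0 := (hφ α α (by rw [hα]; simp) rfl).2
  obtain ⟨k, hk, hk'⟩ := hf σ hσ α.re
  obtain ⟨β, hβ, hβ'⟩ := hc' k hk
  have := (hφ α β (by rw [hα]; simp) (by rw [hα, hβ'])).1
  apply hk'
  rw [this] at hβ
  convert hβ
  apply Complex.ext <;> simp [hα0]

def moveSp {r : ℕ} {K : Set (Finset (Fin r))} (hE : ∅ ∈ K) (D : Fin r → ℕ) (φ : ℂ → ℂ)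
    (hφc : Continuous φ) (hφ : ∀ z z', (φ z).im = 0 → φ z' = φ z → z' = z ∧ z.im = 0) :
    C(↥(PolSp K D), ↥(PolSp K D)) :=
  ⟨fun f => ⟨fun k => moveP φ (f.1 k), move_mem hE hφ f.2⟩, by
    refine Continuous.subtype_mk (continuous_pi fun k => ?_) _
    exact continuous_moveP (Φ := fun (_ : ↥(PolSp K D)) z => φ z) (hφc.comp continuous_snd)
      ((continuous_apply k).comp continuous_subtype_val)⟩

lemma piMap_moveSp {r : ℕ} {K : Set (Finset (Fin r))} (hE : ∅ ∈ K) (D : Fin r → ℕ) {b : ℝ}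
    {φ : ℂ → ℂ} (hadm : AdmissiblePhi b φ) (hφ) (k : ℕ) (x) :
    Function.Bijective (piMap k (moveSp (K := K) hE D φ hadm.1 hφ) x) := by
  obtain ⟨hφc, hφi, hφo, hrange, hreal⟩ := hadm
  let θ : ℝ → ℂ → ℂ := fun s z =>
    (((1 - s) * z.re + s * (b - Real.exp (-z.re)) : ℝ) : ℂ) + (z.im : ℂ) * Complex.I
  have θre : ∀ s z, (θ s z).re = (1 - s) * z.re + s * (b - Real.exp (-z.re)) := by
    intro s z; simp [θ, -Complex.ofReal_add, -Complex.ofReal_mul, -Complex.ofReal_sub]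
  have θim : ∀ s z, (θ s z).im = z.im := by
    intro s z; simp [θ, -Complex.ofReal_add, -Complex.ofReal_mul, -Complex.ofReal_sub]
  have hθc : Continuous fun z : ℝ × ℂ => θ z.1 z.2 := by
    simp only [θ]
    refine Continuous.add (Complex.continuous_ofReal.comp ?_) ?_ <;> fun_prop
  have θinj : ∀ s, 0 ≤ s → s ≤ 1 → Function.Injective (θ s) := by
    intro s h0 h1 z z' h
    have him : z.im = z'.im := by rw [← θim s z, h, θim]
    have hre : (1 - s) * z.re + s * (b - Real.exp (-z.re))
      = (1 - s) * z'.re + s * (b - Real.exp (-z'.re)) := by rw [← θre, h, θre]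
    have hm : StrictMono fun a : ℝ => (1 - s) * a + s * (b - Real.exp (-a)) := by
      intro a a' ha
      have h3 : Real.exp (-a') < Real.exp (-a) := Real.exp_lt_exp.2 (by linarith)
      simp only
      rcases h0.eq_or_lt with h | h
      · subst h; simpa using ha
      · nlinarith
    exact Complex.ext (hm.injective hre) him
  have hlt : ∀ z, (φ z).re < b := fun z => by
    have : φ z ∈ Set.range φ := ⟨z, rfl⟩
    rw [hrange] at this; exact this
  let η : ℂ → ℂ := fun z => ((-Real.log (b - (φ z).re) : ℝ) : ℂ) + ((φ z).im : ℂ) * Complex.I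
  have ηre : ∀ z, (η z).re = -Real.log (b - (φ z).re) := by intro z; simp [η]
  have ηim : ∀ z, (η z).im = (φ z).im := by intro z; simp [η]
  have hηc : Continuous η := by
    have h1 : Continuous fun z => Real.log (b - (φ z).re) :=
      Continuous.log (by fun_prop) fun z => by have := hlt z; linarith
    simp only [η]
    fun_prop
  have hθη : ∀ z, θ 1 (η z) = φ z := by
    intro z
    have := hlt z
    apply Complex.ext
    · rw [θre, ηre, neg_neg, Real.exp_log (by linarith)]; ring
    · rw [θim, ηim]
  have hθlt : ∀ w, θ 1 w ∈ Set.range φ := by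
    intro w
    rw [hrange]
    show (θ 1 w).re < b
    rw [θre]
    have := Real.exp_pos (-w.re)
    linarith
  choose ψ hψ using hθlt
  have hψc : Continuous ψ := by
    have hind : IsInducing φ := (IsOpenEmbedding.of_continuous_injective_isOpenMap hφc hφi hφo).isInducing
    rw [hind.continuous_iff]
    have : φ ∘ ψ = fun w => θ 1 w := funext hψ
    rw [this]
    exact hθc.comp (continuous_const.prodMk continuous_id)
  have hψη : ∀ z, ψ (η z) = z := fun z => hφi (by rw [hψ, hθη])
  have hηψ : ∀ w, η (ψ w) = w := fun w => θinj 1 zero_le_one le_rfl (by rw [hθη, hψ])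
  have hreal1 : ∀ z, (φ z).im = 0 ↔ z.im = 0 := by
    intro z
    constructor
    · intro h
      have : φ z ∈ φ '' {z : ℂ | z.im = 0} := by rw [hreal]; exact ⟨h, hlt z⟩
      obtain ⟨w, hw, hw'⟩ := this
      rw [← hφi hw']; exact hw
    · intro h
      have : φ z ∈ φ '' {z : ℂ | z.im = 0} := ⟨z, h, rfl⟩
      rw [hreal] at this
      exact this.1
  have hcomp : ∀ s, 0 ≤ s → s ≤ 1 → ∀ z z', (θ s (η z)).im = 0 → θ s (η z') = θ s (η z) →
      z' = z ∧ z.im = 0 := by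
    intro s h0 h1 z z' h h'
    rw [θim, ηim, hreal1] at h
    refine ⟨?_, h⟩
    rw [← hψη z', θinj s h0 h1 h', hψη]
  have hηp : ∀ z z', (η z).im = 0 → η z' = η z → z' = z ∧ z.im = 0 := by
    intro z z' h h'
    rw [ηim, hreal1] at h
    exact ⟨by rw [← hψη z', h', hψη], h⟩
  have hψp : ∀ z z', (ψ z).im = 0 → ψ z' = ψ z → z' = z ∧ z.im = 0 := by
    intro z z' h h'
    rw [← hreal1, hψ, θim] at h
    exact ⟨by rw [← hηψ z', h', hηψ], h⟩
  have hom : (moveSp (K := K) hE D φ hφc hφ).HomotopicRel (moveSp hE D η hηc hηp) ∅ := by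
    refine homotopicRel_mk _ _ (fun s f k => moveP (fun z => θ (1 - s) (η z)) (f.1 k)) ?_ ?_ ?_ ?_ ?_
    · refine continuous_pi fun k => ?_
      refine continuous_moveP (Φ := fun (y : ℝ × ↥(PolSp K D)) z => θ (1 - y.1) (η z)) ?_ ?_
      · exact hθc.comp (by fun_prop : Continuous fun z : (ℝ × ↥(PolSp K D)) × ℂ =>
          (1 - z.1.1, η z.2))
      · exact (continuous_apply k).comp (continuous_subtype_val.comp continuous_snd)
    · intro f
      simp only [sub_zero, hθη]
      rfl
    · intro f
      have : ∀ z, θ 0 z = z := fun z => Complex.ext (by rw [θre]; ring) (by rw [θim])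
      simp only [sub_self, this]
      rfl
    · intro s y hy; exact hy.elim
    · intro s h0 h1 f
      exact move_mem hE (hcomp (1 - s) (by linarith) (by linarith)) f.2
  obtain ⟨H⟩ := hom
  refine piMap_bijective_of_homotopic ⟨H.toHomotopy⟩ x ?_
  refine piMap_bijective_of_homeo _ (moveSp hE D ψ hψc hψp) ?_ ?_ x
  · intro f
    refine Subtype.ext (funext fun k => ?_)
    show moveP ψ (moveP η (f.1 k)) = f.1 k
    rw [moveP_comp]
    exact moveP_id _ _ fun α _ => hψη α
  · intro f
    refine Subtype.ext (funext fun k => ?_)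
    show moveP η (moveP ψ (f.1 k)) = f.1 k
    rw [moveP_comp]
    exact moveP_id _ _ fun α _ => hηψ α

set_option maxHeartbeats 1000000 in
theorem piMap_stab {n r : ℕ} {N : Fin r → Fin n → ℤ} (h2 : Cond2 N)
    {K : Set (Finset (Fin r))} (hDP : DualProp N K) (hE : ∅ ∈ K) {p : ℕ} (hp : 1 ≤ p)
    (hK : ∀ σ, σ ∉ K → p + 1 ≤ σ.card) (D D0 : Fin r → ℕ) (hDD : ∀ k, D k < D0 k)
    (k : ℕ) (hk : ∀ l, k + 1 < 2 * p * D l)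
    (j : C(↥(PolSp K D0), Loop ↥(UK K) (onesUK hE))) (hj : IsLiftOfID N K hE D0 j)
    (s : C(↥(PolSp K D), ↥(PolSp K D0))) {b : ℝ} {φ : ℂ → ℂ} {xpt : Fin r → ℂ}
    (hadm : AdmissiblePhi b φ) (hs : StabSpec K φ xpt D D0 s)
    (x : ↥(PolSp K D)) : Function.Bijective (piMap k (j.comp s) x) := by
  obtain ⟨l, hl, hl1, hh⟩ := jLemma h2 hDP hE (fun σ hσ => by have := hK σ hσ; omega) D0 j hj (s x)
  have hφ : ∀ z z', (φ z).im = 0 → φ z' = φ z → z' = z ∧ z.im = 0 := by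
    obtain ⟨hφc, hφi, hφo, hrange, hreal⟩ := hadm
    intro z z' h h'
    refine ⟨hφi h', ?_⟩
    have hlt : (φ z).re < b := by
      have : φ z ∈ Set.range φ := ⟨z, rfl⟩
      rw [hrange] at this; exact this
    have : φ z ∈ φ '' {z : ℂ | z.im = 0} := by rw [hreal]; exact ⟨h, hlt⟩
    obtain ⟨w, hw, hw'⟩ := this
    rw [← hφi hw']; exact hw
  refine piMap_bijective_of_homotopic (hh.comp (ContinuousMap.Homotopic.refl s)) x ?_
  rw [ContinuousMap.comp_assoc]
  refine piMap_bijective_comp (piMap_mulLoop _ _ _ _ _ _) ?_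
  -- moving the points off the real axis
  let xs : ℝ → Fin r → ℂ := fun τ k =>
    xpt k + (((if 0 ≤ (xpt k).im then 1 else -1 : ℝ) * τ : ℝ) : ℂ) * Complex.I
  have xsim : ∀ τ, 0 < τ → ∀ k, (xs τ k).im ≠ 0 := by
    intro τ hτ k
    simp only [xs]
    split_ifs with h
    · have : 0 < (xpt k).im + τ := by linarith
      simpa using this.ne'
    · have : (xpt k).im - τ < 0 := by push Not at h; linarith
      have h3 := this.ne
      simpa [sub_eq_add_neg] using h3
  let w : ℝ → Fin r → OnePoint ℝ → ℂ := fun τ k x => 1 + (Complex.I - xs τ k) * vv _ im_I_ne x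
  have wcoe : ∀ τ k (t : ℝ), w τ k t = ((t : ℂ) - xs τ k) / ((t : ℂ) - Complex.I) := by
    intro τ k t
    have := ofReal_sub_ne (t := t) im_I_ne
    simp only [w, vv_coe]
    field_simp
    ring
  have winf : ∀ τ k, w τ k OnePoint.infty = 1 := by intro τ k; simp [w]
  have wc : ∀ k, Continuous fun z : ℝ × OnePoint ℝ => w z.1 k z.2 := by
    intro k
    simp only [w, xs]
    have : Continuous fun z : ℝ × OnePoint ℝ => vv _ im_I_ne z.2 :=
      (vv _ im_I_ne).continuous.comp continuous_snd
    fun_prop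
  have wc1 : ∀ k, Continuous fun x : OnePoint ℝ => w 1 k x := by
    intro k
    have h3 := (wc k).comp (Continuous.prodMk_right (1 : ℝ))
    simp only [Function.comp_def] at h3
    exact h3
  clear_value w
  have wne : ∀ τ, 0 < τ → ∀ k x, w τ k x ≠ 0 := by
    intro τ hτ k x
    induction x using OnePoint.rec with
    | infty => rw [winf]; exact one_ne_zero
    | coe t =>
      rw [wcoe]
      exact div_ne_zero (ofReal_sub_ne (xsim τ hτ k)) (ofReal_sub_ne im_I_ne)
  let l' : C(OnePoint ℝ, Fin r → ℂ) := ⟨fun x k => w 1 k x ^ (D0 k - D k), by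
    refine continuous_pi fun k => Continuous.pow ?_ _
    exact wc1 k⟩
  have hl' : ∀ x k, l' x k ≠ 0 := fun x k => pow_ne_zero _ (wne 1 one_pos k x)
  have hl1' : l' OnePoint.infty = onesC := by
    funext k; simp [l', winf, onesC]
  let M := moveSp (K := K) hE D φ hadm.1 hφ
  have hzero : ∀ f x k, rat (D k) 0 ((M f).1 k) x * w 0 k x ^ (D0 k - D k)
      = rat (D0 k) 0 ((s f).1 k) x := by
    intro f x k
    induction x using OnePoint.rec with
    | infty => simp only [rat_infty, winf, one_pow, mul_one]
    | coe t =>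
      have h3 := ofReal_sub_ne (t := t) im_I_ne
      have h4 : (t : ℂ) - Complex.I ≠ 0 := h3
      have e1 : rat (D k) 0 ((M f).1 k) t = (toPoly (d := D k) (moveP φ (f.1 k))).eval (t : ℂ) /
        den (D k) 0 t := rat_coe (D k) 0 (moveP φ (f.1 k)) t
      have e2 : rat (D0 k) 0 ((s f).1 k) t = (toPoly (d := D0 k) ((s f).1 k)).eval (t : ℂ) /
        den (D0 k) 0 t := rat_coe (D0 k) 0 ((s f).1 k) t
      rw [e1, e2, wcoe, hs f k, toPoly_moveP]
      have h6 : D0 k = D k + (D0 k - D k) := by have := hDD k; omega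
      have h7 : den (D0 k) 0 t = den (D k) 0 t * ((t : ℂ) - Complex.I) ^ (D0 k - D k) := by
        unfold den
        conv_lhs => rw [h6, pow_add]
        ring
      rw [h7, eval_mul, eval_pow, eval_sub, eval_X, eval_C]
      have h8 := den_ne (D k) 0 t
      have h9 : xs 0 k = xpt k := by simp [xs]
      rw [h9, div_pow, div_mul_div_comm]
  have hom : ((eMap hE D0 (fun _ => 0)).comp s).HomotopicRel
      ((mulLoop hE l' hl' hl1').comp ((eMap hE D (fun _ => 0)).comp M)) ∅ := by
    refine loop_homotopicRel_mk _ _ (fun τ f x k => rat (D k) 0 ((M f).1 k) x *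
      w τ k x ^ (D0 k - D k)) ?_ ?_ ?_ ?_ ?_ ?_
    · refine continuous_pi fun k => Continuous.mul ?_ (Continuous.pow ?_ _)
      · have h3 := continuous_rat_uncurry (a := D k) (b := 0)
          (f := fun f : ↥(PolSp K D) => (M f).1 k)
          ((continuous_apply k).comp (continuous_subtype_val.comp M.continuous))
        have h4 := h3.comp (by fun_prop : Continuous fun z : (ℝ × ↥(PolSp K D)) × OnePoint ℝ =>
          (z.1.2, z.2))
        simp only [Function.comp_def] at h4
        exact h4
      · have h4 := (wc k).comp (by fun_prop : Continuous fun z :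
          (ℝ × ↥(PolSp K D)) × OnePoint ℝ => (z.1.1, z.2))
        simp only [Function.comp_def] at h4
        exact h4
    · intro τ h0 _ f x
      rcases h0.eq_or_lt with h | h
      · subst h
        simp only [hzero]
        exact ((eMap hE D0 (fun _ => 0) (s f)).1 x).2
      · have h3 := UK_mul ((eMap hE D (fun _ => 0) (M f)).1 x).2
          (μ := fun k => w τ k x ^ (D0 k - D k)) (fun k => pow_ne_zero _ (wne τ h k x))
        simp only [mul_comm (rat _ _ _ _)]
        exact h3
    · intro f x
      funext k
      rw [hzero]; rfl
    · intro f x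
      funext k
      exact mul_comm _ _
    · intro τ f
      funext k
      simp [rat_infty, winf, onesC]
    · intro τ f hf; exact hf.elim
  obtain ⟨H⟩ := hom
  refine piMap_bijective_of_homotopic ⟨H.toHomotopy⟩ x ?_
  refine piMap_bijective_comp (piMap_mulLoop _ _ _ _ _ _) ?_
  refine piMap_bijective_comp ?_ (piMap_moveSp hE D hadm hφ k x)
  exact piMap_eMap hE hp hK D (fun _ => 0) k (fun l => by simpa using hk l) _

end PartG

section PartH1
open Topology

/-- `L` is a continuous lift of `F` over the set `S`. -/
def Lft {n r : ℕ} (N : Fin r → Fin n → ℤ) (K : Set (Finset (Fin r))) {E : Type*}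
    [TopologicalSpace E] (F : E → XS N K) (S : Set E) (L : E → Fin r → ℂ) : Prop :=
  ContinuousOn L S ∧ ∀ x ∈ S, ∃ h : L x ∈ UK K, qmap N K ⟨L x, h⟩ = F x

variable {n r : ℕ} {N : Fin r → Fin n → ℤ} {K : Set (Finset (Fin r))} {E : Type*}
    [TopologicalSpace E]

lemma Lft.mul {F : E → XS N K} {S : Set E} {L G : E → Fin r → ℂ} (hL : Lft N K F S L)
    (hG : ContinuousOn G S) (hGG : ∀ x ∈ S, G x ∈ GSet N) :
    Lft N K F S (fun x k => G x k * L x k) := by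
  refine ⟨?_, fun x hx => ?_⟩
  · rw [continuousOn_pi]
    intro k
    exact ((continuousOn_pi.1 hG) k).mul ((continuousOn_pi.1 hL.1) k)
  · obtain ⟨h, h'⟩ := hL.2 x hx
    refine ⟨UK_mul h (hGG x hx).1, ?_⟩
    rw [← h', eq_comm, qmap_eq_iff]
    exact ⟨G x, hGG x hx, rfl⟩

lemma Lft.mono {F : E → XS N K} {S T : Set E} {L : E → Fin r → ℂ} (hL : Lft N K F S L)
    (h : T ⊆ S) : Lft N K F T L := ⟨hL.1.mono h, fun x hx => hL.2 x (h hx)⟩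

lemma Lft.congr {F : E → XS N K} {S : Set E} {L L' : E → Fin r → ℂ} (hL : Lft N K F S L)
    (h : ∀ x ∈ S, L' x = L x) : Lft N K F S L' := by
  refine ⟨hL.1.congr h, fun x hx => ?_⟩
  obtain ⟨h1, h2⟩ := hL.2 x hx
  have h3 := h x hx
  refine ⟨by rw [h3]; exact h1, ?_⟩
  rw [← h2]
  congr 1
  exact Subtype.ext h3

lemma Lft.union {F : E → XS N K} {S T : Set E} {L : E → Fin r → ℂ} (hL : Lft N K F S L)
    (hL' : Lft N K F T L) (hS : IsClosed S) (hT : IsClosed T) : Lft N K F (S ∪ T) L :=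
  ⟨hL.1.union_of_isClosed hL'.1 hS hT, fun x hx => hx.elim (hL.2 x) (hL'.2 x)⟩

lemma Lft.cocycle (h2 : Cond2 N) (hK : DualProp N K) {F : E → XS N K} {S : Set E}
    {L L' : E → Fin r → ℂ} (hL : Lft N K F S L) (hL' : Lft N K F S L') :
    ∃ g : E → Fin r → ℂ, ContinuousOn g S ∧ (∀ x ∈ S, g x ∈ GSet N) ∧
      ∀ x ∈ S, ∀ k, L x k = g x k * L' x k := by
  obtain ⟨hc, hm⟩ := hL
  obtain ⟨hc', hm'⟩ := hL'
  choose m e using hm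
  choose m' e' using hm'
  obtain ⟨g, hg, hgG, hgm⟩ := exists_cocycle h2 hK (Y := ↥S) (fun x => ⟨L x, m x x.2⟩)
    (fun x => ⟨L' x, m' x x.2⟩) (Continuous.subtype_mk hc.domRestrict _)
    (Continuous.subtype_mk hc'.domRestrict _) (fun x => (e x x.2).trans (e' x x.2).symm)
  refine ⟨fun x => if h : x ∈ S then g ⟨x, h⟩ else fun _ => 1, ?_, ?_, ?_⟩
  · rw [continuousOn_iff_continuous_domRestrict]
    convert hg using 1
    funext x
    simp
  · intro x hx
    simp only [hx, dif_pos]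
    exact hgG _
  · intro x hx k
    simp only [hx, dif_pos]
    exact hgm ⟨x, hx⟩ k

lemma Lft.glue (h2 : Cond2 N) (hK : DualProp N K) {F : E → XS N K} {S T : Set E}
    (hS : IsClosed S) (hT : IsClosed T) {L L' : E → Fin r → ℂ} (hL : Lft N K F S L)
    (hL' : Lft N K F T L') (ret : E → E) (hrc : Continuous ret) (hr : ∀ x ∈ T, ret x ∈ S ∩ T)
    (hr' : ∀ x ∈ S ∩ T, ret x = x) : ∃ L'', Lft N K F (S ∪ T) L'' := by
  obtain ⟨g, hg, hgG, hgm⟩ := Lft.cocycle h2 hK (hL.mono (Set.inter_subset_left (t := T)))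
    (hL'.mono (Set.inter_subset_right (s := S)))
  have h3 : Lft N K F T (fun x k => g (ret x) k * L' x k) :=
    hL'.mul (G := fun x => g (ret x)) (hg.comp hrc.continuousOn hr) fun x hx => hgG _ (hr x hx)
  refine ⟨fun x => if x ∈ S then L x else fun k => g (ret x) k * L' x k, ?_⟩
  refine Lft.union ?_ ?_ hS hT
  · exact hL.congr fun x hx => by simp [hx]
  · refine h3.congr fun x hx => ?_
    by_cases hxS : x ∈ S
    · simp only [hxS, if_true]
      funext k
      rw [hr' x ⟨hxS, hx⟩]
      exact hgm x ⟨hxS, hx⟩ k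
    · simp [hxS]

/-- local sections -/
lemma exists_section (h2 : Cond2 N) (hK : DualProp N K) (u : XS N K) :
    ∃ (V : Set (XS N K)) (L : XS N K → Fin r → ℂ), IsOpen V ∧ u ∈ V ∧ Lft N K id V L := by
  obtain ⟨x, rfl⟩ := Quot.exists_rep u
  obtain ⟨σ, hσ, hx⟩ := exists_US x.2
  obtain ⟨ρ, hρc, hρG, hρe⟩ := exists_equivar N h2 hK hσ
  have hiff : ∀ a b : ↥(UK K), toricRel N K a b → (a.1 ∈ US σ ↔ b.1 ∈ US σ) := by
    rintro a b ⟨μ, hμ, h⟩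
    rw [← h]
    constructor
    · intro ha; exact US_mul ha hμ.1
    · intro hb k hk h0
      exact hb k hk (by simp [h0])
  let V : Set (XS N K) := {u | Quot.lift (fun a : ↥(UK K) => a.1 ∈ US σ)
    (fun a b h => propext (hiff a b h)) u}
  let L : XS N K → Fin r → ℂ := Quot.lift (fun a : ↥(UK K) => if a.1 ∈ US σ then
    fun k => (ρ a.1 k)⁻¹ * a.1 k else fun _ => 1) (by
      intro a b h
      have h3 := hiff a b h
      obtain ⟨μ, hμ, h⟩ := h
      by_cases ha : a.1 ∈ US σ
      · have hb := h3.1 ha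
        simp only [ha, hb, if_true]
        funext k
        rw [← h, hρe μ hμ _ ha]
        have := hμ.1 k
        have := (hρG _ ha).1 k
        field_simp
      · have hb : b.1 ∉ US σ := fun hb => ha (h3.2 hb)
        simp [ha, hb])
  have hq : IsQuotientMap (qmap N K) := isQuotientMap_quot_mk
  have hpre : qmap N K ⁻¹' V = {a : ↥(UK K) | a.1 ∈ US σ} := rfl
  have hV : IsOpen V := by
    rw [← hq.isOpen_preimage, hpre]
    exact (isOpen_US σ).preimage continuous_subtype_val
  refine ⟨V, L, hV, hx, ?_, ?_⟩
  · rw [hq.continuousOn_isOpen_iff hV, hpre]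
    have : ContinuousOn (fun a : ↥(UK K) => fun k => (ρ a.1 k)⁻¹ * a.1 k)
        {a : ↥(UK K) | a.1 ∈ US σ} := by
      rw [continuousOn_pi]
      intro k
      have h3 : ContinuousOn (fun a : ↥(UK K) => ρ a.1 k) {a : ↥(UK K) | a.1 ∈ US σ} :=
        ((continuous_apply k).comp_continuousOn hρc).comp continuous_subtype_val.continuousOn
          fun a ha => ha
      exact (h3.inv₀ fun a ha => (hρG _ ha).1 k).mul
        ((continuous_apply k).comp continuous_subtype_val).continuousOn
    refine this.congr fun a ha => ?_
    have ha : a.1 ∈ US σ := ha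
    show (if a.1 ∈ US σ then _ else _) = _
    rw [if_pos ha]
  · intro u hu
    obtain ⟨a, rfl⟩ := Quot.exists_rep u
    have ha : a.1 ∈ US σ := hu
    have hLa : L (Quot.mk _ a) = fun k => (ρ a.1 k)⁻¹ * a.1 k := by
      show (if a.1 ∈ US σ then _ else _) = _
      rw [if_pos ha]
    have hm : L (Quot.mk _ a) ∈ UK K := by
      rw [hLa]; exact UK_mul a.2 fun k => inv_ne_zero ((hρG _ ha).1 k)
    refine ⟨hm, ?_⟩
    show qmap N K _ = qmap N K a
    rw [eq_comm, qmap_eq_iff]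
    refine ⟨_, GSet_inv (hρG _ ha), ?_⟩
    exact hLa.symm

lemma lft_of_section {F : E → XS N K} (hF : Continuous F) {V : Set (XS N K)}
    {L : XS N K → Fin r → ℂ} (hL : Lft N K id V L) {S : Set E} (hS : ∀ x ∈ S, F x ∈ V) :
    Lft N K F S (fun x => L (F x)) :=
  ⟨hL.1.comp hF.continuousOn hS, fun x hx => hL.2 _ (hS x hx)⟩

end PartH1

section PartH1b
open Topology
variable {n r : ℕ} {N : Fin r → Fin n → ℤ} {K : Set (Finset (Fin r))}

/-- lifts over boxes -/
theorem exists_lft_box (h2 : Cond2 N) (hK : DualProp N K) {M : ℕ} (F : (Fin M → ℝ) → XS N K)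
    (hF : Continuous F) (A B : Fin M → ℝ) : ∃ L, Lft N K F (Set.Icc A B) L := by
  choose V s hV hu hs using exists_section h2 hK
  obtain ⟨δ', hδ', hball⟩ := lebesgue_number_lemma_of_metric (s := Set.Icc A B)
    (c := fun u : XS N K => F ⁻¹' V u) isCompact_Icc (fun u => (hV u).preimage hF)
    (fun x _ => Set.mem_iUnion.2 ⟨F x, hu (F x)⟩)
  let δ := δ' / 2
  have hδ : 0 < δ := by positivity
  have key : ∀ S : Finset (Fin M), ∀ a b : Fin M → ℝ, A ≤ a → b ≤ B → a ≤ b →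
      (∀ i ∉ S, b i - a i ≤ δ) → ∃ L, Lft N K F (Set.Icc a b) L := by
    intro S
    induction S using Finset.induction_on with
    | empty =>
      intro a b ha hb hab hd
      obtain ⟨u, hu⟩ := hball a ⟨ha, hab.trans hb⟩
      refine ⟨_, lft_of_section hF (hs u) fun x hx => hu ?_⟩
      rw [Metric.mem_ball]
      refine lt_of_le_of_lt ((dist_pi_le_iff hδ.le).2 fun i => ?_) (half_lt_self hδ')
      have h1 := hd i (by simp)
      have h3 := hx.1 i
      have h4 := hx.2 i
      rw [Real.dist_eq, abs_of_nonneg (by linarith)]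
      linarith
    | insert i S hi ih =>
      have : ∀ m : ℕ, ∀ a b : Fin M → ℝ, A ≤ a → b ≤ B → a ≤ b →
          (∀ j ∉ insert i S, b j - a j ≤ δ) → b i - a i ≤ m * δ →
          ∃ L, Lft N K F (Set.Icc a b) L := by
        intro m
        induction m with
        | zero =>
          intro a b ha hb hab hd hm
          refine ih a b ha hb hab fun j hj => ?_
          by_cases hji : j = i
          · subst hji
            rw [Nat.cast_zero, zero_mul] at hm
            linarith
          · exact hd j (by simp [hji, hj])
        | succ m ihm =>
          intro a b ha hb hab hd hm
          by_cases hsm : b i - a i ≤ δ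
          · refine ih a b ha hb hab fun j hj => ?_
            by_cases hji : j = i
            · subst hji; exact hsm
            · exact hd j (by simp [hji, hj])
          push Not at hsm
          let c := b i - δ
          have hc1 : a i ≤ c := by simp only [c]; linarith
          have hc2 : c ≤ b i := by simp only [c]; linarith
          have hb' : Function.update b i c ≤ b := by
            intro j
            by_cases hji : j = i
            · subst hji; simpa using hc2
            · simp [hji]
          have ha' : a ≤ Function.update a i c := by
            intro j
            by_cases hji : j = i
            · subst hji; simpa using hc1
            · simp [hji]
          have hab1 : a ≤ Function.update b i c := by
            intro j
            by_cases hji : j = i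
            · subst hji; simpa using hc1
            · simpa [hji] using hab j
          have hab2 : Function.update a i c ≤ b := by
            intro j
            by_cases hji : j = i
            · subst hji; simpa using hc2
            · simpa [hji] using hab j
          obtain ⟨L1, hL1⟩ := ihm a (Function.update b i c) ha (hb'.trans hb) hab1
            (by
              intro j hj
              have : j ≠ i := fun h => hj (by simp [h])
              simpa [this] using hd j hj)
            (by
              push_cast at hm
              simp only [Function.update_self, c]
              linarith)
          obtain ⟨L2, hL2⟩ := ih (Function.update a i c) b (ha.trans ha') hb hab2
            (by
              intro j hj
              by_cases hji : j = i
              · subst hji; simp [c]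
              · simpa [hji] using hd j (by simp [hji, hj]))
          have hsub : Set.Icc a b ⊆ Set.Icc a (Function.update b i c) ∪
              Set.Icc (Function.update a i c) b := by
            intro x hx
            rcases le_total (x i) c with h | h
            · left
              refine ⟨hx.1, fun j => ?_⟩
              by_cases hji : j = i
              · subst hji; simpa using h
              · simpa [hji] using hx.2 j
            · right
              refine ⟨fun j => ?_, hx.2⟩
              by_cases hji : j = i
              · subst hji; simpa using h
              · simpa [hji] using hx.1 j
          obtain ⟨L, hL⟩ := Lft.glue h2 hK isClosed_Icc isClosed_Icc hL1 hL2
            (fun x => Function.update x i c) (continuous_id.update i continuous_const)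
            (by
              intro x hx
              refine ⟨⟨fun j => ?_, fun j => ?_⟩, fun j => ?_, fun j => ?_⟩ <;> by_cases hji : j = i
              · subst hji; simpa using hc1
              · simpa [hji] using hx.1 j
              · subst hji; simp
              · simpa [hji] using hx.2 j
              · subst hji; simp
              · simpa [hji] using hx.1 j
              · subst hji; simpa using hc2
              · simpa [hji] using hx.2 j)
            (by
              rintro x ⟨hx1, hx2⟩
              have e1 := hx1.2 i
              have e2 := hx2.1 i
              simp only [Function.update_self] at e1 e2
              have : x i = c := le_antisymm e1 e2
              rw [← this, Function.update_eq_self])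
          exact ⟨L, hL.mono hsub⟩
      intro a b ha hb hab hd
      obtain ⟨m, hm⟩ := exists_nat_ge ((b i - a i) / δ)
      exact this m a b ha hb hab hd (by rwa [div_le_iff₀ hδ] at hm)
  by_cases hAB : A ≤ B
  · exact key Finset.univ A B le_rfl le_rfl hAB (by simp)
  · rw [Set.Icc_eq_empty hAB]
    exact ⟨fun _ _ => 1, continuousOn_empty _, fun x hx => hx.elim⟩

end PartH1b

section PartH2
open Topology

lemma exists_log_vs {m : ℕ} (h : (Fin m → ℝ) → ℂ) (hc : Continuous h) (hne : ∀ x, h x ≠ 0) :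
    ∃ ψ : (Fin m → ℝ) → ℂ, Continuous ψ ∧ ∀ x, Complex.exp (ψ x) = h x := by
  obtain ⟨f, ⟨-, hf⟩, -⟩ := Complex.isCoveringMapOn_exp.existsUnique_continuousMap_lifts
    (⟨h, hc⟩ : C(Fin m → ℝ, ℂ)) (a₀ := 0) (Complex.exp_log (hne 0)) (fun x => hne x)
  exact ⟨f, f.continuous, fun x => congrFun hf x⟩

variable {n r : ℕ} {N : Fin r → Fin n → ℤ} {K : Set (Finset (Fin r))}

/-- the solid cylinder -/
def Cyl (m : ℕ) : Set ((Fin m → ℝ) × ℝ) := {z | ‖z.1‖ ≤ 1 ∧ 0 ≤ z.2 ∧ z.2 ≤ 1}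
/-- its boundary -/
def CylB (m : ℕ) : Set ((Fin m → ℝ) × ℝ) := {z | z ∈ Cyl m ∧ (‖z.1‖ = 1 ∨ z.2 = 0 ∨ z.2 = 1)}

/-- radial retraction of the cylinder -/
def cylRet {m : ℕ} (z : (Fin m → ℝ) × ℝ) : (Fin m → ℝ) × ℝ :=
  ((max ‖z.1‖ ((2 - z.2) / 2))⁻¹ • z.1, 2 - (2 - z.2) / max ‖z.1‖ ((2 - z.2) / 2))

lemma cylRet_cont {m : ℕ} : ContinuousOn (cylRet (m := m)) (Cyl m) := by
  have hp : ∀ z ∈ Cyl m, max ‖z.1‖ ((2 - z.2) / 2) ≠ 0 := by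
    intro z hz
    have : 0 < (2 - z.2) / 2 := by have := hz.2.2; linarith
    exact (lt_max_of_lt_right this).ne'
  have hc : Continuous fun z : (Fin m → ℝ) × ℝ => max ‖z.1‖ ((2 - z.2) / 2) := by fun_prop
  refine ContinuousOn.prodMk ?_ ?_
  · exact (hc.continuousOn.inv₀ hp).smul continuous_fst.continuousOn
  · exact continuousOn_const.sub (ContinuousOn.div (by fun_prop) hc.continuousOn hp)

lemma cylRet_mem {m : ℕ} {z : (Fin m → ℝ) × ℝ} (hz : z ∈ Cyl m) :
    cylRet z ∈ CylB m ∧ (‖(cylRet z).1‖ = 1 ∨ (cylRet z).2 = 0) := by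
  obtain ⟨h1, h2, h3⟩ := hz
  have hpos : 0 < (2 - z.2) / 2 := by linarith
  rcases le_total ‖z.1‖ ((2 - z.2) / 2) with h | h
  · have e2 : (cylRet z).2 = 0 := by
      have h4 : (2 : ℝ) - z.2 ≠ 0 := (by linarith : (0 : ℝ) < 2 - z.2).ne'
      simp only [cylRet, max_eq_right h]
      rw [div_div_eq_mul_div, mul_comm, mul_div_assoc, div_self h4]
      norm_num
    have e1 : ‖(cylRet z).1‖ ≤ 1 := by
      simp only [cylRet, max_eq_right h, norm_smul, norm_inv, Real.norm_eq_abs, abs_of_pos hpos]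
      rw [inv_mul_le_iff₀ hpos]; linarith
    exact ⟨⟨⟨e1, e2.ge, by rw [e2]; norm_num⟩, Or.inr (Or.inl e2)⟩, Or.inr e2⟩
  · have hz0 : 0 < ‖z.1‖ := hpos.trans_le h
    have e1 : ‖(cylRet z).1‖ = 1 := by
      simp only [cylRet, max_eq_left h, norm_smul, norm_inv, norm_norm]
      exact inv_mul_cancel₀ hz0.ne'
    have e2 : (cylRet z).2 = 2 - (2 - z.2) / ‖z.1‖ := by simp only [cylRet, max_eq_left h]
    refine ⟨⟨⟨e1.le, ?_, ?_⟩, Or.inl e1⟩, Or.inl e1⟩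
    · rw [e2, sub_nonneg, div_le_iff₀ hz0]; linarith
    · rw [e2]
      have : 1 ≤ (2 - z.2) / ‖z.1‖ := by rw [le_div_iff₀ hz0]; linarith
      linarith

lemma cylRet_eq {m : ℕ} {z : (Fin m → ℝ) × ℝ} (hz : z ∈ Cyl m) (h : ‖z.1‖ = 1 ∨ z.2 = 0) :
    cylRet z = z := by
  obtain ⟨h1, h2, h3⟩ := hz
  have : max ‖z.1‖ ((2 - z.2) / 2) = 1 := by
    rcases h with h | h
    · rw [h, max_eq_left]; linarith
    · rw [h, max_eq_right] <;> linarith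
  unfold cylRet
  rw [this]
  ext <;> simp

theorem exists_lft_cyl (h2 : Cond2 N) (hK : DualProp N K) {m : ℕ} (hm : 2 ≤ m)
    (F : (Fin m → ℝ) × ℝ → XS N K) (hF : Continuous F) (d : (Fin m → ℝ) × ℝ → Fin r → ℂ)
    (hd : Lft N K F (CylB m) d) : ∃ L, Lft N K F (Cyl m) L ∧ ∀ z ∈ CylB m, L z = d z := by
  -- a first lift
  obtain ⟨L0, hL0⟩ : ∃ L, Lft N K F (Cyl m) L := by
    obtain ⟨L, hL⟩ := exists_lft_box h2 hK (M := m + 1) (fun y => F (Fin.tail y, y 0))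
      (hF.comp (by unfold Fin.tail; fun_prop)) (fun _ => -1) (fun _ => 1)
    have hcc : Continuous fun z : (Fin m → ℝ) × ℝ => (Fin.cons z.2 z.1 : Fin (m + 1) → ℝ) := by
      fun_prop
    have hmm : ∀ z ∈ Cyl m, (Fin.cons z.2 z.1 : Fin (m + 1) → ℝ) ∈
        Set.Icc (fun _ => -1 : Fin (m + 1) → ℝ) (fun _ => 1) := by
      rintro z ⟨h1, h3, h4⟩
      rw [pi_norm_le_iff_of_nonneg zero_le_one] at h1
      constructor <;> intro i <;> refine Fin.cases ?_ (fun i => ?_) i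
      · simp only [Fin.cons_zero]; linarith
      · simp only [Fin.cons_succ]; exact (abs_le.1 (h1 i)).1
      · simp only [Fin.cons_zero]; linarith
      · simp only [Fin.cons_succ]; exact (abs_le.1 (h1 i)).2
    refine ⟨fun z => L (Fin.cons z.2 z.1), hL.1.comp hcc.continuousOn hmm, fun z hz => ?_⟩
    obtain ⟨h3, h4⟩ := hL.2 _ (hmm z hz)
    exact ⟨h3, by rw [h4]; simp⟩
  have hBC : CylB m ⊆ Cyl m := fun z hz => hz.1
  obtain ⟨g, hgc, hgG, hgm⟩ := Lft.cocycle h2 hK hd (hL0.mono hBC)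
  obtain ⟨R, hRc, hRG, hRe⟩ := exists_retr N h2
  -- the top face
  let rr : (Fin m → ℝ) → (Fin m → ℝ) := fun x => (max 1 ‖x‖)⁻¹ • x
  have hrr1 : ∀ x, ‖rr x‖ ≤ 1 := by
    intro x
    have h1 : 0 < max 1 ‖x‖ := lt_max_of_lt_left one_pos
    simp only [rr, norm_smul, norm_inv, Real.norm_eq_abs, abs_of_pos h1]
    rw [inv_mul_le_iff₀ h1, mul_one]
    exact le_max_right _ _
  have hrr2 : ∀ x, ‖x‖ ≤ 1 → rr x = x := by
    intro x hx
    simp [rr, max_eq_left hx]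
  have hrrc : Continuous rr := by
    have h1 : Continuous fun x : Fin m → ℝ => max 1 ‖x‖ := by fun_prop
    exact (h1.inv₀ fun x => (lt_max_of_lt_left one_pos).ne').smul continuous_id
  have htop : ∀ x : Fin m → ℝ, ‖x‖ ≤ 1 → (x, (1 : ℝ)) ∈ CylB m := fun x hx =>
    ⟨⟨hx, zero_le_one, le_rfl⟩, Or.inr (Or.inr rfl)⟩
  let q : (Fin m → ℝ) → Fin r → ℂ := fun x k =>
    g (rr x, 1) k * (g (cylRet (rr x, 1)) k)⁻¹
  have hret : ∀ z ∈ Cyl m, g (cylRet z) ∈ GSet N := fun z hz => hgG _ (cylRet_mem hz).1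
  have hretc : ContinuousOn (fun z => g (cylRet z)) (Cyl m) :=
    hgc.comp cylRet_cont fun z hz => (cylRet_mem hz).1
  have hqG : ∀ x, q x ∈ GSet N := fun x =>
    GSet_mul (hgG _ (htop _ (hrr1 x))) (GSet_inv (hret _ (htop _ (hrr1 x)).1))
  have hqc : Continuous q := by
    have h1 : Continuous fun x => g (rr x, 1) := by
      rw [← continuousOn_univ]
      exact hgc.comp (by fun_prop) fun x _ => htop _ (hrr1 x)
    have h3 : Continuous fun x => g (cylRet (rr x, 1)) := by
      rw [← continuousOn_univ]
      exact hretc.comp (f := fun x => (rr x, (1 : ℝ))) (by fun_prop) fun x _ => (htop _ (hrr1 x)).1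
    refine continuous_pi fun k => ?_
    refine ((continuous_apply k).comp h1).mul (((continuous_apply k).comp h3).inv₀ fun x => ?_)
    exact (hret _ (htop _ (hrr1 x)).1).1 k
  have hq1 : ∀ x, ‖x‖ = 1 → ∀ k, q x k = 1 := by
    intro x hx k
    have h1 : rr x = x := hrr2 x hx.le
    have h3 : cylRet (x, (1 : ℝ)) = (x, 1) := cylRet_eq (htop x hx.le).1 (Or.inl hx)
    simp only [q]
    rw [h1, h3]
    exact mul_inv_cancel₀ ((hgG _ (htop x hx.le)).1 k)
  -- logarithms
  have hlog : ∀ k, ∃ ψ : (Fin m → ℝ) → ℂ, Continuous ψ ∧ (∀ x, Complex.exp (ψ x) = q x k) ∧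
      ∀ x, ‖x‖ = 1 → ψ x = 0 := by
    intro k
    obtain ⟨ψ, hψc, hψ⟩ := exists_log_vs (fun x => q x k) ((continuous_apply k).comp hqc)
      (fun x => (hqG x).1 k)
    let x0 : Fin m → ℝ := fun _ => 1
    haveI : Nonempty (Fin m) := ⟨⟨0, by omega⟩⟩
    have hx0 : ‖x0‖ = 1 := by simp [x0]
    have hpre : IsPreconnected (Metric.sphere (0 : Fin m → ℝ) 1) := by
      refine isPreconnected_sphere ?_ _ _
      rw [rank_fin_fun]
      exact_mod_cast hm
    haveI : PreconnectedSpace ↥(Metric.sphere (0 : Fin m → ℝ) 1) :=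
      isPreconnected_iff_preconnectedSpace.1 hpre
    have hintZ : ∀ z : ↥(Metric.sphere (0 : Fin m → ℝ) 1), ∃ n : ℤ, ψ z.1 = n * (2 * Real.pi * Complex.I) := by
      intro z
      rw [← Complex.exp_eq_one_iff, hψ]
      exact hq1 _ (by simpa using z.2) k
    have hconst : ∀ x, ‖x‖ = 1 → ψ x = ψ x0 := fun x hx =>
      const_of_int (fun z : ↥(Metric.sphere (0 : Fin m → ℝ) 1) => ψ z.1)
        (hψc.comp continuous_subtype_val) hintZ ⟨x, by simpa using hx⟩ ⟨x0, by simpa using hx0⟩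
    refine ⟨fun x => ψ x - ψ x0, by fun_prop, fun x => ?_, fun x hx => by
      show ψ x - ψ x0 = 0
      rw [hconst x hx, sub_self]⟩
    rw [Complex.exp_sub, hψ, hψ, hq1 x0 hx0 k, div_one]
  choose ψ hψc hψ hψ0 using hlog
  let W : (Fin m → ℝ) × ℝ → Fin r → ℂ := fun z k => Complex.exp ((z.2 : ℂ) * ψ k z.1)
  have hWc : Continuous W := by
    refine continuous_pi fun k => ?_
    simp only [W]
    have := hψc k
    fun_prop
  have hWne : ∀ z, ∀ k, W z k ≠ 0 := fun z k => Complex.exp_ne_zero _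
  have hone : ∀ k : Fin r, (fun _ => 1 : Fin r → ℂ) k ≠ 0 := fun k => one_ne_zero
  let R1 : Fin r → ℂ := R (fun _ => 1)
  have hR1 : R1 ∈ GSet N := hRG _ hone
  have hRg : ∀ μ ∈ GSet N, ∀ k, R μ k * (R1 k)⁻¹ = μ k := by
    intro μ hμ k
    have := hRe μ hμ (fun _ => 1) hone
    simp only [mul_one] at this
    rw [this, mul_assoc, mul_inv_cancel₀ (hR1.1 k), mul_one]
  have hL1 : Lft N K F (Cyl m) (fun z k => g (cylRet z) k * L0 z k) :=
    hL0.mul (G := fun z => g (cylRet z)) hretc hret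
  have hRW : Continuous fun z => R (W z) := by
    rw [← continuousOn_univ]
    exact hRc.comp hWc.continuousOn fun z _ => hWne z
  refine ⟨_, hL1.mul (G := fun z k => R (W z) k * (R1 k)⁻¹) ?_ ?_, ?_⟩
  · refine Continuous.continuousOn (continuous_pi fun k => ?_)
    exact ((continuous_apply k).comp hRW).mul continuous_const
  · intro z _
    exact GSet_mul (hRG _ (hWne z)) (GSet_inv hR1)
  · rintro ⟨x, t⟩ hz
    funext k
    by_cases hJ : ‖x‖ = 1 ∨ t = 0
    · have hW1 : W (x, t) = fun _ => 1 := by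
        funext k
        rcases hJ with h | h
        · simp [W, hψ0 k x h]
        · simp [W, h]
      show R (W (x, t)) k * (R1 k)⁻¹ * (g (cylRet (x, t)) k * L0 (x, t) k) = d (x, t) k
      rw [hW1, hRg _ (GSet_one N), one_mul, cylRet_eq hz.1 hJ]
      exact (hgm _ hz k).symm
    · have ht : t = 1 := by
        rcases hz.2 with h | h | h
        · exact absurd (Or.inl h) hJ
        · exact absurd (Or.inr h) hJ
        · exact h
      subst ht
      have hx : ‖x‖ ≤ 1 := hz.1.1
      have hW1 : W (x, 1) = q x := by
        funext k
        simp [W, hψ]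
      show R (W (x, 1)) k * (R1 k)⁻¹ * (g (cylRet (x, 1)) k * L0 (x, 1) k) = d (x, 1) k
      rw [hW1, hRg _ (hqG x)]
      simp only [q]
      rw [hrr2 x hx, hgm _ hz k]
      have := (hret _ hz.1).1 k
      field_simp

end PartH2

section PartH3
open Topology

variable {n r : ℕ} {N : Fin r → Fin n → ℤ} {K : Set (Finset (Fin r))}

/-- clamp to the unit interval -/
def clampI (x : ℝ) : unitInterval := Set.projIcc 0 1 zero_le_one x

lemma clampI_cont : Continuous clampI :=
  continuous_projIcc (h := zero_le_one)

lemma clampI_of (t : unitInterval) : clampI (t : ℝ) = t := Set.projIcc_val _ t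

/-- the cube point of a real point -/
def cubePt {m : ℕ} (x : Fin m → ℝ) : Fin m → unitInterval := fun i => clampI ((x i + 1) / 2)

lemma cubePt_cont {m : ℕ} : Continuous (cubePt (m := m)) :=
  continuous_pi fun i => clampI_cont.comp (by fun_prop)

lemma cubePt_bd {m : ℕ} {x : Fin m → ℝ} (hx : ‖x‖ = 1) : cubePt x ∈ Cube.boundary (Fin m) := by
  have hex : ∃ i, |x i| = 1 := by
    by_contra hc
    push Not at hc
    have h1 : ‖x‖ < 1 := by
      rw [pi_norm_lt_iff one_pos]
      intro i
      have h3 := norm_le_pi_norm x i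
      rw [hx] at h3
      exact lt_of_le_of_ne h3 (hc i)
    linarith
  obtain ⟨i, hi⟩ := hex
  refine ⟨i, ?_⟩
  rcases (abs_eq zero_le_one).1 hi with h | h
  · right
    simp only [cubePt, h]
    norm_num
    exact clampI_of 1
  · left
    simp only [cubePt, h]
    norm_num
    exact clampI_of 0

/-- the real point of a cube point -/
def realPt {m : ℕ} (y : Fin m → unitInterval) : Fin m → ℝ := fun i => 2 * (y i : ℝ) - 1

lemma cubePt_realPt {m : ℕ} (y : Fin m → unitInterval) : cubePt (realPt y) = y := by
  funext i
  simp only [cubePt, realPt]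
  have : (2 * (y i : ℝ) - 1 + 1) / 2 = y i := by ring
  rw [this, clampI_of]

lemma realPt_norm {m : ℕ} (y : Fin m → unitInterval) : ‖realPt y‖ ≤ 1 := by
  rw [pi_norm_le_iff_of_nonneg zero_le_one]
  intro i
  rw [Real.norm_eq_abs, abs_le]
  simp only [realPt]
  constructor <;> linarith [(y i).2.1, (y i).2.2]

lemma realPt_bd {m : ℕ} {y : Fin m → unitInterval} (hy : y ∈ Cube.boundary (Fin m)) :
    ‖realPt y‖ = 1 := by
  refine le_antisymm (realPt_norm y) ?_
  obtain ⟨i, hi⟩ := hy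
  have h1 := norm_le_pi_norm (realPt y) i
  refine le_trans (le_of_eq ?_) h1
  rcases hi with h | h <;> simp [realPt, h] <;> norm_num

theorem lift_loops (h2 : Cond2 N) (hDP : DualProp N K) (hE : ∅ ∈ K) {m : ℕ} (hm : 2 ≤ m)
    (c : C(Fin m → unitInterval, Loop (XS N K) (qCont N K (onesUK hE))))
    (B : (Fin m → unitInterval) → Loop ↥(UK K) (onesUK hE))
    (hBc : ContinuousOn B (Cube.boundary (Fin m)))
    (hB : ∀ y ∈ Cube.boundary (Fin m), loopMap (qCont N K) rfl (B y) = c y) :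
    ∃ p : C(Fin m → unitInterval, Loop ↥(UK K) (onesUK hE)),
      (∀ y, loopMap (qCont N K) rfl (p y) = c y) ∧ ∀ y ∈ Cube.boundary (Fin m), p y = B y := by
  let F : (Fin m → ℝ) × ℝ → XS N K := fun z => (c (cubePt z.1)).1 (wfun (clampI z.2))
  have hWc : Continuous fun z : (Fin m → ℝ) × ℝ => wfun (clampI z.2) :=
    continuous_wfun.comp (clampI_cont.comp continuous_snd)
  have hYc : Continuous fun z : (Fin m → ℝ) × ℝ => cubePt z.1 := cubePt_cont.comp continuous_fst
  have hF : Continuous F := (continuous_uncurry_loop c).comp (hYc.prodMk hWc)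
  let d : (Fin m → ℝ) × ℝ → Fin r → ℂ := fun z =>
    if ‖z.1‖ = 1 then ((B (cubePt z.1)).1 (wfun (clampI z.2))).1 else onesC
  have hev : Continuous fun z : Loop ↥(UK K) (onesUK hE) × OnePoint ℝ => z.1.1 z.2 :=
    continuous_uncurry_loop (ContinuousMap.id _)
  let S : Set ((Fin m → ℝ) × ℝ) := {z | z ∈ Cyl m ∧ ‖z.1‖ = 1}
  let T : Set ((Fin m → ℝ) × ℝ) := {z | z ∈ Cyl m ∧ (z.2 = 0 ∨ z.2 = 1)}
  have hCyl : IsClosed (Cyl m) := by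
    refine IsClosed.inter (isClosed_le continuous_fst.norm continuous_const) (IsClosed.inter ?_ ?_)
    · exact isClosed_le continuous_const continuous_snd
    · exact isClosed_le continuous_snd continuous_const
  have hSc : IsClosed S := hCyl.inter (isClosed_eq continuous_fst.norm continuous_const)
  have hTc : IsClosed T := hCyl.inter
    ((isClosed_eq continuous_snd continuous_const).union (isClosed_eq continuous_snd continuous_const))
  have hend : ∀ t : ℝ, t = 0 ∨ t = 1 → wfun (clampI t) = OnePoint.infty := by
    rintro t (rfl | rfl)
    · rw [show clampI 0 = 0 from clampI_of 0, wfun_zero]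
    · rw [show clampI 1 = 1 from clampI_of 1, wfun_one]
  have hdT : ∀ z ∈ T, d z = onesC := by
    intro z hz
    simp only [d]
    split_ifs with h
    · rw [hend _ hz.2, (B (cubePt z.1)).2]; rfl
    · rfl
  have hdS : ∀ z ∈ S, d z = ((B (cubePt z.1)).1 (wfun (clampI z.2))).1 := by
    intro z hz
    simp only [d]
    rw [if_pos hz.2]
  have hST : CylB m ⊆ S ∪ T := by
    rintro z ⟨h1, h3 | h3⟩
    · exact Or.inl ⟨h1, h3⟩
    · exact Or.inr ⟨h1, h3⟩
  have hLS : Lft N K F S d := by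
    refine Lft.congr (L := fun z => ((B (cubePt z.1)).1 (wfun (clampI z.2))).1) ⟨?_, ?_⟩ hdS
    · have h1 : ContinuousOn (fun z : (Fin m → ℝ) × ℝ => B (cubePt z.1)) S :=
        hBc.comp hYc.continuousOn fun z hz => cubePt_bd hz.2
      exact continuous_subtype_val.comp_continuousOn
        (hev.comp_continuousOn (h1.prodMk hWc.continuousOn))
    · intro z hz
      refine ⟨Subtype.prop _, ?_⟩
      have h1 := hB _ (cubePt_bd hz.2)
      show qmap N K ((B (cubePt z.1)).1 (wfun (clampI z.2))) = (c (cubePt z.1)).1 (wfun (clampI z.2))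
      rw [← h1]
      rfl
  have hLT : Lft N K F T d := by
    refine Lft.congr (L := fun _ => onesC) ⟨continuousOn_const, ?_⟩ hdT
    intro z hz
    refine ⟨ones_mem_UK hE, ?_⟩
    show qmap N K (onesUK hE) = (c (cubePt z.1)).1 (wfun (clampI z.2))
    rw [hend _ hz.2, (c (cubePt z.1)).2]
    rfl
  obtain ⟨L, hL, hLd⟩ := exists_lft_cyl h2 hDP hm F hF d ((hLS.union hLT hSc hTc).mono hST)
  have hmem : ∀ z : (Fin m → unitInterval) × unitInterval, (realPt z.1, (z.2 : ℝ)) ∈ Cyl m :=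
    fun z => ⟨realPt_norm _, z.2.2.1, z.2.2.2⟩
  have hGc : Continuous fun z : (Fin m → unitInterval) × unitInterval =>
      L (realPt z.1, (z.2 : ℝ)) := by
    rw [← continuousOn_univ]
    refine hL.1.comp (f := fun z : (Fin m → unitInterval) × unitInterval =>
      (realPt z.1, (z.2 : ℝ))) ?_ fun z _ => hmem z
    refine Continuous.continuousOn (Continuous.prodMk (continuous_pi fun i => ?_) (by fun_prop))
    simp only [realPt]
    fun_prop
  let G : C((Fin m → unitInterval) × unitInterval, ↥(UK K)) :=
    ⟨fun z => ⟨L (realPt z.1, (z.2 : ℝ)), (hL.2 _ (hmem z)).choose⟩, hGc.subtype_mk _⟩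
  have hGe : ∀ y : Fin m → unitInterval, ∀ t : unitInterval, ((t : ℝ) = 0 ∨ (t : ℝ) = 1) →
      G (y, t) = onesUK hE := by
    intro y t ht
    refine Subtype.ext ?_
    have h1 : (realPt y, (t : ℝ)) ∈ CylB m := ⟨hmem (y, t), Or.inr ht⟩
    exact (hLd _ h1).trans (hdT _ ⟨h1.1, ht⟩)
  obtain ⟨G', hG'⟩ := descend G fun y => by
    rw [hGe y 0 (Or.inl rfl), hGe y 1 (Or.inr rfl)]
  refine ⟨mkLoopMap G' fun y => ?_, fun y => ?_, fun y hy => ?_⟩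
  · rw [← wfun_zero, hG', hGe y 0 (Or.inl rfl)]
  · refine Loop.ext' fun x => ?_
    obtain ⟨s, rfl⟩ := wfun_surj x
    show qmap N K (G' (y, wfun s)) = _
    rw [hG']
    have h1 := (hL.2 _ (hmem (y, s))).choose_spec
    refine Eq.trans h1 ?_
    simp only [F]
    rw [cubePt_realPt, clampI_of]
  · refine Loop.ext' fun x => ?_
    obtain ⟨s, rfl⟩ := wfun_surj x
    rw [mkLoopMap_apply, hG']
    refine Subtype.ext ?_
    have h1 : (realPt y, (s : ℝ)) ∈ S := ⟨hmem (y, s), realPt_bd hy⟩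
    have h3 : (realPt y, (s : ℝ)) ∈ CylB m := ⟨hmem (y, s), Or.inl (realPt_bd hy)⟩
    refine (hLd _ h3).trans ((hdS _ h1).trans ?_)
    simp only
    rw [cubePt_realPt, clampI_of]

lemma boundary_succ {k : ℕ} {v : Fin (k + 1) → unitInterval} :
    v ∈ Cube.boundary (Fin (k + 1)) ↔ (v 0 = 0 ∨ v 0 = 1) ∨ Fin.tail v ∈ Cube.boundary (Fin k) := by
  constructor
  · rintro ⟨i, hi⟩
    revert hi
    refine Fin.cases (fun h => Or.inl h) (fun i h => Or.inr ⟨i, h⟩) i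
  · rintro (h | ⟨i, h⟩)
    · exact ⟨0, h⟩
    · exact ⟨i.succ, h⟩

theorem piMap_loopq (h2 : Cond2 N) (hDP : DualProp N K) (hE : ∅ ∈ K) {k : ℕ} (hk : 2 ≤ k)
    (γ : Loop ↥(UK K) (onesUK hE)) :
    Function.Bijective (piMap k (loopMap (x₀ := onesUK hE) (y₀ := qCont N K (onesUK hE))
      (qCont N K) rfl) γ) := by
  constructor
  · rw [piMap_injective_iff]
    rintro p q hp hq ⟨H⟩
    have htl : Continuous fun v : Fin (k + 1) → unitInterval => (Fin.tail v : Fin k → unitInterval) := by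
      unfold Fin.tail; fun_prop
    let c : C(Fin (k + 1) → unitInterval, Loop (XS N K) (qCont N K (onesUK hE))) :=
      ⟨fun v => H (v 0, Fin.tail v), H.continuous.comp ((continuous_apply 0).prodMk htl)⟩
    let B : (Fin (k + 1) → unitInterval) → Loop ↥(UK K) (onesUK hE) := fun v =>
      if v 0 = 0 then p (Fin.tail v) else if v 0 = 1 then q (Fin.tail v) else γ
    have hB0 : ∀ v, v 0 = 0 → B v = p (Fin.tail v) := fun v h => by simp only [B, if_pos h]
    have hB1 : ∀ v, v 0 = 1 → B v = q (Fin.tail v) := fun v h => by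
      simp only [B, h, one_ne_zero, if_false, if_true]
    have hBb : ∀ v : Fin (k + 1) → unitInterval, (Fin.tail v : Fin k → unitInterval) ∈ Cube.boundary (Fin k) → B v = γ := fun v h => by
      simp only [B]
      split_ifs
      · exact hp _ h
      · exact hq _ h
      · rfl
    have hBc : ContinuousOn B (Cube.boundary (Fin (k + 1))) := by
      have e0 : ContinuousOn B {v | v 0 = 0} :=
        ((p.continuous.comp htl).continuousOn).congr fun v hv => hB0 v hv
      have e1 : ContinuousOn B {v | v 0 = 1} :=
        ((q.continuous.comp htl).continuousOn).congr fun v hv => hB1 v hv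
      have e2 : ContinuousOn B {v | Fin.tail v ∈ Cube.boundary (Fin k)} :=
        (continuousOn_const (c := γ)).congr fun v hv => hBb v hv
      have c0 : IsClosed {v : Fin (k + 1) → unitInterval | v 0 = 0} :=
        isClosed_eq (continuous_apply 0) continuous_const
      have c1 : IsClosed {v : Fin (k + 1) → unitInterval | v 0 = 1} :=
        isClosed_eq (continuous_apply 0) continuous_const
      have c2 : IsClosed {v : Fin (k + 1) → unitInterval | Fin.tail v ∈ Cube.boundary (Fin k)} :=
        (isClosed_cube_boundary k).preimage htl
      refine ((e0.union_of_isClosed e1 c0 c1).union_of_isClosed e2 (c0.union c1) c2).mono ?_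
      intro v hv
      exact boundary_succ.1 hv
    obtain ⟨P, hP, hPB⟩ := lift_loops h2 hDP hE (m := k + 1) (by omega) c B hBc (by
      intro v hv
      rcases boundary_succ.1 hv with (h | h) | h
      · rw [hB0 v h]
        show _ = H (v 0, Fin.tail v)
        rw [h, H.apply_zero]; rfl
      · rw [hB1 v h]
        show _ = H (v 0, Fin.tail v)
        rw [h, H.apply_one]; rfl
      · rw [hBb v h]
        show _ = H (v 0, Fin.tail v)
        rw [H.eq_fst _ h]
        show _ = loopMap (qCont N K) rfl (p (Fin.tail v))
        rw [hp _ h])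
    have hcc : Continuous fun z : unitInterval × (Fin k → unitInterval) =>
        (Fin.cons z.1 z.2 : Fin (k + 1) → unitInterval) := by fun_prop
    refine ⟨⟨⟨⟨fun z => P (Fin.cons z.1 z.2), P.continuous.comp hcc⟩, fun v => ?_, fun v => ?_⟩, ?_⟩⟩
    · show P (Fin.cons 0 v) = p v
      rw [hPB _ (boundary_succ.2 (Or.inl (Or.inl (by simp)))), hB0 _ (by simp)]
      simp
    · show P (Fin.cons 1 v) = q v
      rw [hPB _ (boundary_succ.2 (Or.inl (Or.inr (by simp)))), hB1 _ (by simp)]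
      simp
    · intro s v hv
      show P (Fin.cons s v) = p v
      rw [hPB _ (boundary_succ.2 (Or.inr (by simpa using hv))), hBb _ (by simpa using hv), hp v hv]
  · rw [piMap_surjective_iff]
    intro c hc
    obtain ⟨p, hp, hpB⟩ := lift_loops h2 hDP hE hk c (fun _ => γ) continuousOn_const
      fun y hy => (hc y hy).symm
    refine ⟨p, hpB, ?_⟩
    have : (loopMap (qCont N K) rfl : C(Loop ↥(UK K) (onesUK hE),
      Loop (XS N K) (qCont N K (onesUK hE)))).comp p = c := ContinuousMap.ext hp
    rw [this]
    exact ContinuousMap.HomotopicRel.refl c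

end PartH3

section PartI

lemma exists_primitive {r : ℕ} {K : Set (Finset (Fin r))} (σ : Finset (Fin r)) (h : σ ∉ K) :
    ∃ τ ⊆ σ, PrimitiveSet K τ := by
  induction σ using Finset.strongInduction with
  | H σ ih =>
    by_cases hp : ∀ t ⊂ σ, t ∈ K
    · exact ⟨σ, subset_rfl, h, hp⟩
    · push Not at hp
      obtain ⟨t, ht, htK⟩ := hp
      obtain ⟨τ, hτ, hτ'⟩ := ih t ht htK
      exact ⟨τ, hτ.trans ht.subset, hτ'⟩

lemma rmin_le_card {r : ℕ} {K : Set (Finset (Fin r))} (σ : Finset (Fin r)) (h : σ ∉ K) :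
    rmin K ≤ σ.card := by
  obtain ⟨τ, hτ, hτ'⟩ := exists_primitive σ h
  have h1 : rmin K ≤ τ.card := Nat.sInf_le ⟨τ, hτ', rfl⟩
  exact h1.trans (Finset.card_le_card hτ)

theorem part_i {n r : ℕ} {N : Fin r → Fin n → ℤ} (h2 : Cond2 N) {K : Set (Finset (Fin r))}
    (hDP : DualProp N K) (hE : ∅ ∈ K) (D : Fin r → ℕ)
    (j : C(↥(PolSp K D), Loop ↥(UK K) (onesUK hE))) (hj : IsJD N K hE D j) :
    HomotopyEquivThrough j (dBound K D) := by
  intro x k hk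
  unfold dBound at hk
  have hpos : 2 ≤ rmin K := by
    by_contra hc
    have h1 : ((rmin K : ℤ) - 1) ≤ 0 := by omega
    have h3 := mul_nonpos_of_nonpos_of_nonneg h1 (Int.natCast_nonneg (dmin D))
    have : (0 : ℤ) ≤ k := Int.natCast_nonneg k
    nlinarith
  obtain ⟨p, hp⟩ : ∃ p, rmin K = p + 1 := ⟨rmin K - 1, by omega⟩
  have hp1 : 1 ≤ p := by omega
  have hK : ∀ σ, σ ∉ K → p + 1 ≤ σ.card := fun σ hσ => hp ▸ rmin_le_card σ hσ
  have hk' : ∀ l, k + 1 < 2 * p * D l := by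
    intro l
    have h1 : dmin D ≤ D l := Nat.sInf_le ⟨l, rfl⟩
    have h3 : 2 * p * dmin D ≤ 2 * p * D l := Nat.mul_le_mul_left _ h1
    rw [hp] at hk
    push_cast at hk
    have h4 : (k : ℤ) + 2 ≤ ((2 * p * dmin D : ℕ) : ℤ) := by
      push_cast
      linarith
    have h5 : k + 2 ≤ 2 * p * dmin D := by exact_mod_cast h4
    omega
  rcases hj with ⟨-, hj⟩ | ⟨-, dstar, m₀, -, -, hlt, φ, xpt, hadm, -, -, j₀, s₀, hj₀, hs, rfl⟩
  · exact piMap_lift h2 hDP hE hp1 hK D k hk' j hj x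
  · exact piMap_stab h2 hDP hE hp1 hK D _ hlt k hk' j₀ hj₀ s₀ hadm hs x

end PartI

/-- For a complete non-singular fan `Σ` satisfying (2.9.2) and a subfan
`Σ(1) ⊆ Σ₁ ⊊ Σ` (so that (2.9.1) holds for `Σ₁`), for every `r`-tuple `D` of positive
integers: (i) the map `j_D : Pol*_D(S¹,X_{Σ₁}) → Ω U(K_{Σ₁})` (the lift of `i_D` when
`∑ d_k n_k = 0`, the composite `j_{D₀} ∘ s_{D,D₀}` otherwise) is a homotopy equivalence
through dimension `d(D,Σ₁)`; (ii) `i_D = (Ω q_{Σ₁}) ∘ j_D` induces an isomorphism on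
`π_k` for `2 ≤ k ≤ d(D,Σ₁)`. -/
theorem polSpace_subfan_jD_and_iD
    {n r : ℕ} (F : Fan n) (N : Fin r → Fin n → ℤ)
    (hPG : IsPrimGens F N) (hNS : F.NonSingular) (hC : F.Complete) (h2 : Cond2 N)
    (F1 : Fan n) (hsub : F1.cones ⊆ F.cones) (hne : F1.cones ≠ F.cones)
    (hrays : ∀ k, ray (zr (N k)) ∈ F1.cones) (hPG1 : IsPrimGens F1 N)
    (D : Fin r → ℕ) (hD : ∀ k, 0 < D k) :
    ∀ j : C(↥(PolSp (KC F1 N) D), Loop ↥(UK (KC F1 N)) (onesUK (empty_mem_KC F1 N))),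
      IsJD N (KC F1 N) (empty_mem_KC F1 N) D j →
        HomotopyEquivThrough j (dBound (KC F1 N) D) ∧
        ∀ k : ℕ, 2 ≤ k → (k : ℤ) ≤ dBound (KC F1 N) D →
          ∀ f₀ : ↥(PolSp (KC F1 N) D),
            Function.Bijective
              (piMap k ((loopMap (qCont N (KC F1 N)) rfl).comp j) f₀) := by
  intro j hj
  have hDP : DualProp N (KC F1 N) :=
    dualProp_of_fan F N hPG hNS (KC F1 N) fun σ hσ => hsub hσ
  have h1 := part_i h2 hDP (empty_mem_KC F1 N) D j hj
  exact ⟨h1, fun k hk2 hk f₀ =>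
    piMap_bijective_comp (piMap_loopq h2 hDP (empty_mem_KC F1 N) hk2 (j f₀)) (h1 f₀ k hk)⟩

end Toric
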